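/- Let A : ℝ^d → (symmetric real d×d matrices) be measurable, ℤ^d-periodic, and uniformly elliptic (there is μ > 1 with μ^{−1}|ξ|² ≤ ⟨A(x)ξ, ξ⟩ ≤ μ|ξ|² for all x, ξ ∈ ℝ^d), and let V ∈ L^∞(ℝ^d) be real-valued and ℤ^d-periodic. Define λ₀ := sup{λ ∈ ℝ : ∫_{ℝ^d} (⟨A∇u, ∇u⟩ + V u²) dx ≥ λ ∫_{ℝ^d} u² dx for all u ∈ C_c^∞(ℝ^d)}. Then the functional Q(u) := ∫_{ℝ^d} (⟨A∇u, ∇u⟩ + (V − λ₀) u²) dx is critical in ℝ^d if and only if d ≤ 2. -/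

import Mathlib

open MeasureTheory Filter
open scoped Topology

noncomputable section

abbrev Ed (d : ℕ) := EuclideanSpace ℝ (Fin d)

/-- A smooth compactly supported test function on ℝ^d. -/
def IsTest {d : ℕ} (u : Ed d → ℝ) : Prop :=
  ContDiff ℝ (⊤ : ℕ∞) u ∧ HasCompactSupport u

/-- The quadratic form `⟨A(x)ξ, ξ⟩ = ∑ᵢⱼ Aᵢⱼ(x) ξᵢ ξⱼ`. -/
def quadA {d : ℕ} (A : Ed d → Fin d → Fin d → ℝ) (x : Ed d) (ξ : Ed d) : ℝ :=
  ∑ i, ∑ j, A x i j * ξ i * ξ j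

/-- The functional `Q(u) = ∫ (⟨A∇u, ∇u⟩ + V u²) dx` on ℝ^d. -/
def QA {d : ℕ} (A : Ed d → Fin d → Fin d → ℝ) (V : Ed d → ℝ) (u : Ed d → ℝ) : ℝ :=
  ∫ x, (quadA A x (gradient u x) + V x * u x ^ 2)

/-- A null sequence for the functional `QA A V`. -/
def NullSeqA {d : ℕ} (A : Ed d → Fin d → Fin d → ℝ) (V : Ed d → ℝ)
    (un : ℕ → Ed d → ℝ) : Prop :=
  (∀ n, IsTest (un n)) ∧ (∀ n x, 0 ≤ un n x) ∧
  (∃ B : Set (Ed d), IsOpen B ∧ Bornology.IsBounded B ∧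
    ∀ n, (∫ x in B, un n x ^ 2) = 1) ∧
  Tendsto (fun n => QA A V (un n)) atTop (𝓝 0)

/-- A ground state of `QA A V`: a positive continuous function on ℝ^d that is the
limit of a null sequence in `L²(K)` for every compact `K`. -/
def GroundStateA {d : ℕ} (A : Ed d → Fin d → Fin d → ℝ) (V : Ed d → ℝ)
    (φ : Ed d → ℝ) : Prop :=
  Continuous φ ∧ (∀ x, 0 < φ x) ∧
  ∃ un, NullSeqA A V un ∧ ∀ K : Set (Ed d), IsCompact K →
    Tendsto (fun n => ∫ x in K, (un n x - φ x) ^ 2) atTop (𝓝 0)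

/-- `QA A V` is critical in ℝ^d. -/
def CriticalA {d : ℕ} (A : Ed d → Fin d → Fin d → ℝ) (V : Ed d → ℝ) : Prop :=
  (∀ u, IsTest u → 0 ≤ QA A V u) ∧ ∃ φ, GroundStateA A V φ

/-- bilinear form of A -/
def bilA {d : ℕ} (A : Ed d → Fin d → Fin d → ℝ) (x : Ed d) (ξ η : Ed d) : ℝ :=
  ∑ i, ∑ j, A x i j * ξ i * η j

structure Coef {d : ℕ} (A : Ed d → Fin d → Fin d → ℝ) (W : Ed d → ℝ) (μ M : ℝ) : Prop where
  mA : Measurable A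
  mW : Measurable W
  sym : ∀ x i j, A x i j = A x j i
  ell : ∀ (x : Ed d) (ξ : Ed d), μ⁻¹ * ‖ξ‖ ^ 2 ≤ quadA A x ξ ∧ quadA A x ξ ≤ μ * ‖ξ‖ ^ 2
  hμ : 1 < μ
  bW : ∀ x, |W x| ≤ M

section bil
variable {d : ℕ} {A : Ed d → Fin d → Fin d → ℝ} {W : Ed d → ℝ} {μ M : ℝ} {x : Ed d}

lemma bilA_self (ξ : Ed d) : bilA A x ξ ξ = quadA A x ξ := rfl

lemma bilA_add_left (ξ ξ' η : Ed d) : bilA A x (ξ + ξ') η = bilA A x ξ η + bilA A x ξ' η := by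
  simp only [bilA, ← Finset.sum_add_distrib, PiLp.add_apply]
  refine Finset.sum_congr rfl fun i _ => Finset.sum_congr rfl fun j _ => by ring

lemma bilA_smul_left (c : ℝ) (ξ η : Ed d) : bilA A x (c • ξ) η = c * bilA A x ξ η := by
  simp only [bilA, Finset.mul_sum, PiLp.smul_apply, smul_eq_mul]
  refine Finset.sum_congr rfl fun i _ => Finset.sum_congr rfl fun j _ => by ring

lemma bilA_comm (h : Coef A W μ M) (ξ η : Ed d) : bilA A x ξ η = bilA A x η ξ := by
  simp only [bilA]
  rw [Finset.sum_comm]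
  refine Finset.sum_congr rfl fun i _ => Finset.sum_congr rfl fun j _ => by
    rw [h.sym x j i]; ring

lemma bilA_add_right (ξ η η' : Ed d) : bilA A x ξ (η + η') = bilA A x ξ η + bilA A x ξ η' := by
  simp only [bilA, ← Finset.sum_add_distrib, PiLp.add_apply]
  refine Finset.sum_congr rfl fun i _ => Finset.sum_congr rfl fun j _ => by ring

lemma bilA_smul_right (c : ℝ) (ξ η : Ed d) : bilA A x ξ (c • η) = c * bilA A x ξ η := by
  simp only [bilA, Finset.mul_sum, PiLp.smul_apply, smul_eq_mul]
  refine Finset.sum_congr rfl fun i _ => Finset.sum_congr rfl fun j _ => by ring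

lemma quadA_add (h : Coef A W μ M) (ξ η : Ed d) :
    quadA A x (ξ + η) = quadA A x ξ + 2 * bilA A x ξ η + quadA A x η := by
  rw [← bilA_self, bilA_add_left, bilA_add_right, bilA_add_right, bilA_comm h η ξ,
    bilA_self, bilA_self]; ring

lemma quadA_smul (c : ℝ) (ξ : Ed d) : quadA A x (c • ξ) = c ^ 2 * quadA A x ξ := by
  rw [← bilA_self, bilA_smul_left, bilA_smul_right, bilA_self]; ring

lemma quadA_nonneg (h : Coef A W μ M) (ξ : Ed d) : 0 ≤ quadA A x ξ :=
  le_trans (by have := h.hμ; positivity) (h.ell x ξ).1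

lemma bilA_abs_le (h : Coef A W μ M) (ξ η : Ed d) : |bilA A x ξ η| ≤ μ * ‖ξ‖ * ‖η‖ := by
  have hμ : 0 < μ := by linarith [h.hμ]
  have key : ∀ a b : Ed d, ‖a‖ = 1 → ‖b‖ = 1 → bilA A x a b ≤ μ := by
    intro a b ha hb
    have h1 := quadA_add (x := x) h a b
    have h2 := quadA_add (x := x) h a ((-1 : ℝ) • b)
    rw [bilA_smul_right, quadA_smul] at h2
    have h3 := quadA_nonneg (x := x) h (a + (-1 : ℝ) • b)
    have h4 := (h.ell x (a + b)).2
    have h5 : ‖a + b‖ ^ 2 ≤ 4 := by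
      have : ‖a + b‖ ≤ 2 := by linarith [norm_add_le a b]
      nlinarith [norm_nonneg (a + b)]
    nlinarith
  rcases eq_or_ne ξ 0 with rfl | hξ
  · simp [bilA]
  rcases eq_or_ne η 0 with rfl | hη
  · simp [bilA]
  have n1 : 0 < ‖ξ‖ := norm_pos_iff.2 hξ
  have n2 : 0 < ‖η‖ := norm_pos_iff.2 hη
  have u1 : ‖(‖ξ‖⁻¹ : ℝ) • ξ‖ = 1 := by rw [norm_smul, norm_inv, norm_norm]; field_simp
  have u2 : ‖(‖η‖⁻¹ : ℝ) • η‖ = 1 := by rw [norm_smul, norm_inv, norm_norm]; field_simp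
  have k1 := key _ _ u1 u2
  have k2 := key ((-1 : ℝ) • (‖ξ‖⁻¹ : ℝ) • ξ) _ (by rw [norm_smul, u1]; simp) u2
  rw [bilA_smul_left, bilA_smul_left, bilA_smul_right] at k2
  rw [bilA_smul_left, bilA_smul_right] at k1
  have e : bilA A x ξ η = ‖ξ‖ * ‖η‖ * (‖ξ‖⁻¹ * (‖η‖⁻¹ * bilA A x ξ η)) := by field_simp
  rw [abs_le]
  have n3 : 0 < ‖ξ‖ * ‖η‖ := by positivity
  constructor
  · rw [e]; nlinarith
  · rw [e]; nlinarith

lemma bilA_measurable (hA : Measurable A) {F G : Ed d → Ed d} (hF : Measurable F)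
    (hG : Measurable G) : Measurable fun x => bilA A x (F x) (G x) := by
  unfold bilA
  refine Finset.measurable_sum _ fun i _ => Finset.measurable_sum _ fun j _ => ?_
  have h1 : Measurable fun x => A x i j := (measurable_pi_apply j).comp ((measurable_pi_apply i).comp hA)
  have h2 : Measurable fun x => F x i := by fun_prop
  have h3 : Measurable fun x => G x j := by fun_prop
  exact (h1.mul h2).mul h3
end bil

section grad
variable {d : ℕ} {u v : Ed d → ℝ} {x : Ed d}

lemma grad_const (c : ℝ) : gradient (fun _ : Ed d => c) x = 0 := by
  simp [gradient]

lemma hasG (h : DifferentiableAt ℝ u x) : HasFDerivAt u (InnerProductSpace.toDual ℝ (Ed d) (gradient u x)) x :=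
  h.hasGradientAt.hasFDerivAt

lemma grad_of {g : Ed d} (h : HasFDerivAt u (InnerProductSpace.toDual ℝ (Ed d) g) x) :
    gradient u x = g := (hasGradientAt_iff_hasFDerivAt.2 h).gradient

lemma grad_mul (hu : DifferentiableAt ℝ u x) (hv : DifferentiableAt ℝ v x) :
    gradient (fun y => u y * v y) x = u x • gradient v x + v x • gradient u x := by
  apply grad_of
  have := (hasG hu).fun_mul (hasG hv)
  simpa using this

lemma grad_add (hu : DifferentiableAt ℝ u x) (hv : DifferentiableAt ℝ v x) :
    gradient (fun y => u y + v y) x = gradient u x + gradient v x := by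
  apply grad_of
  have := (hasG hu).fun_add (hasG hv)
  simpa using this

lemma grad_sub_const (c : ℝ) : gradient (fun y => u y - c) x = gradient u x := by
  simp [gradient, fderiv_sub_const]

lemma grad_add_const (c : ℝ) : gradient (fun y => u y + c) x = gradient u x := by
  simp [gradient, fderiv_add_const]

lemma grad_const_mul (c : ℝ) (hu : DifferentiableAt ℝ u x) :
    gradient (fun y => c * u y) x = c • gradient u x := by
  apply grad_of
  have := (hasG hu).const_mul c
  simpa using this

lemma grad_sum {ι : Type*} (s : Finset ι) (f : ι → Ed d → ℝ)
    (hf : ∀ i ∈ s, DifferentiableAt ℝ (f i) x) :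
    gradient (fun y => ∑ i ∈ s, f i y) x = ∑ i ∈ s, gradient (f i) x := by
  apply grad_of
  have := HasFDerivAt.fun_sum (u := s) (fun i hi => hasG (hf i hi))
  simpa using this

lemma grad_comp {f : ℝ → ℝ} {f' : ℝ} (hf : HasDerivAt f f' (u x)) (hu : DifferentiableAt ℝ u x) :
    gradient (fun y => f (u y)) x = f' • gradient u x := by
  apply grad_of
  have : HasFDerivAt (fun y => f (u y)) _ x := hf.comp_hasFDerivAt x (hasG hu)
  simpa using this

lemma grad_translate (z : Ed d) : gradient (fun y => u (y + z)) x = gradient u (x + z) := by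
  simp [gradient, fderiv_comp_add_right]

lemma grad_scale (c : ℝ) (hu : DifferentiableAt ℝ u (c • x)) :
    gradient (fun y => u (c • y)) x = c • gradient u (c • x) := by
  apply grad_of
  have h2 : HasFDerivAt (fun y : Ed d => c • y) (c • ContinuousLinearMap.id ℝ (Ed d)) x :=
    (hasFDerivAt_id x).const_smul c
  have : HasFDerivAt (fun y => u (c • y)) _ x := (hasG hu).comp x h2
  refine this.congr_fderiv ?_
  ext y; simp

lemma grad_cont (hu : ContDiff ℝ 1 u) : Continuous (gradient u) := by
  unfold gradient
  exact (InnerProductSpace.toDual ℝ (Ed d)).symm.continuous.comp (hu.continuous_fderiv (by simp))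

lemma grad_norm : ‖gradient u x‖ = ‖fderiv ℝ u x‖ := by simp [gradient]

lemma grad_tsupport : tsupport (gradient u) ⊆ tsupport u := by
  refine closure_minimal ?_ (isClosed_tsupport _)
  intro x hx
  by_contra h
  apply hx
  have : fderiv ℝ u x = 0 := image_eq_zero_of_notMem_tsupport (fun h' => h (tsupport_fderiv_subset ℝ h'))
  simp [gradient, this]

lemma grad_zero_off (hx : x ∉ tsupport u) : gradient u x = 0 :=
  image_eq_zero_of_notMem_tsupport (fun h' => hx (grad_tsupport h'))

lemma grad_compact (hu : HasCompactSupport u) : HasCompactSupport (gradient u) :=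
  hu.mono' (subset_closure.trans grad_tsupport)

lemma IsTest.c1 (h : IsTest u) : ContDiff ℝ 1 u := h.1.of_le (by exact_mod_cast le_top)
lemma sm_c1 (h : ContDiff ℝ (⊤ : ℕ∞) u) : ContDiff ℝ 1 u := h.of_le (by exact_mod_cast le_top)
lemma c1_diff (h : ContDiff ℝ 1 u) : DifferentiableAt ℝ u x := h.differentiable (by simp) x

end grad

/-- energy density -/
def den {d : ℕ} (A : Ed d → Fin d → Fin d → ℝ) (W : Ed d → ℝ) (u v : Ed d → ℝ) (x : Ed d) : ℝ :=
  bilA A x (gradient u x) (gradient v x) + W x * u x * v x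

/-- bilinear functional -/
def BQ {d : ℕ} (A : Ed d → Fin d → Fin d → ℝ) (W : Ed d → ℝ) (u v : Ed d → ℝ) : ℝ :=
  ∫ x, den A W u v x

/-- squared H1 norm -/
def H1n {d : ℕ} (u : Ed d → ℝ) (x : Ed d) : ℝ := ‖gradient u x‖ ^ 2 + u x ^ 2

section den
variable {d : ℕ} {A : Ed d → Fin d → Fin d → ℝ} {W : Ed d → ℝ} {μ M : ℝ} {u v : Ed d → ℝ}

lemma QA_eq (u : Ed d → ℝ) : QA A W u = ∫ x, den A W u u x := by
  unfold QA den
  congr 1; ext x; rw [bilA_self]; ring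

lemma den_measurable (h : Coef A W μ M) (hu : ContDiff ℝ 1 u) (hv : ContDiff ℝ 1 v) :
    Measurable (den A W u v) := by
  unfold den
  exact (bilA_measurable h.mA (grad_cont hu).measurable (grad_cont hv).measurable).add
    ((h.mW.mul hu.continuous.measurable).mul hv.continuous.measurable)

lemma Mnn (h : Coef A W μ M) : 0 ≤ M := (abs_nonneg _).trans (h.bW 0)

lemma den_abs_le (h : Coef A W μ M) (x : Ed d) : |den A W u v x| ≤
    μ * ‖gradient u x‖ * ‖gradient v x‖ + M * |u x| * |v x| := by
  unfold den
  refine (abs_add_le _ _).trans (add_le_add (bilA_abs_le h _ _) ?_)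
  rw [abs_mul, abs_mul]
  gcongr
  exact h.bW x

lemma den_comm (h : Coef A W μ M) (x : Ed d) : den A W u v x = den A W v u x := by
  unfold den; rw [bilA_comm h]; ring

lemma den_self_le (h : Coef A W μ M) (x : Ed d) : |den A W u u x| ≤ (μ + M) * H1n u x := by
  refine (den_abs_le h x).trans ?_
  have := h.hμ
  have := Mnn h
  unfold H1n
  have e : |u x| * |u x| = u x ^ 2 := by rw [← abs_mul, abs_mul_self]; ring
  have : M * |u x| * |u x| = M * u x ^ 2 := by rw [mul_assoc, e]
  rw [this]
  nlinarith [sq_nonneg (u x), sq_nonneg ‖gradient u x‖, mul_nonneg (Mnn h) (sq_nonneg ‖gradient u x‖),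
    mul_nonneg (by linarith : 0 ≤ μ) (sq_nonneg (u x))]

lemma H1n_cont (hu : ContDiff ℝ 1 u) : Continuous (H1n u) := by
  unfold H1n
  exact ((grad_cont hu).norm.pow 2).add (hu.continuous.pow 2)

lemma H1n_nonneg (x : Ed d) : 0 ≤ H1n u x := by unfold H1n; positivity

lemma den_integrable (h : Coef A W μ M) (hu : ContDiff ℝ 1 u) (hv : ContDiff ℝ 1 v)
    (hc : HasCompactSupport v) : Integrable (den A W u v) := by
  have hcont : Continuous fun x => μ * ‖gradient u x‖ * ‖gradient v x‖ + M * |u x| * |v x| := by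
    have := grad_cont hu
    have := grad_cont hv
    have := hu.continuous
    have := hv.continuous
    fun_prop
  have hcs : HasCompactSupport fun x => μ * ‖gradient u x‖ * ‖gradient v x‖ + M * |u x| * |v x| := by
    refine HasCompactSupport.intro (K := tsupport v) hc ?_
    intro x hx
    simp [grad_zero_off hx, image_eq_zero_of_notMem_tsupport hx]
  refine (hcont.integrable_of_hasCompactSupport hcs).mono' (den_measurable h hu hv).aestronglyMeasurable ?_
  filter_upwards with x
  rw [Real.norm_eq_abs]; exact den_abs_le h x

lemma cont_intOn {f : Ed d → ℝ} (hf : Continuous f) {s : Set (Ed d)} (hs : Bornology.IsBounded s) :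
    IntegrableOn f s :=
  (hf.continuousOn.integrableOn_compact hs.isCompact_closure).mono_set subset_closure

lemma bm_intOn {f g : Ed d → ℝ} (hf : Measurable f) (hg : Continuous g) (hfg : ∀ x, |f x| ≤ g x)
    {s : Set (Ed d)} (hs : Bornology.IsBounded s) : IntegrableOn f s := by
  refine (cont_intOn hg hs).mono' hf.aestronglyMeasurable ?_
  filter_upwards with x
  exact hfg x

lemma den_intOn (h : Coef A W μ M) (hu : ContDiff ℝ 1 u) (hv : ContDiff ℝ 1 v)
    {s : Set (Ed d)} (hs : Bornology.IsBounded s) : IntegrableOn (den A W u v) s := by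
  refine bm_intOn (den_measurable h hu hv) (g := fun x => μ * ‖gradient u x‖ * ‖gradient v x‖ + M * |u x| * |v x|) ?_ (fun x => den_abs_le h x) hs
  have := grad_cont hu
  have := grad_cont hv
  have := hu.continuous
  have := hv.continuous
  fun_prop

lemma den_add_smul (h : Coef A W μ M) (hu : ContDiff ℝ 1 u) (hv : ContDiff ℝ 1 v) (s : ℝ) (x : Ed d) :
    den A W (fun y => u y + s * v y) (fun y => u y + s * v y) x =
      den A W u u x + 2 * s * den A W u v x + s ^ 2 * den A W v v x := by
  unfold den
  rw [grad_add (c1_diff hu) ((c1_diff hv).const_mul s), grad_const_mul s (c1_diff hv), bilA_self,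
    quadA_add h, bilA_smul_right, quadA_smul, bilA_self, bilA_self]
  ring

end den

section poinc
variable {d : ℕ} {u : Ed d → ℝ}
open scoped ENNReal

lemma line_est (hu : ContDiff ℝ 1 u) (x y : Ed d) :
    |u y - u x| ≤ ‖y - x‖ * ∫ t in Set.Icc (0:ℝ) 1, ‖gradient u (x + t • (y - x))‖ := by
  have hg := grad_cont hu
  have hc : Continuous fun t : ℝ => ‖gradient u (x + t • (y - x))‖ := by fun_prop
  have hd : ∀ t ∈ Set.uIcc (0:ℝ) 1, HasDerivAt (fun t : ℝ => u (x + t • (y - x)))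
      (inner ℝ (gradient u (x + t • (y - x))) (y - x)) t := by
    intro t _
    have h1 := hasG (c1_diff hu (x := x + t • (y - x)))
    have h2 : HasDerivAt (fun t : ℝ => x + t • (y - x)) (y - x) t := by
      simpa using ((hasDerivAt_id t).smul_const (y - x)).const_add x
    exact h1.comp_hasDerivAt t h2
  have hci : Continuous fun t : ℝ => inner ℝ (gradient u (x + t • (y - x))) (y - x) := by fun_prop
  have e := intervalIntegral.integral_eq_sub_of_hasDerivAt hd (hci.intervalIntegrable 0 1)
  have e2 : u y - u x = ∫ t in (0:ℝ)..1, inner ℝ (gradient u (x + t • (y - x))) (y - x) := by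
    rw [e]; simp
  rw [e2, ← Real.norm_eq_abs]
  refine (intervalIntegral.norm_integral_le_integral_norm (by norm_num)).trans ?_
  rw [integral_Icc_eq_integral_Ioc, ← intervalIntegral.integral_of_le (by norm_num),
    ← intervalIntegral.integral_const_mul]
  refine intervalIntegral.integral_mono_on (by norm_num) (hci.norm.intervalIntegrable 0 1)
    ((hc.const_mul _).intervalIntegrable 0 1) ?_
  intro t _
  rw [mul_comm]
  exact norm_inner_le_norm _ _

/-- Jensen for squares -/
lemma sq_integral_le {X : Type*} [MeasurableSpace X] {ν : Measure X} [IsProbabilityMeasure ν]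
    {f : X → ℝ} (hf : Integrable f ν) (hf2 : Integrable (fun x => f x ^ 2) ν) :
    (∫ x, f x ∂ν) ^ 2 ≤ ∫ x, f x ^ 2 ∂ν := by
  set c := ∫ x, f x ∂ν
  have h : ∫ x, (2 * c * f x - c ^ 2) ∂ν ≤ ∫ x, f x ^ 2 ∂ν := by
    refine integral_mono ((hf.const_mul _).sub (integrable_const _)) hf2 fun x => ?_
    nlinarith [sq_nonneg (f x - c)]
  rw [integral_sub (hf.const_mul _) (integrable_const _), integral_const_mul] at h
  simp at h
  nlinarith

lemma line_est_p (hu : ContDiff ℝ 1 u) (x y : Ed d) (p : ℕ) (hp : p = 1 ∨ p = 2) :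
    |u x - u y| ^ p ≤ ‖y - x‖ ^ p * ∫ t in Set.Icc (0:ℝ) 1, ‖gradient u (x + t • (y - x))‖ ^ p := by
  have hg := grad_cont hu
  have hc : Continuous fun t : ℝ => ‖gradient u (x + t • (y - x))‖ := by fun_prop
  have h := line_est hu x y
  rw [abs_sub_comm] at h
  rcases hp with rfl | rfl
  · simpa using h
  · have : IsProbabilityMeasure (volume.restrict (Set.Icc (0:ℝ) 1)) := ⟨by simp⟩
    calc |u x - u y| ^ 2 ≤ (‖y - x‖ * ∫ t in Set.Icc (0:ℝ) 1, ‖gradient u (x + t • (y - x))‖) ^ 2 := by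
          gcongr
      _ = ‖y - x‖ ^ 2 * (∫ t in Set.Icc (0:ℝ) 1, ‖gradient u (x + t • (y - x))‖) ^ 2 := by ring
      _ ≤ _ := by
          gcongr
          exact sq_integral_le (hc.continuousOn.integrableOn_compact isCompact_Icc)
            ((hc.pow 2).continuousOn.integrableOn_compact isCompact_Icc)

lemma line_est_e (hu : ContDiff ℝ 1 u) (x y : Ed d) (p : ℕ) (hp : p = 1 ∨ p = 2) (r : ℝ)
    (hr : ‖y - x‖ ≤ r) :
    ENNReal.ofReal (|u x - u y| ^ p) ≤ ENNReal.ofReal (r ^ p) *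
      ∫⁻ t in Set.Icc (0:ℝ) 1, ENNReal.ofReal (‖gradient u (x + t • (y - x))‖ ^ p) := by
  have hg := grad_cont hu
  have hc : Continuous fun t : ℝ => ‖gradient u (x + t • (y - x))‖ ^ p := by fun_prop
  rw [← ofReal_integral_eq_lintegral_ofReal (hc.continuousOn.integrableOn_compact isCompact_Icc)
    (ae_of_all _ fun t => by positivity), ← ENNReal.ofReal_mul (by have := norm_nonneg (y-x); have : 0 ≤ r := by linarith
                                                                   positivity)]
  apply ENNReal.ofReal_le_ofReal
  refine (line_est_p hu x y p hp).trans ?_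
  gcongr
  

lemma kernel_le {K : Set (Ed d)} (hK : Convex ℝ K) (hKm : MeasurableSet K) (r : ℝ)
    {h : Ed d → ℝ≥0∞} (hh : Measurable h) :
    ∫⁻ x in K, ∫⁻ y in K ∩ Metric.ball x r, ∫⁻ t in Set.Icc (0:ℝ) 1, h (x + t • (y - x)) ≤
      volume (Metric.ball (0 : Ed d) r) * ∫⁻ x in K, h x := by
  have hm : Measurable fun q : (Ed d × Ed d) × ℝ => K.indicator h (q.1.2 + q.2 • q.1.1) :=
    (hh.indicator hKm).comp (by fun_prop)
  have step1 : ∀ x ∈ K, ∫⁻ y in K ∩ Metric.ball x r, ∫⁻ t in Set.Icc (0:ℝ) 1, h (x + t • (y - x)) ≤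
      ∫⁻ z in Metric.ball 0 r, ∫⁻ t in Set.Icc (0:ℝ) 1, K.indicator h (x + t • z) := by
    intro x hx
    rw [← lintegral_indicator (hKm.inter Metric.isOpen_ball.measurableSet),
      ← lintegral_indicator Metric.isOpen_ball.measurableSet]
    rw [← lintegral_add_left_eq_self _ x]
    refine lintegral_mono fun z => ?_
    simp only [Set.indicator]
    split_ifs with h1 h2 h2
    · simp only [add_sub_cancel_left]
      refine setLIntegral_mono' measurableSet_Icc fun t ht => ?_
      have : x + t • z ∈ K := by
        have := hK.add_smul_sub_mem hx h1.1 ht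
        simpa using this
      simp [this]
    · exfalso
      apply h2
      have := h1.2
      simpa [Metric.mem_ball, dist_eq_norm] using this
    · simp
    · simp
  calc _ ≤ ∫⁻ x in K, ∫⁻ z in Metric.ball 0 r, ∫⁻ t in Set.Icc (0:ℝ) 1, K.indicator h (x + t • z) :=
        setLIntegral_mono' hKm step1
    _ ≤ ∫⁻ x, ∫⁻ z in Metric.ball 0 r, ∫⁻ t in Set.Icc (0:ℝ) 1, K.indicator h (x + t • z) :=
        setLIntegral_le_lintegral _ _
    _ = ∫⁻ z in Metric.ball 0 r, ∫⁻ x, ∫⁻ t in Set.Icc (0:ℝ) 1, K.indicator h (x + t • z) := by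
        rw [lintegral_lintegral_swap]
        have : Measurable fun q : (Ed d × Ed d) × ℝ => K.indicator h (q.1.1 + q.2 • q.1.2) :=
          (hh.indicator hKm).comp (by fun_prop)
        exact (Measurable.lintegral_prod_right' (ν := volume.restrict (Set.Icc (0:ℝ) 1)) this).aemeasurable
    _ = ∫⁻ z in Metric.ball (0 : Ed d) r, ∫⁻ x in K, h x := by
        refine lintegral_congr fun z => ?_
        rw [lintegral_lintegral_swap]
        · have : ∀ t : ℝ, ∫⁻ x, K.indicator h (x + t • z) = ∫⁻ x in K, h x := by
            intro t
            rw [lintegral_add_right_eq_self (fun x => K.indicator h x), lintegral_indicator hKm]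
          simp [this]
        · have : Measurable fun q : Ed d × ℝ => K.indicator h (q.1 + q.2 • z) :=
            (hh.indicator hKm).comp (by fun_prop)
          exact this.aemeasurable
    _ = _ := by simp [mul_comm]

/-- Poincare, localized double-integral form. -/
lemma poinc (hu : ContDiff ℝ 1 u) {K : Set (Ed d)} (hK : Convex ℝ K) (hKm : MeasurableSet K)
    (hKb : Bornology.IsBounded K) {r : ℝ} (hr : 0 ≤ r) (p : ℕ) (hp : p = 1 ∨ p = 2) :
    ∫ x in K, ∫ y in K ∩ Metric.ball x r, |u x - u y| ^ p ≤
      r ^ p * volume.real (Metric.ball (0 : Ed d) r) * ∫ x in K, ‖gradient u x‖ ^ p := by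
  have hg := grad_cont hu
  have hgc : Continuous fun x => ‖gradient u x‖ ^ p := by fun_prop
  have hR : 0 ≤ r ^ p * volume.real (Metric.ball (0 : Ed d) r) * ∫ x in K, ‖gradient u x‖ ^ p := by
    have : 0 ≤ ∫ x in K, ‖gradient u x‖ ^ p := integral_nonneg fun x => by positivity
    positivity
  refine (le_abs_self _).trans ?_
  rw [← Real.norm_eq_abs, ← ENNReal.ofReal_le_ofReal_iff hR, ofReal_norm]
  refine (enorm_integral_le_lintegral_enorm _).trans ?_
  calc _ ≤ ∫⁻ x in K, ∫⁻ y in K ∩ Metric.ball x r, ENNReal.ofReal (r ^ p) *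
        ∫⁻ t in Set.Icc (0:ℝ) 1, ENNReal.ofReal (‖gradient u (x + t • (y - x))‖ ^ p) := by
        refine lintegral_mono fun x => ?_
        refine (enorm_integral_le_lintegral_enorm _).trans ?_
        refine setLIntegral_mono' (hKm.inter Metric.isOpen_ball.measurableSet) fun y hy => ?_
        rw [Real.enorm_eq_ofReal (by positivity)]
        refine line_est_e hu x y p hp r ?_
        have := hy.2
        rw [Metric.mem_ball, dist_eq_norm] at this
        exact this.le
    _ = ENNReal.ofReal (r ^ p) * ∫⁻ x in K, ∫⁻ y in K ∩ Metric.ball x r,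
        ∫⁻ t in Set.Icc (0:ℝ) 1, ENNReal.ofReal (‖gradient u (x + t • (y - x))‖ ^ p) := by
        rw [← lintegral_const_mul' _ _ ENNReal.ofReal_ne_top]
        refine lintegral_congr fun x => ?_
        rw [← lintegral_const_mul' _ _ ENNReal.ofReal_ne_top]
    _ ≤ ENNReal.ofReal (r ^ p) * (volume (Metric.ball (0 : Ed d) r) * ∫⁻ x in K, ENNReal.ofReal (‖gradient u x‖ ^ p)) := by
        gcongr
        exact kernel_le hK hKm r (h := fun x => ENNReal.ofReal (‖gradient u x‖ ^ p)) (by fun_prop)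
    _ = _ := by
        rw [← ofReal_integral_eq_lintegral_ofReal (cont_intOn hgc hKb) (ae_of_all _ fun t => by positivity),
          ENNReal.ofReal_mul (by positivity), ENNReal.ofReal_mul (by positivity), mul_assoc,
          Measure.real, ENNReal.ofReal_toReal measure_ball_lt_top.ne]

/-- global form on bounded convex sets -/
lemma poinc' (hu : ContDiff ℝ 1 u) {K : Set (Ed d)} (hK : Convex ℝ K) (hKm : MeasurableSet K)
    {x0 : Ed d} {ρ : ℝ} (hρ : 0 ≤ ρ) (hKb : K ⊆ Metric.ball x0 ρ) (p : ℕ) (hp : p = 1 ∨ p = 2) :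
    ∫ x in K, ∫ y in K, |u x - u y| ^ p ≤
      (2 * ρ) ^ p * volume.real (Metric.ball (0 : Ed d) (2 * ρ)) * ∫ x in K, ‖gradient u x‖ ^ p := by
  refine le_trans (le_of_eq ?_) (poinc hu hK hKm (Metric.isBounded_ball.subset hKb) (by positivity : 0 ≤ 2 * ρ) p hp)
  refine setIntegral_congr_fun hKm fun x hx => ?_
  have : K ∩ Metric.ball x (2 * ρ) = K := by
    refine Set.inter_eq_left.2 fun y hy => ?_
    have h1 := hKb hx
    have h2 := hKb hy
    rw [Metric.mem_ball] at *
    have := dist_triangle_right y x x0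
    linarith
  simp only [this]

/-- average over a set -/
def av (u : Ed d → ℝ) (b : Set (Ed d)) : ℝ := (volume.real b)⁻¹ * ∫ y in b, u y

lemma av_prob {b : Set (Ed d)} (hb : 0 < volume.real b) :
    IsProbabilityMeasure ((volume b)⁻¹ • volume.restrict b) := by
  constructor
  have h := ENNReal.toReal_pos_iff.1 hb
  simp only [Measure.smul_apply, smul_eq_mul, Measure.restrict_apply MeasurableSet.univ, Set.univ_inter]
  exact ENNReal.inv_mul_cancel h.1.ne' h.2.ne

lemma av_eq (u : Ed d → ℝ) (b : Set (Ed d)) : av u b = ∫ y, u y ∂((volume b)⁻¹ • volume.restrict b) := by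
  rw [integral_smul_measure, ENNReal.toReal_inv]; rfl

lemma av_sq_le {b : Set (Ed d)} (hb : 0 < volume.real b) (hbb : Bornology.IsBounded b) {f : Ed d → ℝ}
    (hf : Continuous f) : (av f b) ^ 2 ≤ (volume.real b)⁻¹ * ∫ y in b, f y ^ 2 := by
  have := av_prob hb
  have h := ENNReal.toReal_pos_iff.1 hb
  have hi : (volume b)⁻¹ ≠ ⊤ := ENNReal.inv_ne_top.2 h.1.ne'
  have := sq_integral_le ((cont_intOn hf hbb).integrable.smul_measure hi)
    ((cont_intOn (hf.pow 2) hbb).integrable.smul_measure hi)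
  rw [← av_eq, ← av_eq] at this
  exact this

lemma av_const {b : Set (Ed d)} (hb : 0 < volume.real b) (c : ℝ) : av (fun _ => c) b = c := by
  unfold av
  rw [setIntegral_const, smul_eq_mul]; field_simp

lemma av_sub {b : Set (Ed d)} (hbb : Bornology.IsBounded b) {f g : Ed d → ℝ}
    (hf : Continuous f) (hg : Continuous g) : av (fun x => f x - g x) b = av f b - av g b := by
  unfold av
  rw [integral_sub (cont_intOn hf hbb) (cont_intOn hg hbb)]; ring

lemma av_mono {b : Set (Ed d)} (hbb : Bornology.IsBounded b) (hbm : MeasurableSet b) {f g : Ed d → ℝ}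
    (hf : Continuous f) (hg : Continuous g) (h : ∀ x ∈ b, f x ≤ g x) : av f b ≤ av g b := by
  unfold av
  gcongr 1
  exact setIntegral_mono_on (cont_intOn hf hbb) (cont_intOn hg hbb) hbm h

lemma poincG (hu : ContDiff ℝ 1 u) {K b : Set (Ed d)} (hK : Convex ℝ K) (hKm : MeasurableSet K)
    {x0 : Ed d} {ρ : ℝ} (hρ : 0 ≤ ρ) (hKb : K ⊆ Metric.ball x0 ρ) (hbK : b ⊆ K) (hb : 0 < volume.real b) :
    ∫ x in K, (u x - av u b) ^ 2 ≤ (volume.real b)⁻¹ * ((2 * ρ) ^ 2 *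
      volume.real (Metric.ball (0 : Ed d) (2 * ρ))) * ∫ x in K, ‖gradient u x‖ ^ 2 := by
  have hKB : Bornology.IsBounded K := Metric.isBounded_ball.subset hKb
  have hbB := hKB.subset hbK
  have h := poinc' hu hK hKm hρ hKb 2 (Or.inr rfl)
  simp only [sq_abs] at h
  rw [mul_assoc]
  refine le_trans ?_ (mul_le_mul_of_nonneg_left h (by positivity))
  rw [← integral_const_mul]
  have hu' := hu.continuous
  have hcF : Continuous fun x => ∫ y in K, (u x - u y) ^ 2 := by
    have e : (fun x => ∫ y in K, (u x - u y) ^ 2) = fun x => u x ^ 2 * volume.real K - 2 * u x * (∫ y in K, u y) + ∫ y in K, u y ^ 2 := by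
      ext x
      have i1 : IntegrableOn (fun y => u x ^ 2 - 2 * u x * u y) K := cont_intOn (by fun_prop) hKB
      have i2 : IntegrableOn (fun y => u y ^ 2) K := cont_intOn (by fun_prop) hKB
      have i3 : IntegrableOn (fun y => 2 * u x * u y) K := cont_intOn (by fun_prop) hKB
      have i4 : IntegrableOn (fun y => u x ^ 2) K := cont_intOn (by fun_prop) hKB
      calc _ = ∫ y in K, (u x ^ 2 - 2 * u x * u y + u y ^ 2) := by
            congr 1; ext y; ring
        _ = _ := by
            rw [integral_add i1 i2, integral_sub i4 i3, integral_const_mul, setIntegral_const, smul_eq_mul]; ring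
    rw [e]; fun_prop
  refine setIntegral_mono_on (cont_intOn (by fun_prop) hKB) ((cont_intOn hcF hKB).const_mul _) hKm fun x hx => ?_
  have e1 : u x - av u b = av (fun y => u x - u y) b := by
    rw [av_sub hbB continuous_const hu', av_const hb]
  rw [e1]
  refine (av_sq_le hb hbB (by fun_prop)).trans ?_
  gcongr 1
  refine setIntegral_mono_set (cont_intOn (by fun_prop) hKB) (ae_of_all _ fun y => sq_nonneg _) hbK.eventuallyLE

lemma poincG2 (hu : ContDiff ℝ 1 u) {K b b' : Set (Ed d)} (hK : Convex ℝ K) (hKm : MeasurableSet K)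
    {x0 : Ed d} {ρ : ℝ} (hρ : 0 ≤ ρ) (hKb : K ⊆ Metric.ball x0 ρ) (hbK : b ⊆ K) (hb : 0 < volume.real b)
    (hbK' : b' ⊆ K) (hb' : 0 < volume.real b') :
    (av u b' - av u b) ^ 2 ≤ (volume.real b')⁻¹ * ((volume.real b)⁻¹ * ((2 * ρ) ^ 2 *
      volume.real (Metric.ball (0 : Ed d) (2 * ρ))) * ∫ x in K, ‖gradient u x‖ ^ 2) := by
  have hKB : Bornology.IsBounded K := Metric.isBounded_ball.subset hKb
  have hu' := hu.continuous
  have e : av u b' - av u b = av (fun x => u x - av u b) b' := by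
    rw [av_sub (hKB.subset hbK') hu' continuous_const, av_const hb']
  rw [e]
  refine (av_sq_le hb' (hKB.subset hbK') (by fun_prop)).trans ?_
  gcongr 1
  refine le_trans ?_ (poincG hu hK hKm hρ hKb hbK hb)
  exact setIntegral_mono_set (cont_intOn (by fun_prop) hKB) (ae_of_all _ fun y => sq_nonneg _) hbK'.eventuallyLE

lemma ball_vol (x : Ed d) {r : ℝ} (hr : 0 < r) : volume.real (Metric.ball x r) = r ^ d * volume.real (Metric.ball (0 : Ed d) 1) := by
  have := Measure.addHaar_ball_of_pos (volume : Measure (Ed d)) x hr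
  simp only [Measure.real, this]
  rw [ENNReal.toReal_mul, ENNReal.toReal_ofReal (by positivity)]
  simp

lemma om_pos : 0 < volume.real (Metric.ball (0 : Ed d) 1) :=
  ENNReal.toReal_pos (Metric.measure_ball_pos _ _ one_pos).ne' measure_ball_lt_top.ne

lemma ball_vol_pos (x : Ed d) {r : ℝ} (hr : 0 < r) : 0 < volume.real (Metric.ball x r) :=
  ENNReal.toReal_pos (Metric.measure_ball_pos _ _ hr).ne' measure_ball_lt_top.ne

end poinc

lemma I_add {X : Type*} [MeasurableSpace X] {ν : Measure X} {f g : X → ℝ} (hf : Integrable f ν)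
    (hg : Integrable g ν) : Integrable (fun x => f x + g x) ν := hf.add hg
lemma I_sub {X : Type*} [MeasurableSpace X] {ν : Measure X} {f g : X → ℝ} (hf : Integrable f ν)
    (hg : Integrable g ν) : Integrable (fun x => f x - g x) ν := hf.sub hg

lemma cs_int {X : Type*} [MeasurableSpace X] {ν : Measure X}
    {f g : X → ℝ} (hf : Integrable (fun x => f x ^ 2) ν) (hg : Integrable (fun x => g x ^ 2) ν)
    (hfg : Integrable (fun x => f x * g x) ν) :
    (∫ x, f x * g x ∂ν) ^ 2 ≤ (∫ x, f x ^ 2 ∂ν) * ∫ x, g x ^ 2 ∂ν := by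
  have key : ∀ t : ℝ, 0 ≤ (∫ x, f x ^ 2 ∂ν) * (t * t) + (2 * ∫ x, f x * g x ∂ν) * t + ∫ x, g x ^ 2 ∂ν := by
    intro t
    have : 0 ≤ ∫ x, (t * f x + g x) ^ 2 ∂ν := integral_nonneg fun x => sq_nonneg _
    have e : ∫ x, (t * f x + g x) ^ 2 ∂ν = ∫ x, ((t * t) * f x ^ 2 + (2 * t) * (f x * g x) + g x ^ 2) ∂ν := by
      congr 1; ext x; ring
    rw [e, integral_add (I_add (hf.const_mul _) (hfg.const_mul _)) hg, integral_add (hf.const_mul _) (hfg.const_mul _),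
      integral_const_mul, integral_const_mul] at this
    linarith
  have := discrim_le_zero key
  unfold discrim at this
  nlinarith

section hid
variable {d : ℕ} {A : Ed d → Fin d → Fin d → ℝ} {W : Ed d → ℝ} {μ M : ℝ} {a b : Ed d → ℝ}

/-- Wronskian -/
def Xw (a b : Ed d → ℝ) (x : Ed d) : Ed d := a x • gradient b x + (-b x) • gradient a x

lemma Xw_cont (ha : ContDiff ℝ 1 a) (hb : ContDiff ℝ 1 b) : Continuous (Xw a b) := by
  have := grad_cont ha
  have := grad_cont hb
  have := ha.continuous
  have := hb.continuous
  unfold Xw; fun_prop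

lemma IsTest.cont (h : IsTest a) : Continuous a := h.1.continuous

lemma IsTest.integrable_cont (h : IsTest a) {f : Ed d → ℝ} (hf : Continuous f) (h0 : ∀ x, x ∉ tsupport a → f x = 0) :
    Integrable f :=
  hf.integrable_of_hasCompactSupport (HasCompactSupport.intro (K := tsupport a) h.2 h0)

lemma sqrt_hasDerivAt_help {δ : ℝ} (hδ : 0 < δ) (p : ℝ) (hp : 0 ≤ p) :
    HasDerivAt (fun t => Real.sqrt (t + δ ^ 2) - δ) (1 / (2 * Real.sqrt (p + δ ^ 2))) p := by
  have h1 : HasDerivAt (fun t : ℝ => t + δ ^ 2) 1 p := by simpa using (hasDerivAt_id p).add_const (δ ^ 2)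
  have := h1.sqrt (by positivity)
  exact this.sub_const δ

lemma hid (h : Coef A W μ M) (hpos : ∀ u, IsTest u → 0 ≤ QA A W u) (ha : IsTest a) (hb : IsTest b)
    {δ : ℝ} (hδ : 0 < δ) :
    ∫ x, ‖Xw a b x‖ ^ 2 / (a x ^ 2 + b x ^ 2 + δ ^ 2) ≤
      μ * (QA A W a + QA A W b + 2 * δ * M * ∫ x, (|a x| + |b x|)) := by
  set p : Ed d → ℝ := fun x => a x * a x + b x * b x with hp
  have hpn : ∀ x, 0 ≤ p x := fun x => add_nonneg (mul_self_nonneg _) (mul_self_nonneg _)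
  set s : Ed d → ℝ := fun x => Real.sqrt (p x + δ ^ 2) - δ with hs
  have hac := ha.cont
  have hbc := hb.cont
  have hstest : IsTest s := by
    constructor
    · refine ContDiff.sub (ContDiff.sqrt ?_ fun x => (add_pos_of_nonneg_of_pos (hpn x) (by positivity)).ne') contDiff_const
      exact ((ha.1.mul ha.1).add (hb.1.mul hb.1)).add contDiff_const
    · refine HasCompactSupport.intro (K := tsupport a ∪ tsupport b) (ha.2.isCompact.union hb.2.isCompact) ?_
      intro x hx
      simp only [Set.mem_union, not_or] at hx
      simp [hs, hp, image_eq_zero_of_notMem_tsupport hx.1, image_eq_zero_of_notMem_tsupport hx.2,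
        Real.sqrt_sq hδ.le]
  have hden : ∀ x, den A W s s x ≤ den A W a a x + den A W b b x + 2 * δ * M * (|a x| + |b x|)
      - μ⁻¹ * (‖Xw a b x‖ ^ 2 / (a x ^ 2 + b x ^ 2 + δ ^ 2)) := by
    intro x
    have da := c1_diff ha.c1 (x := x)
    have db := c1_diff hb.c1 (x := x)
    set D := p x + δ ^ 2 with hD
    have hDpos : 0 < D := by have := hpn x; positivity
    have hgs : gradient s x = (1 / Real.sqrt D) • (a x • gradient a x + b x • gradient b x) := by
      have h1 := grad_comp (u := p) (x := x) (sqrt_hasDerivAt_help hδ (p x) (hpn x)) (by fun_prop)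
      have h2 : gradient p x = (2 : ℝ) • (a x • gradient a x + b x • gradient b x) := by
        rw [hp, grad_add (by fun_prop) (by fun_prop), grad_mul da da, grad_mul db db, smul_add, two_smul, two_smul]
      rw [h2, smul_smul] at h1
      rw [h1, ← hD]
      congr 1
      field_simp
    have e1 : quadA A x (gradient s x) = (1 / D) * quadA A x (a x • gradient a x + b x • gradient b x) := by
      rw [hgs, quadA_smul, div_pow, Real.sq_sqrt hDpos.le, one_pow]
    have e2 : quadA A x (a x • gradient a x + b x • gradient b x) + quadA A x (Xw a b x)
        = p x * (quadA A x (gradient a x) + quadA A x (gradient b x)) := by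
      unfold Xw
      rw [quadA_add h, quadA_add h]
      simp only [quadA_smul, bilA_smul_left, bilA_smul_right]
      rw [bilA_comm h (gradient b x) (gradient a x)]
      simp only [hp]; ring
    have qa := quadA_nonneg (x := x) h (gradient a x)
    have qb := quadA_nonneg (x := x) h (gradient b x)
    have qX := (h.ell x (Xw a b x)).1
    have e3 : quadA A x (gradient s x) ≤ quadA A x (gradient a x) + quadA A x (gradient b x)
        - μ⁻¹ * (‖Xw a b x‖ ^ 2 / D) := by
      rw [e1, eq_sub_of_add_eq e2]
      have : (1 / D) * (p x * (quadA A x (gradient a x) + quadA A x (gradient b x))) ≤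
          quadA A x (gradient a x) + quadA A x (gradient b x) := by
        rw [← mul_assoc]
        refine mul_le_of_le_one_left (by positivity) ?_
        rw [one_div, inv_mul_le_iff₀ hDpos]; rw [hD]; nlinarith
      have h4 : μ⁻¹ * (‖Xw a b x‖ ^ 2 / D) ≤ 1 / D * quadA A x (Xw a b x) := by
        calc _ = 1 / D * (μ⁻¹ * ‖Xw a b x‖ ^ 2) := by ring
          _ ≤ _ := by gcongr
      rw [mul_sub]; linarith
    have hsq : Real.sqrt D ^ 2 = D := Real.sq_sqrt hDpos.le
    have hsx : s x = Real.sqrt D - δ := rfl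
    have hs0 : 0 ≤ s x := by
      rw [hsx, sub_nonneg]; apply Real.le_sqrt_of_sq_le; have := hpn x; rw [hD]; linarith
    have hs1 : s x ≤ |a x| + |b x| := by
      rw [hsx, sub_le_iff_le_add]
      apply Real.sqrt_le_iff.2 ⟨by positivity, ?_⟩
      rw [hD]
      simp only [hp]
      have := abs_mul_abs_self (a x)
      have := abs_mul_abs_self (b x)
      nlinarith [abs_nonneg (a x), abs_nonneg (b x), mul_nonneg (abs_nonneg (a x)) (abs_nonneg (b x)),
        mul_nonneg (abs_nonneg (a x)) hδ.le, mul_nonneg (abs_nonneg (b x)) hδ.le]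
    have e4 : s x ^ 2 = p x - 2 * δ * s x := by
      rw [hsx]; nlinarith
    have e5 : W x * s x * s x ≤ W x * a x * a x + W x * b x * b x + 2 * δ * M * (|a x| + |b x|) := by
      have : W x * s x * s x = W x * a x * a x + W x * b x * b x + 2 * δ * (-W x * s x) := by
        have : W x * s x * s x = W x * (s x ^ 2) := by ring
        rw [this, e4]; simp only [hp]; ring
      rw [this]
      have h6 : -W x * s x ≤ M * (|a x| + |b x|) := by
        have h7 := (abs_le.1 (h.bW x)).1
        have := Mnn h
        calc -W x * s x ≤ M * s x := by gcongr; linarith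
          _ ≤ _ := by gcongr
      have := mul_le_mul_of_nonneg_left h6 (by positivity : 0 ≤ 2 * δ)
      linarith
    have hDD : a x ^ 2 + b x ^ 2 + δ ^ 2 = D := by rw [hD]; simp only [hp]; ring
    rw [hDD]
    unfold den
    rw [bilA_self, bilA_self, bilA_self]
    linarith
  have iX : Integrable fun x => ‖Xw a b x‖ ^ 2 / (a x ^ 2 + b x ^ 2 + δ ^ 2) := by
    refine ha.integrable_cont ?_ ?_
    · refine Continuous.div (by have := Xw_cont ha.c1 hb.c1; fun_prop) (by fun_prop) fun x => by positivity
    · intro x hx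
      simp [Xw, grad_zero_off hx, image_eq_zero_of_notMem_tsupport hx]
  have ia := den_integrable h ha.c1 ha.c1 ha.2
  have ib := den_integrable h hb.c1 hb.c1 hb.2
  have iab : Integrable fun x => |a x| + |b x| :=
    (ha.integrable_cont (by fun_prop) (fun x hx => by simp [image_eq_zero_of_notMem_tsupport hx])).add
    (hb.integrable_cont (by fun_prop) (fun x hx => by simp [image_eq_zero_of_notMem_tsupport hx]))
  have h1 := hpos s hstest
  rw [QA_eq] at h1
  have h2 := integral_mono (den_integrable h hstest.c1 hstest.c1 hstest.2)
    (I_sub (I_add (I_add ia ib) (iab.const_mul (2 * δ * M))) (iX.const_mul μ⁻¹)) hden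
  have h3 := h1.trans h2
  rw [integral_sub (I_add (I_add ia ib) (iab.const_mul (2 * δ * M))) (iX.const_mul μ⁻¹),
    integral_add (I_add ia ib) (iab.const_mul (2 * δ * M)), integral_add ia ib, integral_const_mul, integral_const_mul,
    ← QA_eq, ← QA_eq] at h3
  have hμ : 0 < μ := by linarith [h.hμ]
  rw [sub_nonneg, inv_mul_le_iff₀ hμ] at h3
  exact h3

lemma hidE (h : Coef A W μ M) (hpos : ∀ u, IsTest u → 0 ≤ QA A W u) (ha : IsTest a) (hb : IsTest b)
    {E : Set (Ed d)} (hEb : Bornology.IsBounded E) :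
    (∫ x in E, ‖Xw a b x‖) ^ 2 ≤ μ * (QA A W a + QA A W b) * ∫ x in E, (a x ^ 2 + b x ^ 2) := by
  have hac := ha.cont
  have hbc := hb.cont
  have hX := Xw_cont ha.c1 hb.c1
  have key : ∀ δ : ℝ, 0 < δ → (∫ x in E, ‖Xw a b x‖) ^ 2 ≤
      (μ * (QA A W a + QA A W b + 2 * δ * M * ∫ x, (|a x| + |b x|))) *
        ((∫ x in E, (a x ^ 2 + b x ^ 2)) + δ ^ 2 * volume.real E) := by
    intro δ hδ
    have hDp : ∀ x, 0 < a x ^ 2 + b x ^ 2 + δ ^ 2 := fun x => by positivity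
    have hsq : ∀ x, Real.sqrt (a x ^ 2 + b x ^ 2 + δ ^ 2) ≠ 0 := fun x => (Real.sqrt_pos.2 (hDp x)).ne'
    have hc1 : Continuous fun x => ‖Xw a b x‖ / Real.sqrt (a x ^ 2 + b x ^ 2 + δ ^ 2) :=
      Continuous.div (by fun_prop) (by fun_prop) hsq
    have hc2 : Continuous fun x => Real.sqrt (a x ^ 2 + b x ^ 2 + δ ^ 2) := by fun_prop
    have := cs_int (ν := volume.restrict E) (cont_intOn (hc1.pow 2) hEb) (cont_intOn (hc2.pow 2) hEb)
      (cont_intOn (hc1.mul hc2) hEb)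
    have e1 : ∀ x, ‖Xw a b x‖ / Real.sqrt (a x ^ 2 + b x ^ 2 + δ ^ 2) * Real.sqrt (a x ^ 2 + b x ^ 2 + δ ^ 2) = ‖Xw a b x‖ :=
      fun x => div_mul_cancel₀ _ (hsq x)
    simp only [e1, div_pow, Real.sq_sqrt (hDp _).le] at this
    refine this.trans ?_
    have h1 := hid h hpos ha hb hδ
    have h2 : ∫ x in E, ‖Xw a b x‖ ^ 2 / (a x ^ 2 + b x ^ 2 + δ ^ 2) ≤ ∫ x, ‖Xw a b x‖ ^ 2 / (a x ^ 2 + b x ^ 2 + δ ^ 2) := by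
      refine setIntegral_le_integral ?_ (ae_of_all _ fun x => by positivity)
      refine ha.integrable_cont ?_ ?_
      · refine Continuous.div (by fun_prop) (by fun_prop) fun x => by positivity
      · intro x hx
        simp [Xw, grad_zero_off hx, image_eq_zero_of_notMem_tsupport hx]
    have h3 : ∫ x in E, (a x ^ 2 + b x ^ 2 + δ ^ 2) = (∫ x in E, (a x ^ 2 + b x ^ 2)) + δ ^ 2 * volume.real E := by
      rw [integral_add (cont_intOn (by fun_prop) hEb) (cont_intOn (by fun_prop) hEb), setIntegral_const, smul_eq_mul]
      ring
    rw [h3]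
    have h4 : 0 ≤ ∫ x in E, (a x ^ 2 + b x ^ 2) := integral_nonneg fun x => by positivity
    gcongr
    exact h2.trans h1
  have hlim : Tendsto (fun δ : ℝ => (μ * (QA A W a + QA A W b + 2 * δ * M * ∫ x, (|a x| + |b x|))) *
        ((∫ x in E, (a x ^ 2 + b x ^ 2)) + δ ^ 2 * volume.real E)) (𝓝[>] 0)
        (𝓝 ((μ * (QA A W a + QA A W b + 2 * 0 * M * ∫ x, (|a x| + |b x|))) *
        ((∫ x in E, (a x ^ 2 + b x ^ 2)) + 0 ^ 2 * volume.real E))) := by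
    apply Tendsto.mono_left _ nhdsWithin_le_nhds
    apply Continuous.tendsto
    fun_prop
  have := ge_of_tendsto hlim (by filter_upwards [self_mem_nhdsWithin] with δ hδ; exact key δ hδ)
  simpa using this

end hid

/-- smooth truncation from below -/
def bet (m t : ℝ) : ℝ := m / 2 + (t - m / 2) * Real.smoothTransition (4 / m * t - 2)

section bet
variable {m : ℝ}
lemma bet_smooth : ContDiff ℝ (⊤ : ℕ∞) (bet m) := by
  unfold bet
  refine contDiff_const.add ((contDiff_id.sub contDiff_const).mul (Real.smoothTransition.contDiff.comp ?_))
  exact (contDiff_const.mul contDiff_id).sub contDiff_const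

lemma bet_eq (hm : 0 < m) {t : ℝ} (ht : 3 * m / 4 ≤ t) : bet m t = t := by
  unfold bet
  rw [Real.smoothTransition.one_of_one_le]
  · ring
  · have : 4 / m * (3 * m / 4) ≤ 4 / m * t := by gcongr
    have e : 4 / m * (3 * m / 4) = 3 := by field_simp
    linarith

lemma bet_low (hm : 0 < m) {t : ℝ} (ht : t ≤ m / 2) : bet m t = m / 2 := by
  unfold bet
  rw [Real.smoothTransition.zero_of_nonpos]
  · ring
  · have : 4 / m * t ≤ 4 / m * (m / 2) := by gcongr
    have e : 4 / m * (m / 2) = 2 := by field_simp; norm_num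
    linarith

lemma bet_ge (hm : 0 < m) (t : ℝ) : m / 2 ≤ bet m t := by
  rcases le_total t (m / 2) with h | h
  · exact (bet_low hm h).ge
  · unfold bet
    have := Real.smoothTransition.nonneg (4 / m * t - 2)
    nlinarith

lemma bet_le (hm : 0 < m) (t : ℝ) : bet m t ≤ max t (m / 2) := by
  rcases le_total t (m / 2) with h | h
  · rw [bet_low hm h]; exact le_max_right _ _
  · refine le_trans ?_ (le_max_left _ _)
    unfold bet
    have := Real.smoothTransition.le_one (4 / m * t - 2)
    nlinarith

lemma bet_pos (hm : 0 < m) (t : ℝ) : 0 < bet m t := lt_of_lt_of_le (by positivity) (bet_ge hm t)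

lemma bet_diff (t : ℝ) : HasDerivAt (bet m) (deriv (bet m) t) t :=
  ((bet_smooth (m := m)).differentiable (by simp) t).hasDerivAt

lemma bet_deriv_one (hm : 0 < m) {t : ℝ} (ht : m ≤ t) : deriv (bet m) t = 1 := by
  have : bet m =ᶠ[𝓝 t] id := by
    filter_upwards [Ioi_mem_nhds (by linarith : 3 * m / 4 < t)] with s hs
    exact bet_eq hm (le_of_lt hs)
  rw [this.deriv_eq]; simp

lemma bet_deriv_bdd (m : ℝ) : ∃ C, 0 ≤ C ∧ ∀ t ∈ Set.Icc 0 m, |deriv (bet m) t| ≤ C := by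
  have hc : Continuous (deriv (bet m)) := (bet_smooth (m := m)).continuous_deriv (by simp)
  obtain ⟨C, hC⟩ := isCompact_Icc.exists_bound_of_continuousOn (s := Set.Icc 0 m) hc.continuousOn
  exact ⟨max C 0, le_max_right _ _, fun t ht => (hC t ht).trans (le_max_left _ _)⟩

lemma bet_sub (hm : 0 < m) {t w : ℝ} (hw : 2 * m ≤ w) : |bet m t - w| ≤ 2 * |t - w| := by
  rcases le_total (3 * m / 4) t with h | h
  · rw [bet_eq hm h]; linarith [abs_nonneg (t - w)]
  · have h1 := bet_ge hm t
    have h2 := (bet_le hm t).trans (max_le h (by linarith : m / 2 ≤ 3 * m / 4))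
    rw [abs_of_nonpos (by linarith), abs_of_nonpos (by linarith)]
    linarith

lemma bet_inv_sub (hm : 0 < m) {t w : ℝ} (hw : 2 * m ≤ w) :
    |(bet m t)⁻¹ - w⁻¹| ≤ 2 / m ^ 2 * |t - w| := by
  have hb := bet_pos hm t
  have hb1 := bet_ge hm t
  have hw0 : 0 < w := by linarith
  rw [inv_sub_inv hb.ne' hw0.ne', abs_div, abs_of_pos (mul_pos hb hw0), div_le_iff₀ (mul_pos hb hw0)]
  have h1 := bet_sub hm (t := t) hw
  rw [abs_sub_comm] at h1
  have h2 : m ^ 2 ≤ bet m t * w := by nlinarith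
  calc |w - bet m t| ≤ 2 * |t - w| := h1
    _ = 2 / m ^ 2 * |t - w| * m ^ 2 := by field_simp
    _ ≤ _ := by gcongr
end bet

section quot
variable {d : ℕ} {a u : Ed d → ℝ} {m : ℝ}

/-- truncated quotient -/
def quo (m : ℝ) (a u : Ed d → ℝ) (x : Ed d) : ℝ := a x * (bet m (u x))⁻¹

lemma quo_smooth (hm : 0 < m) (ha : ContDiff ℝ 1 a) (hu : ContDiff ℝ 1 u) : ContDiff ℝ 1 (quo m a u) := by
  unfold quo
  have h1 : ContDiff ℝ 1 (bet m) := (bet_smooth (m := m)).of_le (by exact_mod_cast le_top)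
  exact ha.mul (ContDiff.inv (h1.comp hu) fun x => (bet_pos hm _).ne')

lemma quo_grad (hm : 0 < m) (ha : ContDiff ℝ 1 a) (hu : ContDiff ℝ 1 u) (x : Ed d) :
    gradient (quo m a u) x = (bet m (u x))⁻¹ • gradient a x +
      (-(a x * deriv (bet m) (u x) / bet m (u x) ^ 2)) • gradient u x := by
  have h1 : HasDerivAt (fun t => (bet m t)⁻¹) (-deriv (bet m) (u x) / bet m (u x) ^ 2) (u x) :=
    (bet_diff (u x)).fun_inv (bet_pos hm _).ne'
  have hq := quo_smooth hm (contDiff_const (c := (1:ℝ))) hu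
  unfold quo at hq ⊢
  simp only [one_mul] at hq
  rw [grad_mul (c1_diff ha) (c1_diff hq), grad_comp h1 (c1_diff hu), smul_smul, add_comm]
  congr 2; ring

lemma quo_grad_hi (hm : 0 < m) (ha : ContDiff ℝ 1 a) (hu : ContDiff ℝ 1 u) {x : Ed d} (hx : m ≤ u x) :
    ‖gradient (quo m a u) x‖ = ‖Xw a u x‖ / u x ^ 2 := by
  have hp : 0 < u x := by linarith
  have e : gradient (quo m a u) x = (-(u x ^ 2)⁻¹) • Xw a u x := by
    rw [quo_grad hm ha hu, bet_deriv_one hm hx, bet_eq hm (by linarith), Xw, smul_add, smul_smul, smul_smul, add_comm]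
    congr 2
    · ring
    · field_simp
  rw [e, norm_smul, norm_neg, norm_inv, norm_pow, Real.norm_of_nonneg hp.le]
  field_simp

lemma quo_grad_lo (hm : 0 < m) (ha : ContDiff ℝ 1 a) (hu : ContDiff ℝ 1 u) {C : ℝ} (hC0 : 0 ≤ C)
    (hC : ∀ t ∈ Set.Icc 0 m, |deriv (bet m) t| ≤ C) {x : Ed d} (h0 : 0 ≤ u x) (hx : u x ≤ m) :
    ‖gradient (quo m a u) x‖ ≤ (2 / m + 4 * C / m) * ‖gradient a x‖ + 4 * C / m ^ 2 * ‖Xw a u x‖ := by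
  set β := bet m (u x) with hβ
  set β' := deriv (bet m) (u x)
  have hβ1 : m / 2 ≤ β := bet_ge hm _
  have hβ0 : 0 < β := bet_pos hm _
  have e : gradient (quo m a u) x = (β⁻¹ - u x * β' / β ^ 2) • gradient a x + (-(β' / β ^ 2)) • Xw a u x := by
    rw [quo_grad hm ha hu, Xw]
    module
  have hi : β⁻¹ ≤ 2 / m := by
    rw [inv_le_comm₀ hβ0 (by positivity), inv_div]; exact hβ1
  have hb : |β' / β ^ 2| ≤ 4 * C / m ^ 2 := by
    rw [abs_div, abs_of_pos (by positivity : 0 < β ^ 2), div_eq_mul_inv, ← inv_pow]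
    calc |β'| * β⁻¹ ^ 2 ≤ C * (2 / m) ^ 2 := by
          gcongr
          exact hC _ ⟨h0, hx⟩
      _ = _ := by ring
  rw [e]
  refine (norm_add_le _ _).trans ?_
  rw [norm_smul, norm_smul, norm_neg, Real.norm_eq_abs, Real.norm_eq_abs]
  gcongr
  refine (abs_sub _ _).trans ?_
  rw [abs_of_pos (by positivity : 0 < β⁻¹), mul_div_assoc, abs_mul, abs_of_nonneg h0]
  have : u x * |β' / β ^ 2| ≤ m * (4 * C / m ^ 2) := by gcongr
  have e2 : m * (4 * C / m ^ 2) = 4 * C / m := by field_simp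
  linarith
end quot

section lemR
variable {d : ℕ} {A : Ed d → Fin d → Fin d → ℝ} {W : Ed d → ℝ} {μ M : ℝ}
  {u a : ℕ → Ed d → ℝ} {φ α : Ed d → ℝ} {S : Set (Ed d)} {m : ℝ}

lemma exists_cut (R : ℝ) : ∃ χ : Ed d → ℝ, IsTest χ ∧ (∀ x, 0 ≤ χ x ∧ χ x ≤ 1) ∧
    (∀ x ∈ Metric.ball (0 : Ed d) R, χ x = 1) ∧ (∀ x ∈ Metric.ball (0 : Ed d) R, gradient χ x = 0) := by
  let f : ContDiffBump (0 : Ed d) := ⟨|R| + 1, |R| + 2, by positivity, by linarith⟩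
  have h1 : ∀ x ∈ Metric.ball (0 : Ed d) R, f x = 1 := by
    intro x hx
    refine f.one_of_mem_closedBall ?_
    refine Metric.ball_subset_closedBall (Metric.ball_subset_ball ?_ hx)
    show R ≤ |R| + 1
    linarith [le_abs_self R]
  refine ⟨f, ⟨f.contDiff, f.hasCompactSupport⟩, fun x => ⟨f.nonneg, f.le_one⟩, h1, ?_⟩
  intro x hx
  have : (f : Ed d → ℝ) =ᶠ[𝓝 x] fun _ => 1 := by
    filter_upwards [Metric.isOpen_ball.mem_nhds hx] with y hy using h1 y hy
  have h2 : fderiv ℝ (f : Ed d → ℝ) x = 0 := by rw [this.fderiv_eq]; simp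
  simp [gradient, h2]


lemma smallE (hm : 0 < m) (hSb : Bornology.IsBounded S) (hSm : MeasurableSet S) (hu : ∀ n, Continuous (u n))
    (hφ : Continuous φ) (hφm : ∀ x ∈ S, 2 * m ≤ φ x)
    (hL : Tendsto (fun n => ∫ x in S, (u n x - φ x) ^ 2) atTop (𝓝 0)) :
    Tendsto (fun n => volume.real (S ∩ {x | u n x < m})) atTop (𝓝 0) := by
  have hE : ∀ n, MeasurableSet (S ∩ {x | u n x < m}) := fun n =>
    hSm.inter (isOpen_lt (hu n) continuous_const).measurableSet
  refine squeeze_zero (g := fun n => (m ^ 2)⁻¹ * ∫ x in S, (u n x - φ x) ^ 2) (fun n => measureReal_nonneg) (fun n => ?_) (by simpa using hL.const_mul (m ^ 2)⁻¹)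
  rw [← div_eq_inv_mul, le_div_iff₀ (by positivity), mul_comm]
  have hc : Continuous fun x => (u n x - φ x) ^ 2 := by have := hu n; fun_prop
  calc m ^ 2 * volume.real (S ∩ {x | u n x < m}) = ∫ x in S ∩ {x | u n x < m}, m ^ 2 := by
        rw [setIntegral_const, smul_eq_mul, mul_comm]
    _ ≤ ∫ x in S ∩ {x | u n x < m}, (u n x - φ x) ^ 2 := by
        refine setIntegral_mono_on (cont_intOn continuous_const (hSb.subset Set.inter_subset_left))
          (cont_intOn hc (hSb.subset Set.inter_subset_left)) (hE n) fun x hx => ?_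
        have h1 := hφm x hx.1
        have h2 : u n x < m := hx.2
        nlinarith
    _ ≤ _ := setIntegral_mono_set (cont_intOn hc hSb) (ae_of_all _ fun x => sq_nonneg _)
        Set.inter_subset_left.eventuallyLE

lemma smallE2 (hm : 0 < m) (hSb : Bornology.IsBounded S) (hSm : MeasurableSet S) (hu : ∀ n, Continuous (u n))
    (hφ : Continuous φ) (hφm : ∀ x ∈ S, 2 * m ≤ φ x)
    (hL : Tendsto (fun n => ∫ x in S, (u n x - φ x) ^ 2) atTop (𝓝 0))
    (ha : ∀ n, Continuous (a n)) (hα : Continuous α)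
    (hLa : Tendsto (fun n => ∫ x in S, (a n x - α x) ^ 2) atTop (𝓝 0)) :
    Tendsto (fun n => ∫ x in S ∩ {x | u n x < m}, (a n x) ^ 2) atTop (𝓝 0) := by
  have hE : ∀ n, MeasurableSet (S ∩ {x | u n x < m}) := fun n =>
    hSm.inter (isOpen_lt (hu n) continuous_const).measurableSet
  obtain ⟨C, hC⟩ := hSb.isCompact_closure.exists_bound_of_continuousOn hα.continuousOn
  have hlim : Tendsto (fun n => 2 * (∫ x in S, (a n x - α x) ^ 2) + 2 * C ^ 2 * volume.real (S ∩ {x | u n x < m})) atTop (𝓝 0) := by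
    simpa using (hLa.const_mul 2).add ((smallE hm hSb hSm hu hφ hφm hL).const_mul (2 * C ^ 2))
  refine squeeze_zero (fun n => integral_nonneg fun x => sq_nonneg _) (fun n => ?_) hlim
  have hc : Continuous fun x => (a n x - α x) ^ 2 := by have := ha n; fun_prop
  have hEb : Bornology.IsBounded (S ∩ {x | u n x < m}) := hSb.subset Set.inter_subset_left
  calc ∫ x in S ∩ {x | u n x < m}, (a n x) ^ 2 ≤ ∫ x in S ∩ {x | u n x < m}, (2 * (a n x - α x) ^ 2 + 2 * C ^ 2) := by
        refine setIntegral_mono_on (cont_intOn ((ha n).pow 2) hEb)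
          (cont_intOn (by fun_prop) hEb) (hE n) fun x hx => ?_
        have h1 := hC x (subset_closure hx.1)
        rw [Real.norm_eq_abs] at h1
        have h2 : α x ^ 2 ≤ C ^ 2 := sq_le_sq' (by linarith [neg_abs_le (α x)]) ((le_abs_self _).trans h1)
        nlinarith [sq_nonneg (a n x - 2 * α x)]
    _ = 2 * (∫ x in S ∩ {x | u n x < m}, (a n x - α x) ^ 2) + 2 * C ^ 2 * volume.real (S ∩ {x | u n x < m}) := by
        rw [integral_add (cont_intOn (by fun_prop) hEb) (cont_intOn (by fun_prop) hEb), integral_const_mul,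
          setIntegral_const, smul_eq_mul]; ring
    _ ≤ _ := by
        gcongr 2 * ?_ + _
        exact setIntegral_mono_set (cont_intOn hc hSb) (ae_of_all _ fun x => sq_nonneg _)
          Set.inter_subset_left.eventuallyLE

lemma grad_E (h : Coef A W μ M) (hpos : ∀ u, IsTest u → 0 ≤ QA A W u) (hSb : Bornology.IsBounded S) :
    ∃ C, 0 ≤ C ∧ ∀ (w : Ed d → ℝ), IsTest w → ∀ E ⊆ S, MeasurableSet E → (∫ x in E, ‖gradient w x‖) ^ 2 ≤
      μ * (C + QA A W w) * (volume.real E + ∫ x in E, w x ^ 2) := by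
  obtain ⟨R, hR⟩ := hSb.subset_ball (0 : Ed d)
  obtain ⟨χ, hχ, -, h1, h2⟩ := exists_cut (d := d) R
  refine ⟨QA A W χ, hpos χ hχ, fun w hw E hE hEm => ?_⟩
  have hEb := hSb.subset hE
  have := hidE h hpos hχ hw hEb
  have e1 : ∫ x in E, ‖Xw χ w x‖ = ∫ x in E, ‖gradient w x‖ := by
    refine setIntegral_congr_fun hEm fun x hx => ?_
    simp [Xw, h1 x (hR (hE hx)), h2 x (hR (hE hx))]
  have e2 : ∫ x in E, (χ x ^ 2 + w x ^ 2) = volume.real E + ∫ x in E, w x ^ 2 := by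
    have := hw.cont
    have e3 : ∫ x in E, (χ x ^ 2 + w x ^ 2) = ∫ x in E, (1 + w x ^ 2) :=
      setIntegral_congr_fun hEm fun x hx => by simp [h1 x (hR (hE hx))]
    rw [e3, integral_add (cont_intOn (by fun_prop) hEb) (cont_intOn (by fun_prop) hEb), setIntegral_const]
    simp
  rw [e1, e2] at this
  exact this

lemma lemR (h : Coef A W μ M) (hpos : ∀ u, IsTest u → 0 ≤ QA A W u)
    (hm : 0 < m) (hSb : Bornology.IsBounded S) (hSm : MeasurableSet S) (hu : ∀ n, IsTest (u n))
    (hu0 : ∀ n x, 0 ≤ u n x) (ha : ∀ n, IsTest (a n)) {CQ : ℝ} (hQu : ∀ n, QA A W (u n) ≤ CQ)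
    (hQa : ∀ n, QA A W (a n) ≤ CQ)
    (hφ : Continuous φ) (hφm : ∀ x ∈ S, 2 * m ≤ φ x)
    (hL : Tendsto (fun n => ∫ x in S, (u n x - φ x) ^ 2) atTop (𝓝 0)) (hα : Continuous α)
    (hLa : Tendsto (fun n => ∫ x in S, (a n x - α x) ^ 2) atTop (𝓝 0)) :
    Tendsto (fun n => ∫ x in S ∩ {x | u n x < m}, ‖gradient (quo m (a n) (u n)) x‖) atTop (𝓝 0) := by
  have hE : ∀ n, MeasurableSet (S ∩ {x | u n x < m}) := fun n =>
    hSm.inter (isOpen_lt (hu n).cont continuous_const).measurableSet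
  obtain ⟨C, hC0, hC⟩ := grad_E h hpos hSb
  obtain ⟨C1, hC10, hC1⟩ := bet_deriv_bdd m
  have hv := smallE hm hSb hSm (fun n => (hu n).cont) hφ hφm hL
  have hv2 := smallE2 hm hSb hSm (fun n => (hu n).cont) hφ hφm hL (fun n => (ha n).cont) hα hLa
  have hμ : 0 < μ := by linarith [h.hμ]
  set v := fun n => volume.real (S ∩ {x | u n x < m})
  set w := fun n => ∫ x in S ∩ {x | u n x < m}, (a n x) ^ 2
  have hw0 : ∀ n, 0 ≤ w n := fun n => integral_nonneg fun x => sq_nonneg _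
  have hv0 : ∀ n, 0 ≤ v n := fun n => measureReal_nonneg
  have hlim : Tendsto (fun n => (2 / m + 4 * C1 / m) * Real.sqrt (μ * (C + CQ) * (v n + w n)) +
      4 * C1 / m ^ 2 * Real.sqrt (μ * (CQ + CQ) * (w n + m ^ 2 * v n))) atTop (𝓝 0) := by
    have h1 : Tendsto (fun n => Real.sqrt (μ * (C + CQ) * (v n + w n))) atTop (𝓝 0) := by
      have := ((hv.add hv2).const_mul (μ * (C + CQ))).sqrt
      simpa using this
    have h2 : Tendsto (fun n => Real.sqrt (μ * (CQ + CQ) * (w n + m ^ 2 * v n))) atTop (𝓝 0) := by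
      have := ((hv2.add (hv.const_mul (m ^ 2))).const_mul (μ * (CQ + CQ))).sqrt
      simpa using this
    simpa using (h1.const_mul (2 / m + 4 * C1 / m)).add (h2.const_mul (4 * C1 / m ^ 2))
  refine squeeze_zero (fun n => integral_nonneg fun x => norm_nonneg _) (fun n => ?_) hlim
  have hEb : Bornology.IsBounded (S ∩ {x | u n x < m}) := hSb.subset Set.inter_subset_left
  have cg := grad_cont (ha n).c1
  have cX := Xw_cont (ha n).c1 (hu n).c1
  have cq := grad_cont (quo_smooth hm (ha n).c1 (hu n).c1)
  have uc := (hu n).cont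
  have ac := (ha n).cont
  calc _ ≤ ∫ x in S ∩ {x | u n x < m}, ((2 / m + 4 * C1 / m) * ‖gradient (a n) x‖ + 4 * C1 / m ^ 2 * ‖Xw (a n) (u n) x‖) := by
        refine setIntegral_mono_on (cont_intOn (by fun_prop) hEb) (cont_intOn (by fun_prop) hEb) (hE n) fun x hx => ?_
        exact quo_grad_lo hm (ha n).c1 (hu n).c1 hC10 hC1 (hu0 n x) (le_of_lt hx.2)
    _ = (2 / m + 4 * C1 / m) * (∫ x in S ∩ {x | u n x < m}, ‖gradient (a n) x‖) +
          4 * C1 / m ^ 2 * ∫ x in S ∩ {x | u n x < m}, ‖Xw (a n) (u n) x‖ := by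
        rw [integral_add (cont_intOn (by fun_prop) hEb) (cont_intOn (by fun_prop) hEb), integral_const_mul, integral_const_mul]
    _ ≤ _ := by
        gcongr
        · apply Real.le_sqrt_of_sq_le
          refine (hC (a n) (ha n) _ Set.inter_subset_left (hE n)).trans ?_
          have := hw0 n
          have := hv0 n
          have := hQa n
          show μ * (C + QA A W (a n)) * (v n + w n) ≤ _
          gcongr
        · apply Real.le_sqrt_of_sq_le
          refine (hidE h hpos (ha n) (hu n) hEb).trans ?_
          have := hw0 n
          have := hv0 n
          have := hQa n
          have := hQu n
          have h4 : ∫ x in S ∩ {x | u n x < m}, (a n x ^ 2 + u n x ^ 2) ≤ w n + m ^ 2 * v n := by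
            rw [integral_add (cont_intOn (by fun_prop) hEb) (cont_intOn (by fun_prop) hEb)]
            gcongr
            calc ∫ x in S ∩ {x | u n x < m}, u n x ^ 2 ≤ ∫ x in S ∩ {x | u n x < m}, m ^ 2 := by
                  refine setIntegral_mono_on (cont_intOn (by fun_prop) hEb) (cont_intOn (by fun_prop) hEb) (hE n) fun x hx => ?_
                  have h2 : u n x < m := hx.2
                  have := hu0 n x
                  gcongr
              _ = _ := by rw [setIntegral_const, smul_eq_mul, mul_comm]
          have h5 : 0 ≤ ∫ x in S ∩ {x | u n x < m}, (a n x ^ 2 + u n x ^ 2) := integral_nonneg fun x => by positivity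
          have := hpos _ (ha n)
          have := hpos _ (hu n)
          have : 0 ≤ CQ := by linarith
          gcongr
end lemR

section N4
variable {d : ℕ} {A : Ed d → Fin d → Fin d → ℝ} {W : Ed d → ℝ} {μ M : ℝ}
  {u a : ℕ → Ed d → ℝ} {φ α : Ed d → ℝ} {S : Set (Ed d)} {m : ℝ}

lemma L2_set (hu : ∀ n, Continuous (u n)) (hφ : Continuous φ) (hS : Bornology.IsBounded S)
    (hL : ∀ K : Set (Ed d), IsCompact K → Tendsto (fun n => ∫ x in K, (u n x - φ x) ^ 2) atTop (𝓝 0)) :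
    Tendsto (fun n => ∫ x in S, (u n x - φ x) ^ 2) atTop (𝓝 0) := by
  refine squeeze_zero (fun n => integral_nonneg fun x => sq_nonneg _) (fun n => ?_) (hL _ hS.isCompact_closure)
  have hc : Continuous fun x => (u n x - φ x) ^ 2 := by have := hu n; fun_prop
  exact setIntegral_mono_set (cont_intOn hc hS.closure) (ae_of_all _ fun x => sq_nonneg _) subset_closure.eventuallyLE

lemma L1_sq {f : Ed d → ℝ} (hf : Continuous f) (hS : Bornology.IsBounded S) :
    ∫ x in S, |f x| ≤ Real.sqrt (volume.real S * ∫ x in S, f x ^ 2) := by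
  apply Real.le_sqrt_of_sq_le
  have := cs_int (ν := volume.restrict S) (f := fun _ => (1:ℝ)) (g := fun x => |f x|) (cont_intOn (by fun_prop) hS) (cont_intOn (by fun_prop) hS) (cont_intOn (by fun_prop) hS)
  simpa using this

lemma L1_tend (hu : ∀ n, Continuous (u n)) (hφ : Continuous φ) (hS : Bornology.IsBounded S)
    (hL : Tendsto (fun n => ∫ x in S, (u n x - φ x) ^ 2) atTop (𝓝 0)) :
    Tendsto (fun n => ∫ x in S, |u n x - φ x|) atTop (𝓝 0) := by
  refine squeeze_zero (fun n => integral_nonneg fun x => abs_nonneg _)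
    (fun n => L1_sq (by have := hu n; fun_prop) hS) ?_
  simpa using (hL.const_mul (volume.real S)).sqrt

lemma quo_L1 (hm : 0 < m) (hSb : Bornology.IsBounded S) (hSm : MeasurableSet S) (hu : ∀ n, Continuous (u n))
    (ha : ∀ n, Continuous (a n)) (hφ : Continuous φ) (hφ0 : ∀ x, 0 < φ x) (hφm : ∀ x ∈ S, 2 * m ≤ φ x)
    (hL : Tendsto (fun n => ∫ x in S, (u n x - φ x) ^ 2) atTop (𝓝 0)) (hα : Continuous α)
    (hLa : Tendsto (fun n => ∫ x in S, (a n x - α x) ^ 2) atTop (𝓝 0)) :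
    Tendsto (fun n => ∫ x in S, |quo m (a n) (u n) x - α x * (φ x)⁻¹|) atTop (𝓝 0) := by
  obtain ⟨C, hC⟩ := hSb.isCompact_closure.exists_bound_of_continuousOn hα.continuousOn
  have h1 := L1_tend hu hφ hSb hL
  have h2 := L1_tend ha hα hSb hLa
  have hlim : Tendsto (fun n => 2 / m * (∫ x in S, |a n x - α x|) + C * (2 / m ^ 2) * ∫ x in S, |u n x - φ x|) atTop (𝓝 0) := by
    simpa using (h2.const_mul (2 / m)).add (h1.const_mul (C * (2 / m ^ 2)))
  refine squeeze_zero (fun n => integral_nonneg fun x => abs_nonneg _) (fun n => ?_) hlim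
  have hun := hu n
  have han := ha n
  have hφi : Continuous fun x => (φ x)⁻¹ := hφ.inv₀ fun x => (hφ0 x).ne'
  have hb : Continuous fun x => (bet m (u n x))⁻¹ :=
    (bet_smooth.continuous.comp hun).inv₀ fun x => (bet_pos hm _).ne'
  have hq : Continuous (quo m (a n) (u n)) := han.mul hb
  rw [← integral_const_mul, ← integral_const_mul, ← integral_add (cont_intOn (by fun_prop) hSb) (cont_intOn (by fun_prop) hSb)]
  refine setIntegral_mono_on (cont_intOn (by fun_prop) hSb) (cont_intOn (by fun_prop) hSb) hSm fun x hx => ?_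
  have h3 := hC x (subset_closure hx)
  rw [Real.norm_eq_abs] at h3
  have h4 := bet_inv_sub hm (t := u n x) (hφm x hx)
  have hb1 := bet_ge hm (u n x)
  have hb0 := bet_pos hm (u n x)
  have hi : (bet m (u n x))⁻¹ ≤ 2 / m := by
    rw [inv_le_comm₀ hb0 (by positivity), inv_div]; exact hb1
  have e : quo m (a n) (u n) x - α x * (φ x)⁻¹ = (bet m (u n x))⁻¹ * (a n x - α x) + α x * ((bet m (u n x))⁻¹ - (φ x)⁻¹) := by
    unfold quo; ring
  rw [e]
  refine (abs_add_le _ _).trans ?_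
  rw [abs_mul, abs_mul, abs_of_pos (inv_pos.2 hb0), mul_assoc C]
  have hC0 : 0 ≤ C := (abs_nonneg _).trans h3
  gcongr

lemma tend_bdd {f : ℕ → ℝ} {l : ℝ} (hf : Tendsto f atTop (𝓝 l)) : ∃ C, 0 ≤ C ∧ ∀ n, f n ≤ C := by
  obtain ⟨C, hC⟩ := hf.bddAbove_range
  exact ⟨max C 0, le_max_right _ _, fun n => (hC ⟨n, rfl⟩).trans (le_max_left _ _)⟩

lemma L2_bdd (ha : ∀ n, Continuous (a n)) (hα : Continuous α) (hSb : Bornology.IsBounded S)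
    (hLa : Tendsto (fun n => ∫ x in S, (a n x - α x) ^ 2) atTop (𝓝 0)) :
    ∃ C, 0 ≤ C ∧ ∀ n, ∫ x in S, a n x ^ 2 ≤ C := by
  obtain ⟨C, hC0, hC⟩ := tend_bdd hLa
  have h0 : 0 ≤ ∫ x in S, α x ^ 2 := integral_nonneg fun x => sq_nonneg _
  refine ⟨2 * C + 2 * ∫ x in S, α x ^ 2, by positivity, fun n => ?_⟩
  have := ha n
  calc ∫ x in S, a n x ^ 2 ≤ ∫ x in S, (2 * (a n x - α x) ^ 2 + 2 * α x ^ 2) := by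
        refine integral_mono (cont_intOn (by fun_prop) hSb) (cont_intOn (by fun_prop) hSb) fun x => ?_
        show a n x ^ 2 ≤ 2 * (a n x - α x) ^ 2 + 2 * α x ^ 2
        nlinarith [sq_nonneg (a n x - 2 * α x)]
    _ = 2 * (∫ x in S, (a n x - α x) ^ 2) + 2 * ∫ x in S, α x ^ 2 := by
        rw [integral_add (cont_intOn (by fun_prop) hSb) (cont_intOn (by fun_prop) hSb), integral_const_mul, integral_const_mul]
    _ ≤ _ := by gcongr; exact hC n

lemma pos_min (hφ : Continuous φ) (hφ0 : ∀ x, 0 < φ x) (hSb : Bornology.IsBounded S) :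
    ∃ m, 0 < m ∧ ∀ x ∈ S, 2 * m ≤ φ x := by
  rcases (closure S).eq_empty_or_nonempty with h | h
  · refine ⟨1, one_pos, fun x hx => ?_⟩
    have := subset_closure hx
    rw [h] at this
    exact this.elim
  · obtain ⟨x0, -, h0⟩ := hSb.isCompact_closure.exists_isMinOn h hφ.continuousOn
    refine ⟨φ x0 / 2, by have := hφ0 x0; positivity, fun x hx => ?_⟩
    have := h0 (subset_closure hx)
    simp only [Set.mem_ofPred_eq] at this
    linarith

set_option maxHeartbeats 1000000 in
lemma quo_const (h : Coef A W μ M) (hpos : ∀ u, IsTest u → 0 ≤ QA A W u)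
    (hu : ∀ n, IsTest (u n)) (hu0 : ∀ n x, 0 ≤ u n x) (hQu : Tendsto (fun n => QA A W (u n)) atTop (𝓝 0))
    (ha : ∀ n, IsTest (a n)) (hQa : Tendsto (fun n => QA A W (a n)) atTop (𝓝 0))
    (hφ : Continuous φ) (hφ0 : ∀ x, 0 < φ x)
    (hL : ∀ K : Set (Ed d), IsCompact K → Tendsto (fun n => ∫ x in K, (u n x - φ x) ^ 2) atTop (𝓝 0))
    (hα : Continuous α)
    (hLa : ∀ K : Set (Ed d), IsCompact K → Tendsto (fun n => ∫ x in K, (a n x - α x) ^ 2) atTop (𝓝 0))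
    (x y : Ed d) : α x * φ y = α y * φ x := by
  set R := ‖x‖ + ‖y‖ + 1
  have hR : 0 < R := by positivity
  set S := Metric.ball (0 : Ed d) R with hS
  have hSb : Bornology.IsBounded S := Metric.isBounded_ball
  have hSo : IsOpen S := Metric.isOpen_ball
  have hSm : MeasurableSet S := hSo.measurableSet
  have hSv : 0 < volume.real S := ball_vol_pos _ hR
  obtain ⟨m, hm, hφm⟩ := pos_min hφ hφ0 hSb
  have hLS := L2_set (fun n => (hu n).cont) hφ hSb hL
  have hLaS := L2_set (fun n => (ha n).cont) hα hSb hLa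
  obtain ⟨C1, hC10, hC1⟩ := tend_bdd hQu
  obtain ⟨C2, hC20, hC2⟩ := tend_bdd hQa
  obtain ⟨C3, hC30, hC3⟩ := L2_bdd (fun n => (hu n).cont) hφ hSb hLS
  obtain ⟨C4, hC40, hC4⟩ := L2_bdd (fun n => (ha n).cont) hα hSb hLaS
  have hμ : 0 < μ := by linarith [h.hμ]
  have hlow := lemR h hpos hm hSb hSm hu hu0 ha (CQ := max C1 C2) (fun n => (hC1 n).trans (le_max_left _ _))
    (fun n => (hC2 n).trans (le_max_right _ _)) hφ hφm hLS hα hLaS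
  have hrc : ∀ n, Continuous (gradient (quo m (a n) (u n))) := fun n => grad_cont (quo_smooth hm (ha n).c1 (hu n).c1)
  have hq : ∀ n, Continuous (quo m (a n) (u n)) := fun n => (quo_smooth hm (ha n).c1 (hu n).c1).continuous
  have hgrad : Tendsto (fun n => ∫ x in S, ‖gradient (quo m (a n) (u n)) x‖) atTop (𝓝 0) := by
    have hlim : Tendsto (fun n => (∫ x in S ∩ {x | u n x < m}, ‖gradient (quo m (a n) (u n)) x‖) +
        (m ^ 2)⁻¹ * Real.sqrt (μ * (QA A W (a n) + QA A W (u n)) * (C4 + C3))) atTop (𝓝 0) := by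
      have := (((hQa.add hQu).const_mul μ).mul_const (C4 + C3)).sqrt
      simpa using hlow.add (this.const_mul (m ^ 2)⁻¹)
    refine squeeze_zero (fun n => integral_nonneg fun x => norm_nonneg _) (fun n => ?_) hlim
    have hlt : MeasurableSet {x | u n x < m} := (isOpen_lt (hu n).cont continuous_const).measurableSet
    have := hrc n
    rw [← integral_inter_add_sdiff hlt (cont_intOn (by fun_prop) hSb)]
    have hDb : Bornology.IsBounded (S \ {x | u n x < m}) := hSb.subset Set.sdiff_subset
    have cX := Xw_cont (ha n).c1 (hu n).c1
    have uc := (hu n).cont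
    have ac := (ha n).cont
    gcongr
    calc ∫ x in S \ {x | u n x < m}, ‖gradient (quo m (a n) (u n)) x‖
        ≤ ∫ x in S \ {x | u n x < m}, (m ^ 2)⁻¹ * ‖Xw (a n) (u n) x‖ := by
          refine setIntegral_mono_on (cont_intOn (by fun_prop) hDb) (cont_intOn (by fun_prop) hDb) (hSm.diff hlt) fun x hx => ?_
          have hx2 : m ≤ u n x := not_lt.1 hx.2
          rw [quo_grad_hi hm (ha n).c1 (hu n).c1 hx2, div_eq_inv_mul]
          gcongr
      _ ≤ ∫ x in S, (m ^ 2)⁻¹ * ‖Xw (a n) (u n) x‖ :=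
          setIntegral_mono_set (cont_intOn (by fun_prop) hSb) (ae_of_all _ fun x => by positivity) Set.sdiff_subset.eventuallyLE
      _ = (m ^ 2)⁻¹ * ∫ x in S, ‖Xw (a n) (u n) x‖ := integral_const_mul _ _
      _ ≤ _ := by
          gcongr
          apply Real.le_sqrt_of_sq_le
          refine (hidE h hpos (ha n) (hu n) hSb).trans ?_
          have := hpos _ (ha n)
          have := hpos _ (hu n)
          rw [integral_add (cont_intOn (by fun_prop) hSb) (cont_intOn (by fun_prop) hSb)]
          gcongr
          · exact hC4 n
          · exact hC3 n
  have hL1 := quo_L1 hm hSb hSm (fun n => (hu n).cont) (fun n => (ha n).cont) hφ hφ0 hφm hLS hα hLaS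
  set ρ : Ed d → ℝ := fun x => α x * (φ x)⁻¹ with hρ
  have hφi : Continuous fun x => (φ x)⁻¹ := hφ.inv₀ fun x => (hφ0 x).ne'
  have hρc : Continuous ρ := hα.mul hφi
  set c := av ρ S with hc
  have hzero : ∫ x in S, |ρ x - c| ≤ 0 := by
    have hP : ∀ n, ∫ x in S, |ρ x - c| ≤ 2 * (∫ x in S, |quo m (a n) (u n) x - ρ x|) +
        (volume.real S)⁻¹ * ((2 * R) ^ 1 * volume.real (Metric.ball (0 : Ed d) (2 * R)) * ∫ x in S, ‖gradient (quo m (a n) (u n)) x‖) := by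
      intro n
      set r := quo m (a n) (u n)
      have hr : Continuous r := hq n
      have h1 : ∀ f : Ed d → ℝ, Continuous f → |av f S| ≤ (volume.real S)⁻¹ * ∫ x in S, |f x| := by
        intro f hf
        unfold av
        rw [abs_mul, abs_of_pos (inv_pos.2 hSv)]
        gcongr
        exact abs_integral_le_integral_abs
      have hc1 : |av r S - c| ≤ (volume.real S)⁻¹ * ∫ x in S, |r x - ρ x| := by
        rw [hc, ← av_sub hSb hr hρc]
        exact h1 _ (hr.sub hρc)
      have hI : ∫ x in S, |r x - av r S| ≤ ∫ x in S, (volume.real S)⁻¹ * ∫ y in S, |r x - r y| := by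
        refine integral_mono_of_nonneg (ae_of_all _ fun x => abs_nonneg _) ?_ (ae_of_all _ fun x => ?_)
        · refine Integrable.const_mul ?_ _
          have : Integrable (fun q : Ed d × Ed d => |r q.1 - r q.2|) ((volume.restrict S).prod (volume.restrict S)) := by
            have : IsFiniteMeasure (volume.restrict S) := ⟨by simpa using hSb.measure_lt_top⟩
            obtain ⟨C, hC⟩ := hSb.isCompact_closure.exists_bound_of_continuousOn hr.continuousOn
            refine Integrable.of_bound (C := C + C) (by fun_prop) ?_
            rw [Measure.prod_restrict]
            refine (ae_restrict_iff' (hSm.prod hSm)).2 (ae_of_all _ fun q hq => ?_)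
            rw [Real.norm_eq_abs, abs_abs]
            refine (abs_sub _ _).trans (add_le_add (hC _ (subset_closure hq.1)) (hC _ (subset_closure hq.2)))
          exact this.integral_prod_left
        · show |r x - av r S| ≤ _
          have : r x - av r S = av (fun y => r x - r y) S := by
            rw [av_sub hSb continuous_const hr, av_const hSv]
          rw [this]
          exact h1 _ (by fun_prop)
      rw [integral_const_mul] at hI
      have hPo := poinc' (quo_smooth hm (ha n).c1 (hu n).c1) (convex_ball (0 : Ed d) R) hSm hR.le subset_rfl 1 (Or.inl rfl)
      simp only [pow_one] at hPo ⊢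
      have h2 : ∫ x in S, |ρ x - c| ≤ ∫ x in S, (|r x - ρ x| + |r x - av r S| + |av r S - c|) := by
        refine integral_mono (cont_intOn (by fun_prop) hSb) (cont_intOn (by fun_prop) hSb) fun x => ?_
        show |ρ x - c| ≤ |r x - ρ x| + |r x - av r S| + |av r S - c|
        have e : ρ x - c = -(r x - ρ x) + (r x - av r S) + (av r S - c) := by ring
        rw [e]
        refine (abs_add_three _ _ _).trans ?_
        rw [abs_neg]
      rw [integral_add (cont_intOn (by fun_prop) hSb) (cont_intOn (by fun_prop) hSb),
        integral_add (cont_intOn (by fun_prop) hSb) (cont_intOn (by fun_prop) hSb), setIntegral_const, smul_eq_mul] at h2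
      have h3 : volume.real S * |av r S - c| ≤ ∫ x in S, |r x - ρ x| := by
        calc _ ≤ volume.real S * ((volume.real S)⁻¹ * ∫ x in S, |r x - ρ x|) := by gcongr
          _ = _ := by field_simp
      have h4 := hI.trans (mul_le_mul_of_nonneg_left hPo (inv_pos.2 hSv).le)
      linarith
    refine ge_of_tendsto' (x := atTop) ?_ hP
    have T := (hL1.const_mul 2).add ((hgrad.const_mul ((2 * R) ^ 1 * volume.real (Metric.ball (0 : Ed d) (2 * R)))).const_mul (volume.real S)⁻¹)
    simp only [mul_zero, add_zero] at T
    exact T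
  have hz : ∫ x in S, |ρ x - c| = 0 := le_antisymm hzero (integral_nonneg fun x => abs_nonneg _)
  rw [setIntegral_eq_zero_iff_of_nonneg_ae (ae_of_all _ fun x => abs_nonneg _) (cont_intOn (by fun_prop) hSb)] at hz
  have heq : Set.EqOn (fun x => |ρ x - c|) 0 S :=
    Measure.eqOn_open_of_ae_eq hz hSo (by fun_prop) continuousOn_const
  have hx : x ∈ S := by
    rw [hS, mem_ball_zero_iff]; have := norm_nonneg y; simp only [R]; linarith
  have hy : y ∈ S := by
    rw [hS, mem_ball_zero_iff]; have := norm_nonneg x; simp only [R]; linarith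
  have e1 : ρ x = c := by
    have := heq hx
    simpa [sub_eq_zero] using this
  have e2 : ρ y = c := by
    have := heq hy
    simpa [sub_eq_zero] using this
  have e3 : α x * (φ x)⁻¹ = α y * (φ y)⁻¹ := e1.trans e2.symm
  have := hφ0 x
  have := hφ0 y
  field_simp at e3
  linarith
end N4

section cone
open scoped Pointwise
variable {d : ℕ}

lemma ray_est {g : Ed d → ℝ} (hg : ContDiff ℝ 1 g) {y : Ed d} {T : ℝ} (hT : 1 ≤ T) (h0 : g (T • y) = 0) :
    |g y| ≤ ‖y‖ * ∫ t in Set.Ioc 1 T, ‖gradient g (t • y)‖ := by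
  have hgc := grad_cont hg
  have hc : Continuous fun t : ℝ => ‖gradient g (t • y)‖ := by fun_prop
  have hd : ∀ t ∈ Set.uIcc (1:ℝ) T, HasDerivAt (fun t : ℝ => g (t • y))
      (inner ℝ (gradient g (t • y)) y) t := by
    intro t _
    have h1 := hasG (c1_diff hg (x := t • y))
    have h2 : HasDerivAt (fun t : ℝ => t • y) y t := by
      simpa using (hasDerivAt_id t).smul_const y
    exact h1.comp_hasDerivAt t h2
  have hci : Continuous fun t : ℝ => inner ℝ (gradient g (t • y)) y := by fun_prop
  have e := intervalIntegral.integral_eq_sub_of_hasDerivAt hd (hci.intervalIntegrable 1 T)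
  rw [h0, one_smul] at e
  have e2 : |g y| = ‖∫ t in (1:ℝ)..T, inner ℝ (gradient g (t • y)) y‖ := by
    rw [e, Real.norm_eq_abs]; simp
  rw [e2]
  refine (intervalIntegral.norm_integral_le_integral_norm hT).trans ?_
  rw [← intervalIntegral.integral_of_le hT, ← intervalIntegral.integral_const_mul]
  refine intervalIntegral.integral_mono_on hT (hci.norm.intervalIntegrable 1 T)
    ((hc.const_mul _).intervalIntegrable 1 T) ?_
  intro t _
  rw [mul_comm]
  exact norm_inner_le_norm _ _

lemma coneL (hd : 3 ≤ d) {B0 : Set (Ed d)} (hBm : MeasurableSet B0) (hBb : Bornology.IsBounded B0) {l L : ℝ} (hl : 0 < l) (hL0 : 0 ≤ L)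
    (hlB : ∀ y ∈ B0, l ≤ ‖y‖) (hLB : ∀ y ∈ B0, ‖y‖ ≤ L) {Cn : Set (Ed d)}
    (hCn : MeasurableSet Cn) (hray : ∀ t : ℝ, 1 ≤ t → ∀ y ∈ B0, t • y ∈ Cn)
    {g : Ed d → ℝ} (hg : ContDiff ℝ 1 g) (hgc : HasCompactSupport g) {E : Set (Ed d)} (hE : MeasurableSet E)
    {F H : ℝ} (hF0 : 0 ≤ F) (hH0 : 0 ≤ H)
    (hF : ∫ x in Cn \ E, ‖gradient g x‖ ^ 2 ≤ F ^ 2) (hH : ∫ x in Cn ∩ E, ‖gradient g x‖ ≤ H) :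
    ∫ x in B0, |g x| ≤ L * (2 * (Real.sqrt (volume.real B0) * F + H)) := by
  have hG := grad_cont hg
  obtain ⟨R, hR⟩ := hgc.isCompact.isBounded.subset_ball (0 : Ed d)
  set T := max 1 (R / l) with hT
  have hT1 : 1 ≤ T := le_max_left _ _
  have hT0 : ∀ y ∈ B0, g (T • y) = 0 := by
    intro y hy
    apply image_eq_zero_of_notMem_tsupport
    intro hmem
    have := hR hmem
    rw [mem_ball_zero_iff, norm_smul, Real.norm_of_nonneg (by positivity)] at this
    have h1 : R ≤ T * l := by
      rw [← div_le_iff₀ hl]; exact le_max_right _ _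
    have h2 : T * l ≤ T * ‖y‖ := by gcongr; exact hlB y hy
    linarith
  have hi2 : Integrable fun x => ‖gradient g x‖ ^ 2 :=
    Continuous.integrable_of_hasCompactSupport (by fun_prop) (HasCompactSupport.intro (K := tsupport g) hgc fun x hx => by simp [grad_zero_off hx])
  have hi1 : Integrable fun x => ‖gradient g x‖ :=
    Continuous.integrable_of_hasCompactSupport (by fun_prop) (HasCompactSupport.intro (K := tsupport g) hgc fun x hx => by simp [grad_zero_off hx])
  set Kc := Real.sqrt (volume.real B0) * F + H with hKc
  have hKc0 : 0 ≤ Kc := by positivity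
  -- slices
  have hslice : ∀ t : ℝ, 1 ≤ t → ∫ y in B0, ‖gradient g (t • y)‖ ≤ Kc * t ^ (-(3/2) : ℝ) := by
    intro t ht
    have ht0 : 0 < t := by linarith
    have e1 := Measure.setIntegral_comp_smul_of_pos (volume : Measure (Ed d)) (fun x => ‖gradient g x‖) B0 ht0
    rw [e1]
    have hfr : Module.finrank ℝ (Ed d) = d := by simp
    rw [hfr, smul_eq_mul]
    have hsub : t • B0 ⊆ Cn := by
      rintro _ ⟨y, hy, rfl⟩
      exact hray t ht y hy
    have hBt : Bornology.IsBounded (t • B0) := hBb.smul₀ t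
    have hBtm : MeasurableSet (t • B0) := hBm.const_smul₀ t
    have hvol : volume.real (t • B0) = t ^ d * volume.real B0 := by
      simp only [Measure.real, Measure.addHaar_smul, ENNReal.toReal_mul, hfr]
      rw [ENNReal.toReal_ofReal (abs_nonneg _), abs_of_pos (by positivity)]
    have h1 : ∫ x in t • B0, ‖gradient g x‖ ≤ Real.sqrt (t ^ d * volume.real B0) * F + H := by
      rw [← integral_inter_add_sdiff hE hi1.integrableOn, add_comm]
      gcongr
      · have hb2 : Bornology.IsBounded (t • B0 \ E) := hBt.subset Set.sdiff_subset
        have := L1_sq (S := t • B0 \ E) (f := fun x => ‖gradient g x‖) (by fun_prop) hb2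
        simp only [abs_norm] at this
        refine this.trans ?_
        rw [← Real.sqrt_sq hF0, ← Real.sqrt_mul (by positivity)]
        apply Real.sqrt_le_sqrt
        rw [← hvol]
        have hv : volume.real (t • B0 \ E) ≤ volume.real (t • B0) :=
          measureReal_mono Set.sdiff_subset hBt.measure_lt_top.ne
        have h2 : ∫ x in t • B0 \ E, ‖gradient g x‖ ^ 2 ≤ F ^ 2 :=
          (setIntegral_mono_set hi2.integrableOn (ae_of_all _ fun x => sq_nonneg _)
            (Set.sdiff_subset_sdiff_left hsub).eventuallyLE).trans hF
        gcongr
      · exact (setIntegral_mono_set hi1.integrableOn (ae_of_all _ fun x => norm_nonneg _)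
            (Set.inter_subset_inter_left _ hsub).eventuallyLE).trans hH
    have hr : t ^ (-(3/2) : ℝ) = (Real.sqrt (t ^ 3))⁻¹ := by
      rw [Real.rpow_neg ht0.le, Real.sqrt_eq_rpow, ← Real.rpow_natCast, ← Real.rpow_mul ht0.le]
      norm_num
    have hs3 : Real.sqrt (t ^ 3) ≤ Real.sqrt (t ^ d) := Real.sqrt_le_sqrt (pow_le_pow_right₀ ht hd)
    have hs1 : 1 ≤ Real.sqrt (t ^ 3) := Real.one_le_sqrt.2 (one_le_pow₀ ht)
    have hsd : Real.sqrt (t ^ d) ^ 2 = t ^ d := Real.sq_sqrt (by positivity)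
    set q := Real.sqrt (t ^ d)
    have hq1 : 1 ≤ q := hs1.trans hs3
    rw [Real.sqrt_mul (by positivity)] at h1
    calc (t ^ d)⁻¹ * ∫ x in t • B0, ‖gradient g x‖ ≤ (q ^ 2)⁻¹ * (q * Real.sqrt (volume.real B0) * F + H) := by
          rw [hsd]; gcongr
      _ ≤ (q ^ 2)⁻¹ * (q * Kc) := by
          gcongr
          rw [hKc]
          nlinarith
      _ = Kc * q⁻¹ := by field_simp
      _ ≤ _ := by rw [hr]; gcongr
  have hrpow : IntegrableOn (fun t : ℝ => t ^ (-(3/2) : ℝ)) (Set.Ioi 1) := integrableOn_Ioi_rpow_of_lt (by norm_num) one_pos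
  have hrI : ∫ t in Set.Ioi (1:ℝ), t ^ (-(3/2) : ℝ) = 2 := by
    rw [integral_Ioi_rpow_of_lt (by norm_num) one_pos]; norm_num
  have hR0 : 0 ≤ L * (2 * Kc) := by positivity
  refine (le_abs_self _).trans ?_
  rw [← Real.norm_eq_abs, ← ENNReal.ofReal_le_ofReal_iff hR0, ofReal_norm]
  refine (enorm_integral_le_lintegral_enorm _).trans ?_
  have hm2 : Measurable fun q : Ed d × ℝ => ENNReal.ofReal ‖gradient g (q.2 • q.1)‖ := by fun_prop
  calc _ ≤ ∫⁻ y in B0, ENNReal.ofReal L * ∫⁻ t in Set.Ioc 1 T, ENNReal.ofReal ‖gradient g (t • y)‖ := by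
        refine setLIntegral_mono' hBm fun y hy => ?_
        have hc : Continuous fun t : ℝ => ‖gradient g (t • y)‖ := by fun_prop
        rw [Real.enorm_eq_ofReal (abs_nonneg _), ← ofReal_integral_eq_lintegral_ofReal
          ((hc.integrableOn_Icc (a := 1) (b := T)).mono_set Set.Ioc_subset_Icc_self) (ae_of_all _ fun t => norm_nonneg _),
          ← ENNReal.ofReal_mul hL0]
        apply ENNReal.ofReal_le_ofReal
        refine (ray_est hg hT1 (hT0 y hy)).trans ?_
        gcongr
        exact hLB y hy
    _ = ENNReal.ofReal L * ∫⁻ t in Set.Ioc 1 T, ∫⁻ y in B0, ENNReal.ofReal ‖gradient g (t • y)‖ := by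
        rw [lintegral_const_mul' _ _ ENNReal.ofReal_ne_top, lintegral_lintegral_swap hm2.aemeasurable]
    _ ≤ ENNReal.ofReal L * ∫⁻ t in Set.Ioc 1 T, ENNReal.ofReal (Kc * t ^ (-(3/2) : ℝ)) := by
        gcongr ENNReal.ofReal L * ?_
        refine setLIntegral_mono' measurableSet_Ioc fun t ht => ?_
        rw [← ofReal_integral_eq_lintegral_ofReal (cont_intOn (by fun_prop) hBb) (ae_of_all _ fun t => norm_nonneg _)]
        exact ENNReal.ofReal_le_ofReal (hslice t ht.1.le)
    _ ≤ ENNReal.ofReal L * ∫⁻ t in Set.Ioi 1, ENNReal.ofReal (Kc * t ^ (-(3/2) : ℝ)) := by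
        gcongr
        exact Set.Ioc_subset_Ioi_self
    _ = _ := by
        rw [← ofReal_integral_eq_lintegral_ofReal (hrpow.const_mul Kc), integral_const_mul, hrI,
          ← ENNReal.ofReal_mul hL0]
        · congr 1; ring
        · refine (ae_restrict_iff' measurableSet_Ioi).2 (ae_of_all _ fun t ht => ?_)
          have : (0:ℝ) < t := lt_trans one_pos ht
          positivity
end cone

section transl
variable {d : ℕ} {A : Ed d → Fin d → Fin d → ℝ} {W : Ed d → ℝ} {μ M : ℝ} {e : Ed d}

lemma QA_transl (hA : ∀ x, A (x + e) = A x) (hW : ∀ x, W (x + e) = W x) (u : Ed d → ℝ) :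
    QA A W (fun x => u (x + e)) = QA A W u := by
  unfold QA
  rw [← integral_add_right_eq_self (fun x => quadA A x (gradient u x) + W x * u x ^ 2) e]
  congr 1; ext x
  rw [grad_translate, hW]
  simp only [quadA, hA]

lemma IsTest.transl {u : Ed d → ℝ} (hu : IsTest u) (e : Ed d) : IsTest fun x => u (x + e) := by
  refine ⟨hu.1.comp (contDiff_id.add contDiff_const), ?_⟩
  exact hu.2.comp_homeomorph (Homeomorph.addRight e)

lemma L2_transl {u : ℕ → Ed d → ℝ} {φ : Ed d → ℝ} (e : Ed d)
    (hL : ∀ K : Set (Ed d), IsCompact K → Tendsto (fun n => ∫ x in K, (u n x - φ x) ^ 2) atTop (𝓝 0)) :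
    ∀ K : Set (Ed d), IsCompact K → Tendsto (fun n => ∫ x in K, (u n (x + e) - φ (x + e)) ^ 2) atTop (𝓝 0) := by
  intro K hK
  have h1 := hL ((fun x => x + e) '' K) (hK.image (by fun_prop))
  refine h1.congr fun n => ?_
  have := (measurePreserving_add_right (volume : Measure (Ed d)) e).setIntegral_preimage_emb
    (MeasurableEquiv.addRight e).measurableEmbedding (fun x => (u n x - φ x) ^ 2) ((fun x => x + e) '' K)
  rw [← this, Set.preimage_image_eq _ (add_left_injective e)]

end transl

section noncrit
variable {d : ℕ} {A : Ed d → Fin d → Fin d → ℝ} {W : Ed d → ℝ} {μ M m : ℝ} {φ a u : Ed d → ℝ}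

lemma QA_cmul (ha : IsTest a) (t : ℝ) : QA A W (fun x => t * a x) = t ^ 2 * QA A W a := by
  unfold QA
  rw [← integral_const_mul]
  congr 1; ext x
  rw [grad_const_mul t (c1_diff ha.c1), quadA_smul]
  ring

lemma IsTest.cmul (ha : IsTest a) (t : ℝ) : IsTest (fun x => t * a x) :=
  ⟨contDiff_const.mul ha.1, ha.2.mul_left⟩

lemma hiQ (h : Coef A W μ M) (hpos : ∀ u, IsTest u → 0 ≤ QA A W u) (hm : 0 < m) (ha : IsTest a) (hu : IsTest u)
    {t : ℝ} (ht : 0 < t) (hta : ∀ x, t * |a x| ≤ m) {S : Set (Ed d)} (hS : MeasurableSet S) :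
    ∫ x in S \ {x | u x < m}, ‖gradient (quo m a u) x‖ ^ 2 ≤ 3 * μ / m ^ 2 * (QA A W a + QA A W u / t ^ 2) := by
  have hat := ha.cmul t
  set I := ∫ x in S \ {x | u x < m}, ‖gradient (quo m a u) x‖ ^ 2
  have hXe : ∀ x, Xw (fun x => t * a x) u x = t • Xw a u x := by
    intro x
    simp only [Xw]
    rw [grad_const_mul t (c1_diff ha.c1)]
    module
  have hE : MeasurableSet {x | u x < m} := measurableSet_lt hu.cont.measurable measurable_const
  have key : ∀ δ ∈ Set.Ioo 0 m, I ≤ 3 / (t ^ 2 * m ^ 2) * (μ * (t ^ 2 * QA A W a + QA A W u + 2 * δ * M * ∫ x, (|t * a x| + |u x|))) := by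
    intro δ hδ
    have h1 := hid h hpos hat hu hδ.1
    rw [QA_cmul ha] at h1
    have hXc := Xw_cont hat.c1 hu.c1
    have hac := ha.cont
    have huc := hu.cont
    have hint : Integrable fun x => ‖Xw (fun x => t * a x) u x‖ ^ 2 / ((t * a x) ^ 2 + u x ^ 2 + δ ^ 2) := by
      refine hu.integrable_cont (Continuous.div (by fun_prop) (by fun_prop) fun x => ?_) fun x hx => ?_
      · have := hδ.1; positivity
      · simp [Xw, grad_zero_off hx, image_eq_zero_of_notMem_tsupport hx]
    calc I ≤ ∫ x in S \ {x | u x < m}, 3 / (t ^ 2 * m ^ 2) * (‖Xw (fun x => t * a x) u x‖ ^ 2 / ((t * a x) ^ 2 + u x ^ 2 + δ ^ 2)) := by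
          have hqs := grad_cont (quo_smooth hm ha.c1 hu.c1)
          have hi : Integrable fun x => ‖gradient (quo m a u) x‖ ^ 2 := by
            refine ha.integrable_cont (by fun_prop) fun x hx => ?_
            have : gradient a x = 0 := grad_zero_off hx
            rw [quo_grad hm ha.c1 hu.c1, this, image_eq_zero_of_notMem_tsupport hx]; simp
          refine setIntegral_mono_on hi.integrableOn (hint.const_mul _).integrableOn (hS.diff hE) fun x hx => ?_
          have hx2 : m ≤ u x := not_lt.1 hx.2
          rw [quo_grad_hi hm ha.c1 hu.c1 hx2, hXe, norm_smul, Real.norm_of_nonneg ht.le]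
          have hu0 : 0 < u x := hm.trans_le hx2
          have e1 : (t * a x) ^ 2 ≤ m ^ 2 := by
            rw [← sq_abs (t * a x), abs_mul, abs_of_pos ht]
            exact pow_le_pow_left₀ (by positivity) (hta x) 2
          have e2 : δ ^ 2 ≤ m ^ 2 := pow_le_pow_left₀ hδ.1.le hδ.2.le 2
          have e3 : m ^ 2 ≤ u x ^ 2 := pow_le_pow_left₀ hm.le hx2 2
          set N := ‖Xw a u x‖
          have hδ0 := hδ.1
          rw [div_pow, ← mul_div_assoc, div_le_div_iff₀ (by positivity) (by positivity)]
          have e4 : 3 / (t ^ 2 * m ^ 2) * (t * N) ^ 2 * (u x ^ 2) ^ 2 = N ^ 2 * (3 * u x ^ 2 * (u x ^ 2 / m ^ 2)) := by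
            field_simp
          rw [e4]
          have e5 : 1 ≤ u x ^ 2 / m ^ 2 := by rw [le_div_iff₀ (by positivity)]; linarith
          have e6 : 3 * u x ^ 2 * 1 ≤ 3 * u x ^ 2 * (u x ^ 2 / m ^ 2) := by gcongr
          gcongr
          linarith
      _ ≤ ∫ x, 3 / (t ^ 2 * m ^ 2) * (‖Xw (fun x => t * a x) u x‖ ^ 2 / ((t * a x) ^ 2 + u x ^ 2 + δ ^ 2)) :=
          setIntegral_le_integral (hint.const_mul _) (ae_of_all _ fun x => by positivity)
      _ ≤ _ := by
          rw [integral_const_mul]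
          gcongr
  have hlim : Tendsto (fun δ : ℝ => 3 / (t ^ 2 * m ^ 2) * (μ * (t ^ 2 * QA A W a + QA A W u + 2 * δ * M * ∫ x, (|t * a x| + |u x|)))) (𝓝[>] 0)
      (𝓝 (3 / (t ^ 2 * m ^ 2) * (μ * (t ^ 2 * QA A W a + QA A W u + 2 * 0 * M * ∫ x, (|t * a x| + |u x|))))) := by
    refine Tendsto.mono_left ?_ nhdsWithin_le_nhds
    exact Continuous.tendsto (f := fun δ : ℝ => 3 / (t ^ 2 * m ^ 2) * (μ * (t ^ 2 * QA A W a + QA A W u + 2 * δ * M * ∫ x, (|t * a x| + |u x|)))) (by fun_prop) 0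
  have hI := ge_of_tendsto hlim (by filter_upwards [Ioo_mem_nhdsGT hm] with δ hδ using key δ hδ)
  refine hI.trans (le_of_eq ?_)
  field_simp
  ring

lemma cone_pos (hφ : Continuous φ) (hφ0 : ∀ x, 0 < φ x)
    (hmul : ∀ (i : Fin d) (x y : Ed d), φ (x + EuclideanSpace.single i 1) * φ y = φ (y + EuclideanSpace.single i 1) * φ x) :
    ∃ s : Fin d → ℝ, (∀ i, s i ^ 2 = 1) ∧ ∃ m, 0 < m ∧ ∀ x : Ed d, (∀ i, 0 ≤ s i * x i) → 2 * m ≤ φ x := by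
  have hs : ∀ i : Fin d, ∃ s : ℝ, s ^ 2 = 1 ∧ ∀ x, φ x ≤ φ (x + EuclideanSpace.single i s) := by
    intro i
    rcases le_total (φ 0) (φ (0 + EuclideanSpace.single i 1)) with hc | hc
    · refine ⟨1, by norm_num, fun x => ?_⟩
      have h1 := hmul i x 0
      have h2 : φ 0 * φ x ≤ φ (x + EuclideanSpace.single i 1) * φ 0 := by
        rw [h1]; exact mul_le_mul_of_nonneg_right hc (hφ0 x).le
      rw [mul_comm] at h2
      exact le_of_mul_le_mul_right h2 (hφ0 0)
    · refine ⟨-1, by norm_num, fun x => ?_⟩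
      have h1 := hmul i (x + EuclideanSpace.single i (-1)) 0
      have e : x + EuclideanSpace.single i (-1) + EuclideanSpace.single i 1 = x := by
        rw [add_assoc]; ext j; by_cases hj : j = i <;> simp [hj]
      rw [e] at h1
      have h2 : φ x * φ 0 ≤ φ (x + EuclideanSpace.single i (-1)) * φ 0 := by
        rw [h1, mul_comm (φ (x + _))]; exact mul_le_mul_of_nonneg_right hc (hφ0 _).le
      exact le_of_mul_le_mul_right h2 (hφ0 0)
  choose s hs1 hs2 using hs
  refine ⟨s, hs1, ?_⟩
  obtain ⟨m, hm, hmin⟩ := pos_min hφ hφ0 (Metric.isBounded_ball (x := (0 : Ed d)) (r := d + 1))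
  refine ⟨m, hm, fun x hx => ?_⟩
  have hk : ∀ (i : Fin d) (k : ℕ) (y : Ed d), φ y ≤ φ (y + (k : ℝ) • EuclideanSpace.single i (s i)) := by
    intro i k
    induction k with
    | zero => intro y; simp
    | succ k ih =>
      intro y
      refine (ih y).trans ((hs2 i _).trans (le_of_eq ?_))
      congr 1
      push_cast
      module
  have hF : ∀ (k : Fin d → ℕ) (F : Finset (Fin d)) (y : Ed d), φ y ≤ φ (y + ∑ i ∈ F, (k i : ℝ) • EuclideanSpace.single i (s i)) := by
    intro k F
    induction F using Finset.induction_on with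
    | empty => intro y; simp
    | insert j F hj ih =>
      intro y
      rw [Finset.sum_insert hj]
      refine (hk j (k j) y).trans ((ih _).trans (le_of_eq ?_))
      rw [add_assoc]
  set k : Fin d → ℕ := fun i => ⌊s i * x i⌋₊
  set z : Ed d := ∑ i, (k i : ℝ) • EuclideanSpace.single i (s i) with hz
  have hzi : ∀ i, z i = k i * s i := by
    intro i
    simp [hz, Finset.sum_apply, Pi.single_apply]
  have h1 := hF k Finset.univ (x - z)
  rw [← hz, sub_add_cancel] at h1
  refine le_trans (hmin _ ?_) h1
  rw [mem_ball_zero_iff]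
  have h2 : ∀ i, ((x - z) i) ^ 2 ≤ 1 := by
    intro i
    have e : (x - z) i = x i - k i * s i := by simp [hzi]
    have hf1 := Nat.floor_le (hx i)
    have hf2 := Nat.lt_floor_add_one (s i * x i)
    have e2 : (s i * x i - k i) ^ 2 = ((x - z) i) ^ 2 := by
      rw [e]
      have := hs1 i
      linear_combination (x i ^ 2 - (k i:ℝ) ^ 2) * this
    rw [← e2, sq_le_one_iff_abs_le_one, abs_le]
    simp only [k]
    constructor <;> linarith
  have h3 : ‖x - z‖ ^ 2 ≤ d := by
    rw [EuclideanSpace.norm_sq_eq]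
    calc _ ≤ ∑ i : Fin d, (1:ℝ) := Finset.sum_le_sum fun i _ => by rw [Real.norm_eq_abs, sq_abs]; exact h2 i
      _ = d := by simp
  have : (0:ℝ) ≤ d := Nat.cast_nonneg d
  nlinarith [norm_nonneg (x - z)]


set_option maxHeartbeats 1000000 in
lemma noncrit (hd : 3 ≤ d) (h : Coef A W μ M)
    (hAper : ∀ (x : Ed d) (i : Fin d), A (x + EuclideanSpace.single i 1) = A x)
    (hWper : ∀ (x : Ed d) (i : Fin d), W (x + EuclideanSpace.single i 1) = W x)
    (hpos : ∀ u, IsTest u → 0 ≤ QA A W u) (hφg : GroundStateA A W φ) : False := by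
  obtain ⟨hφ, hφ0, u, ⟨hu, hu0, -, hQ⟩, hL⟩ := hφg
  obtain ⟨s, hs1, m, hm, hmin⟩ := cone_pos hφ hφ0 (by
    intro i x y
    refine quo_const h hpos hu hu0 hQ (fun n => (hu n).transl (EuclideanSpace.single i 1)) ?_ hφ hφ0 hL
      (α := fun x => φ (x + EuclideanSpace.single i 1)) (by fun_prop) (L2_transl _ hL) x y
    simp_rw [QA_transl (fun x => hAper x i) (fun x => hWper x i)]
    exact hQ)
  have huc : ∀ n, Continuous (u n) := fun n => (hu n).cont
  have hμ0 : 0 < μ := by linarith [h.hμ]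
  set z0 : Ed d := WithLp.toLp 2 (fun i => 2 * s i) with hz0
  set B0 := Metric.ball z0 1 with hB0
  have hBm : MeasurableSet B0 := measurableSet_ball
  have hBb : Bornology.IsBounded B0 := Metric.isBounded_ball
  have hB1 : ∀ y ∈ B0, ∀ i, 1 ≤ s i * y i := by
    intro y hy i
    rw [hB0, mem_ball_iff_norm] at hy
    have h1 : |y i - 2 * s i| < 1 := by
      have := (PiLp.norm_apply_le (y - z0) i).trans_lt hy
      simpa [hz0] using this
    have h2 : (s i * y i - 2) ^ 2 < 1 := by
      have e : (s i * y i - 2) ^ 2 = (y i - 2 * s i) ^ 2 := by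
        linear_combination (y i ^ 2 - 4) * hs1 i
      rw [e]; exact (sq_lt_one_iff_abs_lt_one _).2 h1
    have := (abs_lt.1 ((sq_lt_one_iff_abs_lt_one _).1 h2)).1
    linarith
  have hlB : ∀ y ∈ B0, 1 ≤ ‖y‖ := by
    intro y hy
    have h1 := hB1 y hy ⟨0, by omega⟩
    have h2 := PiLp.norm_apply_le y ⟨0, by omega⟩
    rw [Real.norm_eq_abs] at h2
    have h3 : |s ⟨0, by omega⟩| = 1 := by
      have := hs1 ⟨0, by omega⟩
      rw [← sq_abs] at this
      exact (pow_eq_one_iff_of_nonneg (abs_nonneg _) (by norm_num)).1 this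
    have h4 := le_abs_self (s ⟨0, by omega⟩ * y ⟨0, by omega⟩)
    rw [abs_mul, h3, one_mul] at h4
    linarith
  have hLB : ∀ y ∈ B0, ‖y‖ ≤ ‖z0‖ + 1 := by
    intro y hy
    rw [hB0, mem_ball_iff_norm] at hy
    have := norm_le_insert' y z0
    linarith
  set Cn : Set (Ed d) := {x | ∀ i, 0 ≤ s i * x i} with hCn
  have hCm : MeasurableSet Cn := by
    have : IsClosed Cn := by
      rw [hCn, Set.ofPred_forall]
      exact isClosed_iInter fun i => isClosed_le continuous_const (by fun_prop)
    exact this.measurableSet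
  have hray : ∀ t : ℝ, 1 ≤ t → ∀ y ∈ B0, t • y ∈ Cn := by
    intro t ht y hy i
    have := hB1 y hy i
    simp only [PiLp.smul_apply, smul_eq_mul]
    nlinarith
  have hB0C : B0 ⊆ Cn := fun y hy => by simpa using hray 1 le_rfl y hy
  have hL' : ∀ S : Set (Ed d), Bornology.IsBounded S → Tendsto (fun n => ∫ x in S, (u n x - φ x) ^ 2) atTop (𝓝 0) :=
    fun S hS => L2_set huc hφ hS hL
  obtain ⟨CQ, -, hCQ⟩ := tend_bdd hQ
  set Lc := ‖z0‖ + 1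
  have hLc : 0 ≤ Lc := by positivity
  have main : ∀ a : Ed d → ℝ, IsTest a → ∫ x in B0, |a x * (φ x)⁻¹| ≤
      Lc * (2 * (Real.sqrt (volume.real B0) * Real.sqrt (3 * μ / m ^ 2 * QA A W a))) := by
    intro a ha
    obtain ⟨Ca, hCa⟩ := ha.cont.bounded_above_of_compact_support ha.2
    set t := m / (|Ca| + 1) with ht
    have ht0 : 0 < t := by positivity
    have hta : ∀ x, t * |a x| ≤ m := by
      intro x
      rw [ht, div_mul_eq_mul_div, div_le_iff₀ (by positivity)]
      gcongr
      have := hCa x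
      rw [Real.norm_eq_abs] at this
      linarith [le_abs_self Ca]
    obtain ⟨Ra, hRa⟩ := ha.2.isCompact.isBounded.subset_ball (0 : Ed d)
    set S := Cn ∩ Metric.ball 0 Ra with hS
    have hSb : Bornology.IsBounded S := Metric.isBounded_ball.subset Set.inter_subset_right
    have hSm : MeasurableSet S := hCm.inter measurableSet_ball
    set H : ℕ → ℝ := fun n => ∫ x in S ∩ {x | u n x < m}, ‖gradient (quo m a (u n)) x‖ with hH
    have hHt : Tendsto H atTop (𝓝 0) :=
      lemR (a := fun _ => a) h hpos hm hSb hSm hu hu0 (fun _ => ha) (CQ := max CQ (QA A W a))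
        (fun n => (hCQ n).trans (le_max_left _ _)) (fun _ => le_max_right _ _) hφ (fun x hx => hmin x hx.1)
        (hL' S hSb) ha.cont (by simp)
    set F : ℕ → ℝ := fun n => Real.sqrt (3 * μ / m ^ 2 * (QA A W a + QA A W (u n) / t ^ 2)) with hF
    have hFt : Tendsto F atTop (𝓝 (Real.sqrt (3 * μ / m ^ 2 * (QA A W a + 0 / t ^ 2)))) :=
      (((hQ.div_const _).const_add _).const_mul _).sqrt
    have hb : ∀ n, ∫ x in B0, |quo m a (u n) x| ≤ Lc * (2 * (Real.sqrt (volume.real B0) * F n + H n)) := by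
      intro n
      have hE : MeasurableSet {x | u n x < m} := measurableSet_lt (huc n).measurable measurable_const
      have hz : ∀ x, x ∉ Metric.ball (0 : Ed d) Ra → gradient (quo m a (u n)) x = 0 := by
        intro x hx
        have hx' : x ∉ tsupport a := fun h' => hx (hRa h')
        have : gradient a x = 0 := grad_zero_off hx'
        rw [quo_grad hm ha.c1 (hu n).c1, this, image_eq_zero_of_notMem_tsupport hx']; simp
      refine coneL hd hBm hBb one_pos hLc hlB hLB hCm hray (quo_smooth hm ha.c1 (hu n).c1) ha.2.mul_right hE
        (Real.sqrt_nonneg _) (integral_nonneg fun _ => norm_nonneg _) ?_ ?_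
      · have h0 : 0 ≤ 3 * μ / m ^ 2 * (QA A W a + QA A W (u n) / t ^ 2) := by
          have := hpos a ha
          have := hpos _ (hu n)
          positivity
        rw [hF, Real.sq_sqrt h0]
        exact hiQ h hpos hm ha (hu n) ht0 hta hCm
      · refine le_of_eq (setIntegral_eq_of_subset_of_forall_sdiff_eq_zero (hCm.inter hE)
          (Set.inter_subset_inter_left _ Set.inter_subset_left) fun x hx => ?_)
        rw [hz x, norm_zero]
        intro hxb
        exact hx.2 ⟨⟨hx.1.1, hxb⟩, hx.1.2⟩
    have hq := quo_L1 (a := fun _ => a) hm hBb hBm huc (fun _ => ha.cont) hφ hφ0 (fun x hx => hmin x (hB0C hx)) (hL' B0 hBb)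
      ha.cont (by simp)
    have hc1 : Continuous fun x => a x * (φ x)⁻¹ := ha.cont.mul (hφ.inv₀ fun x => (hφ0 x).ne')
    have hle : ∀ n, ∫ x in B0, |a x * (φ x)⁻¹| ≤ Lc * (2 * (Real.sqrt (volume.real B0) * F n + H n)) +
        ∫ x in B0, |quo m a (u n) x - a x * (φ x)⁻¹| := by
      intro n
      have hqc : Continuous (quo m a (u n)) := (quo_smooth hm ha.c1 (hu n).c1).continuous
      refine le_trans ?_ (add_le_add_left (hb n) _)
      rw [← integral_add (cont_intOn (by fun_prop) hBb) (cont_intOn (by fun_prop) hBb)]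
      refine integral_mono (cont_intOn (by fun_prop) hBb) (cont_intOn (by fun_prop) hBb) fun x => ?_
      have := abs_sub_abs_le_abs_sub (a x * (φ x)⁻¹) (quo m a (u n) x)
      rw [abs_sub_comm] at this
      simp only
      linarith
    have T := (((((hFt.const_mul (Real.sqrt (volume.real B0))).add hHt).const_mul 2).const_mul Lc).add hq)
    have := ge_of_tendsto T (Eventually.of_forall hle)
    simpa using this
  -- apply to the null sequence itself
  have hvol : 0 < volume.real B0 := ball_vol_pos z0 one_pos
  have hone : ∀ n, volume.real B0 ≤ Lc * (2 * (Real.sqrt (volume.real B0) * Real.sqrt (3 * μ / m ^ 2 * QA A W (u n)))) +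
      (2 * m)⁻¹ * ∫ x in B0, |u n x - φ x| := by
    intro n
    refine le_trans ?_ (add_le_add_left (main _ (hu n)) _)
    have hi : Continuous fun x => (φ x)⁻¹ := hφ.inv₀ fun x => (hφ0 x).ne'
    have := huc n
    rw [← integral_const_mul, ← integral_add (cont_intOn (by fun_prop) hBb) (cont_intOn (by fun_prop) hBb)]
    have e : volume.real B0 = ∫ x in B0, (1:ℝ) := by simp
    rw [e]
    refine setIntegral_mono_on (cont_intOn (by fun_prop) hBb) (cont_intOn (by fun_prop) hBb) hBm fun x hx => ?_
    have h2 := hmin x (hB0C hx)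
    have h3 : (φ x)⁻¹ ≤ (2 * m)⁻¹ := inv_anti₀ (by positivity) h2
    have h4 : (1:ℝ) = u n x * (φ x)⁻¹ - (u n x - φ x) * (φ x)⁻¹ := by
      have := (hφ0 x).ne'
      field_simp; ring
    calc (1:ℝ) ≤ |u n x * (φ x)⁻¹| + |(u n x - φ x) * (φ x)⁻¹| := by
          have := abs_sub (u n x * (φ x)⁻¹) ((u n x - φ x) * (φ x)⁻¹)
          rw [← h4, abs_one] at this
          exact this
      _ ≤ _ := by
          rw [abs_mul (u n x - φ x), abs_of_pos (inv_pos.2 (hφ0 x)), mul_comm (|u n x - φ x|)]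
          gcongr
  have T := ((((hQ.const_mul (3 * μ / m ^ 2)).sqrt.const_mul (Real.sqrt (volume.real B0))).const_mul 2).const_mul Lc).add
    ((L1_tend huc hφ hBb (hL' B0 hBb)).const_mul ((2 * m)⁻¹))
  have := ge_of_tendsto T (Eventually.of_forall hone)
  simp at this
  linarith
end noncrit

abbrev bs (d : ℕ) := (EuclideanSpace.basisFun (Fin d) ℝ).toBasis
abbrev Lt (d : ℕ) := Submodule.span ℤ (Set.range (bs d))
abbrev cell (d : ℕ) : Set (Ed d) := ZSpan.fundamentalDomain (bs d)

def IsPer {d : ℕ} {β : Type*} (f : Ed d → β) : Prop := ∀ (g : Lt d) (x : Ed d), f (x + g) = f x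

section lattice
variable {d : ℕ}

lemma per_of {β : Type*} {f : Ed d → β} (hf : ∀ (x : Ed d) (i : Fin d), f (x + EuclideanSpace.single i 1) = f x) : IsPer f := by
  have key : ∀ g ∈ Lt d, ∀ x, f (x + g) = f x := by
    intro g hg
    induction hg using Submodule.span_induction with
    | mem y hy =>
      obtain ⟨i, rfl⟩ := hy
      intro x
      simpa using hf x i
    | zero => intro x; simp
    | add y z _ _ hy hz => intro x; rw [← add_assoc, hz, hy]
    | smul n y _ hy =>
      have hn : ∀ (k : ℕ) x, f (x + k • y) = f x := by
        intro k
        induction k with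
        | zero => intro x; simp
        | succ k ih => intro x; rw [succ_nsmul, ← add_assoc, hy, ih]
      intro x
      obtain ⟨k, rfl | rfl⟩ := n.eq_nat_or_neg
      · simpa using hn k x
      · have := hn k (x + (-(k:ℤ)) • y)
        rw [← this]; congr 1
        simp
  exact fun g x => key g g.2 x

lemma ltfin (R : ℝ) : {g : Lt d | ‖(g : Ed d)‖ < 2 * R}.Finite := by
  have h := ZSpan.setFinite_inter (bs d) (Metric.isBounded_ball (x := (0 : Ed d)) (r := 2 * R))
  have := Set.Finite.preimage (f := ((↑) : Lt d → Ed d)) Subtype.val_injective.injOn h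
  refine this.subset fun g hg => ?_
  simp only [Set.mem_ofPred_eq] at hg
  exact ⟨by simpa using hg, g.2⟩

def FS (d : ℕ) (R : ℝ) : Finset (Lt d) := (ltfin R).toFinset

lemma FS_out {R : ℝ} {g : Lt d} (hg : g ∉ FS d R) {x : Ed d} (hx : x ∈ Metric.ball (0 : Ed d) R) : x + g ∉ Metric.ball (0 : Ed d) R := by
  intro h'
  apply hg
  simp only [FS, Set.Finite.mem_toFinset, Set.mem_ofPred_eq]
  rw [mem_ball_zero_iff] at hx h'
  have : (g : Ed d) = (x + g) - x := by abel
  rw [this]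
  have := norm_sub_le (x + g) x
  linarith

instance ltInv : VAddInvariantMeasure (Lt d) (Ed d) volume :=
  ⟨fun c s _ => measure_preimage_add volume (c : Ed d) s⟩

lemma cell_meas : MeasurableSet (cell d) := ZSpan.fundamentalDomain_measurableSet _
lemma cell_bdd : Bornology.IsBounded (cell d) := ZSpan.fundamentalDomain_isBounded _

lemma cell_rad : ∃ R0 : ℝ, 0 < R0 ∧ cell d ⊆ Metric.ball 0 R0 := by
  obtain ⟨R, hR⟩ := (cell_bdd (d := d)).subset_ball 0
  exact ⟨max R 1, by positivity, hR.trans (Metric.ball_subset_ball (le_max_left _ _))⟩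

lemma cell_vol_pos : 0 < volume.real (cell d) := by
  have h1 := ZSpan.measure_fundamentalDomain_ne_zero (bs d) (μ := volume)
  exact ENNReal.toReal_pos h1 cell_bdd.measure_lt_top.ne

lemma unfold_int {f : Ed d → ℝ} (hf : Integrable f) {R : ℝ} (hR : cell d ⊆ Metric.ball 0 R)
    (hz : ∀ x, x ∉ Metric.ball (0 : Ed d) R → f x = 0) :
    ∫ x, f x = ∫ x in cell d, ∑ g ∈ FS d R, f (x + g) := by
  have h1 := (ZSpan.isAddFundamentalDomain (bs d) (volume : Measure (Ed d))).integral_eq_tsum'' f hf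
  rw [h1, tsum_eq_sum (s := FS d R), integral_finsetSum]
  · refine Finset.sum_congr rfl fun g _ => ?_
    congr 1; ext x
    rw [Submodule.vadd_def, vadd_eq_add, add_comm]
  · intro g _
    exact (hf.comp_add_right (g : Ed d)).integrableOn
  · intro g hg
    refine setIntegral_eq_zero_of_forall_eq_zero fun x hx => ?_
    rw [Submodule.vadd_def, vadd_eq_add, add_comm]
    exact hz _ (FS_out hg (hR hx))

open scoped Pointwise in
lemma per_shift {f : Ed d → ℝ} (hf : IsPer f) (y : Ed d) : ∫ x in cell d, f (x + y) = ∫ x in cell d, f x := by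
  have hD := ZSpan.isAddFundamentalDomain (bs d) (volume : Measure (Ed d))
  have hD2 := hD.vadd_of_comm y
  have h1 := hD2.setIntegral_eq hD (f := f) (fun g x => by
    rw [Submodule.vadd_def, vadd_eq_add, add_comm]; exact hf g x)
  rw [← h1]
  have := (measurePreserving_add_right (volume : Measure (Ed d)) y).setIntegral_preimage_emb
    (MeasurableEquiv.addRight y).measurableEmbedding f (y +ᵥ cell d)
  rw [← this]
  congr 2
  ext x
  simp [Set.mem_vadd_set_iff_neg_vadd_mem, add_comm]

/-- periodic nonnegative function: ball integral bounded by cell integral -/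
lemma per_ball {f : Ed d → ℝ} (hf : IsPer f) (hf0 : ∀ x, 0 ≤ f x) (hc : Continuous f) {R : ℝ}
    (hR : cell d ⊆ Metric.ball 0 R) (x0 : Ed d) :
    ∫ x in Metric.ball x0 R, f x ≤ (FS d R).card * ∫ x in cell d, f x := by
  have e1 : ∫ x in Metric.ball x0 R, f x = ∫ x in Metric.ball (0 : Ed d) R, f (x + x0) := by
    have := (measurePreserving_add_right (volume : Measure (Ed d)) x0).setIntegral_preimage_emb
      (MeasurableEquiv.addRight x0).measurableEmbedding f (Metric.ball x0 R)
    rw [← this]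
    congr 2
    ext x
    simp [dist_eq_norm]
  rw [e1, ← integral_indicator measurableSet_ball, unfold_int _ hR, ← per_shift hf x0, ← integral_const_mul]
  · refine setIntegral_mono_on ?_ ?_ cell_meas fun x hx => ?_
    · refine integrable_finsetSum _ fun g _ => ?_
      have : Integrable ((Metric.ball (0 : Ed d) R).indicator fun x => f (x + x0)) :=
        (cont_intOn (by fun_prop) Metric.isBounded_ball).integrable_indicator measurableSet_ball
      exact (this.comp_add_right (g : Ed d)).integrableOn
    · exact cont_intOn (by fun_prop) cell_bdd
    · calc _ ≤ ∑ g ∈ FS d R, f (x + x0) := by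
            refine Finset.sum_le_sum fun g _ => ?_
            refine (Set.indicator_le_self' (fun _ _ => hf0 _) _).trans (le_of_eq ?_)
            rw [add_right_comm, hf]
        _ = _ := by simp
  · intro x hx; exact Set.indicator_of_notMem hx _
  · exact (cont_intOn (by fun_prop) Metric.isBounded_ball).integrable_indicator measurableSet_ball

/-- periodization -/
def Per (a : Ed d → ℝ) (x : Ed d) : ℝ := ∑' g : Lt d, a (x + g)

lemma Per_eq {a : Ed d → ℝ} {R : ℝ} (hz : ∀ x, x ∉ Metric.ball (0 : Ed d) R → a x = 0) {x : Ed d} (hx : x ∈ Metric.ball (0 : Ed d) R) :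
    Per a x = ∑ g ∈ FS d R, a (x + g) :=
  tsum_eq_sum fun _ hg => hz _ (FS_out hg hx)

lemma Per_per (a : Ed d → ℝ) : IsPer (Per a) := by
  intro g x
  unfold Per
  rw [← (Equiv.addLeft g).tsum_eq (fun h : Lt d => a (x + h))]
  congr 1; ext h
  simp [add_assoc]

lemma Per_smooth {a : Ed d → ℝ} (ha : IsTest a) : ContDiff ℝ (⊤ : ℕ∞) (Per a) := by
  rw [contDiff_iff_contDiffAt]
  intro x
  obtain ⟨R, hR⟩ := ha.2.isCompact.isBounded.subset_ball (0 : Ed d)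
  set R' := max R (‖x‖ + 1)
  have hz : ∀ y, y ∉ Metric.ball (0 : Ed d) R' → a y = 0 := fun y hy =>
    image_eq_zero_of_notMem_tsupport fun h' => hy (Metric.ball_subset_ball (le_max_left _ _) (hR h'))
  have hx : x ∈ Metric.ball (0 : Ed d) R' := by
    rw [mem_ball_zero_iff]; exact lt_of_lt_of_le (by linarith) (le_max_right _ _)
  have h1 : ContDiff ℝ (⊤ : ℕ∞) fun x => ∑ g ∈ FS d R', a (x + g) :=
    ContDiff.sum fun g _ => ha.1.comp (contDiff_id.add contDiff_const)
  refine h1.contDiffAt.congr_of_eventuallyEq ?_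
  filter_upwards [Metric.isOpen_ball.mem_nhds hx] with y hy using Per_eq hz hy

lemma Per_grad {a : Ed d → ℝ} (ha : IsTest a) {R : ℝ} (hz : ∀ x, x ∉ Metric.ball (0 : Ed d) R → a x = 0)
    {x : Ed d} (hx : x ∈ Metric.ball (0 : Ed d) R) :
    gradient (Per a) x = ∑ g ∈ FS d R, gradient a (x + g) := by
  have h1 : Per a =ᶠ[𝓝 x] fun x => ∑ g ∈ FS d R, a (x + g) := by
    filter_upwards [Metric.isOpen_ball.mem_nhds hx] with y hy using Per_eq hz hy
  have h2 : gradient (Per a) x = gradient (fun x => ∑ g ∈ FS d R, a (x + g)) x := by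
    simp only [gradient, h1.fderiv_eq]
  rw [h2, grad_sum]
  · simp_rw [grad_translate]
  · intro g _
    exact c1_diff (ha.transl (g : Ed d)).c1

end lattice

section E1
variable {d : ℕ} {A : Ed d → Fin d → Fin d → ℝ} {W : Ed d → ℝ} {μ M : ℝ} {u v : Ed d → ℝ}

lemma grad_per (hu : IsPer u) : IsPer (gradient u) := by
  intro g x
  rw [← grad_translate]
  congr 1; ext y; exact hu g y

lemma den_per (hA : IsPer A) (hW : IsPer W) (hu : IsPer u) (hv : IsPer v) : IsPer (den A W u v) := by
  intro g x
  simp only [den, bilA, hA g x, hW g x, hu g x, hv g x, grad_per hu g x, grad_per hv g x]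

lemma per_bdd {β : Type*} [NormedAddCommGroup β] {f : Ed d → β} (hf : IsPer f) (hc : Continuous f) : ∃ C, 0 ≤ C ∧ ∀ x, ‖f x‖ ≤ C := by
  obtain ⟨C, hC⟩ := (cell_bdd (d := d)).isCompact_closure.exists_bound_of_continuousOn hc.continuousOn
  refine ⟨max C 0, le_max_right _ _, fun x => ?_⟩
  have h1 := hf (-(ZSpan.floor (bs d) x)) x
  rw [← h1]
  have : x + ((-(ZSpan.floor (bs d) x) : Lt d) : Ed d) = ZSpan.fract (bs d) x := by
    rw [ZSpan.fract_apply, sub_eq_add_neg]; rfl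
  rw [this]
  exact (hC _ (subset_closure (ZSpan.fract_mem_fundamentalDomain _ _))).trans (le_max_left _ _)
end E1

section E1b
variable {d : ℕ} {A : Ed d → Fin d → Fin d → ℝ} {W : Ed d → ℝ} {μ M : ℝ} {u v : Ed d → ℝ}

set_option maxHeartbeats 1000000 in
lemma QT_nonneg (h : Coef A W μ M) (hpos : ∀ u, IsTest u → 0 ≤ QA A W u) (hA : IsPer A) (hW : IsPer W)
    (hu : ContDiff ℝ (⊤ : ℕ∞) u) (hup : IsPer u) : 0 ≤ ∫ x in cell d, den A W u u x := by
  have hu1 := sm_c1 hu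
  have hμ0 : 0 < μ := by linarith [h.hμ]
  obtain ⟨χ, hχ, hχ01, hχ1⟩ := exists_cut (d := d) 1
  obtain ⟨C1, hC10, hC1⟩ := per_bdd hup hu1.continuous
  obtain ⟨C2, hC20, hC2⟩ := per_bdd (grad_per hup) (grad_cont hu1)
  set Cu := 2 * μ * C1 * C2 + μ * C1 ^ 2 with hCu
  have hCu0 : 0 ≤ Cu := by positivity
  have hGc := grad_cont hχ.c1
  have hχc := hχ.cont
  set QT := ∫ x in cell d, den A W u u x with hQT
  set c2 := ∫ x, χ x ^ 2 with hc2
  set g1 := ∫ x, ‖gradient χ x‖ with hg1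
  set g2 := ∫ x, ‖gradient χ x‖ ^ 2 with hg2
  set vc := volume.real (cell d) with hvc
  have hdm := den_measurable h hu1 hu1
  have hc2p : 0 < c2 := by
    have hi : Integrable fun x => χ x ^ 2 := hχ.integrable_cont (by fun_prop) fun x hx => by
      simp [image_eq_zero_of_notMem_tsupport hx]
    refine lt_of_lt_of_le (ball_vol_pos (0 : Ed d) one_pos) ?_
    have e : volume.real (Metric.ball (0 : Ed d) 1) = ∫ x in Metric.ball (0 : Ed d) 1, χ x ^ 2 := by
      rw [setIntegral_congr_fun measurableSet_ball (g := fun _ => (1:ℝ)) fun x hx => by simp [hχ1.1 x hx]]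
      simp
    rw [e]
    exact setIntegral_le_integral hi (ae_of_all _ fun x => sq_nonneg _)
  have key : ∀ R : ℝ, 0 < R → 0 ≤ c2 * QT + vc * Cu * (R⁻¹ * g1 + (R⁻¹) ^ 2 * g2) := by
    intro R hR
    set η : Ed d → ℝ := fun x => χ (R⁻¹ • x) with hη
    have hηt : IsTest η := by
      refine ⟨hχ.1.comp (contDiff_const_smul _), ?_⟩
      exact hχ.2.comp_homeomorph (Homeomorph.smulOfNeZero (R⁻¹) (by positivity))
    have hηg : ∀ x, gradient η x = R⁻¹ • gradient χ (R⁻¹ • x) := fun x => grad_scale _ (c1_diff hχ.c1)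
    have hηc := hηt.cont
    have hηgc := grad_cont hηt.c1
    have hi2 : Integrable fun x => η x ^ 2 := hηt.integrable_cont (by fun_prop) fun x hx => by
      simp [image_eq_zero_of_notMem_tsupport hx]
    have hig : Integrable fun x => Cu * (‖gradient η x‖ + ‖gradient η x‖ ^ 2) := hηt.integrable_cont (by fun_prop) fun x hx => by
      simp [grad_zero_off hx]
    have hdb : ∀ x, |den A W u u x| ≤ (μ + M) * (C2 ^ 2 + C1 ^ 2) := by
      intro x
      refine (den_self_le h x).trans ?_
      have := Mnn h
      have h1 := hC1 x
      rw [Real.norm_eq_abs] at h1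
      unfold H1n
      rw [← sq_abs (u x)]
      gcongr
      exact hC2 x
    have hid : ∀ y, Integrable fun x => η x ^ 2 * den A W u u (x + y) := by
      intro y
      refine (hi2.mul_const ((μ + M) * (C2 ^ 2 + C1 ^ 2))).mono'
        (((hηc.measurable.pow_const 2).mul (hdm.comp (measurable_id.add_const y))).aestronglyMeasurable) (ae_of_all _ fun x => ?_)
      rw [Real.norm_eq_abs, abs_mul, abs_of_nonneg (sq_nonneg _)]
      exact mul_le_mul_of_nonneg_left (hdb _) (sq_nonneg _)
    have hy : ∀ y, 0 ≤ (∫ x, η x ^ 2 * den A W u u (x + y)) + ∫ x, Cu * (‖gradient η x‖ + ‖gradient η x‖ ^ 2) := by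
      intro y
      have hηy : IsTest fun x => η (x + (-y)) := hηt.transl (-y)
      set v : Ed d → ℝ := fun x => u x * η (x + (-y)) with hv
      have hvt : IsTest v := ⟨hu.mul hηy.1, hηy.2.mul_left⟩
      have h0 := hpos v hvt
      rw [QA_eq, ← integral_add_right_eq_self _ y] at h0
      refine h0.trans ?_
      rw [← integral_add (hid y) hig]
      refine integral_mono ((den_integrable h hvt.c1 hvt.c1 hvt.2).comp_add_right y) (I_add (hid y) hig) fun x => ?_
      have e1 : gradient v (x + y) = u (x + y) • gradient η x + η x • gradient u (x + y) := by
        rw [hv, grad_mul (c1_diff hu1) (c1_diff hηy.c1), grad_translate]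
        simp
      have e2 : v (x + y) = u (x + y) * η x := by simp [hv]
      simp only [den, e1, e2, bilA_self]
      rw [quadA_add h, quadA_smul, quadA_smul, bilA_smul_left, bilA_smul_right]
      have b1 := bilA_abs_le (x := x + y) h (gradient η x) (gradient u (x + y))
      have b2 := (h.ell (x + y) (gradient η x)).2
      have b3 : |η x| ≤ 1 := by rw [abs_of_nonneg (hχ01 _).1]; exact (hχ01 _).2
      have b4 := hC1 (x + y)
      rw [Real.norm_eq_abs] at b4
      have b5 := hC2 (x + y)
      have p1 : u (x + y) * (η x * bilA A (x + y) (gradient η x) (gradient u (x + y))) ≤ C1 * (1 * (μ * ‖gradient η x‖ * C2)) := by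
        refine (le_abs_self _).trans ?_
        rw [abs_mul, abs_mul]
        gcongr
        exact b1.trans (by gcongr)
      have p2 : u (x + y) ^ 2 * quadA A (x + y) (gradient η x) ≤ C1 ^ 2 * (μ * ‖gradient η x‖ ^ 2) := by
        rw [← sq_abs (u _)]
        have := quadA_nonneg (x := x + y) h (gradient η x)
        gcongr
      have p3 : 0 ≤ μ * C1 ^ 2 * ‖gradient η x‖ := by positivity
      have p4 : 0 ≤ 2 * μ * C1 * C2 * ‖gradient η x‖ ^ 2 := by positivity
      simp only [hCu]
      nlinarith
    have hprod : Integrable (fun p : Ed d × Ed d => η p.2 ^ 2 * den A W u u (p.2 + p.1)) ((volume.restrict (cell d)).prod volume) := by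
      have hc : Integrable (fun _ : Ed d => (μ + M) * (C2 ^ 2 + C1 ^ 2)) (volume.restrict (cell d)) := cont_intOn continuous_const cell_bdd
      refine (hc.mul_prod hi2).mono' ?_ (ae_of_all _ fun p => ?_)
      · exact (((hηc.measurable.comp measurable_snd).pow_const 2).mul (hdm.comp (measurable_snd.add measurable_fst))).aestronglyMeasurable
      · rw [Real.norm_eq_abs, abs_mul, abs_of_nonneg (sq_nonneg _), mul_comm]
        exact mul_le_mul_of_nonneg_right (hdb _) (sq_nonneg _)
    have hswap := integral_integral_swap (f := fun y x => η x ^ 2 * den A W u u (x + y)) hprod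
    have hint : 0 ≤ ∫ y in cell d, ((∫ x, η x ^ 2 * den A W u u (x + y)) + ∫ x, Cu * (‖gradient η x‖ + ‖gradient η x‖ ^ 2)) :=
      integral_nonneg hy
    rw [integral_add hprod.integral_prod_left (cont_intOn continuous_const cell_bdd)] at hint
    rw [hswap] at hint
    have e3 : ∀ x, ∫ y in cell d, η x ^ 2 * den A W u u (x + y) = η x ^ 2 * QT := by
      intro x
      rw [integral_const_mul, hQT, ← per_shift (den_per hA hW hup hup) x]
      simp_rw [add_comm x]
    simp_rw [e3] at hint
    rw [integral_mul_const, integral_const_mul, integral_add, setIntegral_const, smul_eq_mul] at hint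
    · have s1 : ∫ x, η x ^ 2 = R ^ d * c2 := by
        have := Measure.integral_comp_inv_smul_of_nonneg (volume : Measure (Ed d)) (fun x => χ x ^ 2) hR.le
        simpa using this
      have s2 : ∫ x, ‖gradient η x‖ = R ^ d * (R⁻¹ * g1) := by
        have := Measure.integral_comp_inv_smul_of_nonneg (volume : Measure (Ed d)) (fun x => R⁻¹ * ‖gradient χ x‖) hR.le
        simp only [hηg, norm_smul, Real.norm_of_nonneg (inv_nonneg.2 hR.le)]
        rw [this, integral_const_mul]; simp [hg1]
      have s3 : ∫ x, ‖gradient η x‖ ^ 2 = R ^ d * ((R⁻¹) ^ 2 * g2) := by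
        have := Measure.integral_comp_inv_smul_of_nonneg (volume : Measure (Ed d)) (fun x => (R⁻¹ * ‖gradient χ x‖) ^ 2) hR.le
        simp only [hηg, norm_smul, Real.norm_of_nonneg (inv_nonneg.2 hR.le)]
        rw [this]
        simp_rw [mul_pow]
        rw [integral_const_mul]; simp [hg2]
      rw [s1, s2, s3] at hint
      have hRd : 0 < R ^ d := by positivity
      have : 0 ≤ R ^ d * (c2 * QT + vc * Cu * (R⁻¹ * g1 + (R⁻¹) ^ 2 * g2)) := by
        refine hint.trans (le_of_eq ?_)
        simp only [hvc]; ring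
      exact nonneg_of_mul_nonneg_right this hRd
    · exact hηt.integrable_cont (by fun_prop) fun x hx => by simp [grad_zero_off hx]
    · exact hηt.integrable_cont (by fun_prop) fun x hx => by simp [grad_zero_off hx]
  have T : Tendsto (fun R : ℝ => c2 * QT + vc * Cu * (R⁻¹ * g1 + (R⁻¹) ^ 2 * g2)) atTop
      (𝓝 (c2 * QT + vc * Cu * (0 * g1 + 0 ^ 2 * g2))) := by
    have := tendsto_inv_atTop_zero (𝕜 := ℝ)
    exact (((this.mul_const _).add ((this.pow 2).mul_const _)).const_mul _).const_add _
  have := ge_of_tendsto T (by filter_upwards [eventually_gt_atTop 0] with R hR using key R hR)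
  have h2 : 0 ≤ c2 * QT := by simpa using this
  exact nonneg_of_mul_nonneg_right h2 hc2p

end E1b

/-- approximate positive solutions -/
structure Appr {d : ℕ} (A : Ed d → Fin d → Fin d → ℝ) (W : Ed d → ℝ) (u : ℕ → Ed d → ℝ) : Prop where
  sm : ∀ n, ContDiff ℝ (⊤ : ℕ∞) (u n)
  pos : ∀ n x, 0 < u n x
  bd : ∀ R : ℝ, ∃ C, 0 ≤ C ∧ ∀ n (x0 : Ed d), ∫ x in Metric.ball x0 R, H1n (u n) x ≤ C
  eq : ∀ R ε : ℝ, 0 < ε → ∀ᶠ n in atTop, ∀ ψ, IsTest ψ → (∀ x, x ∉ Metric.ball (0 : Ed d) R → ψ x = 0) →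
    |BQ A W (u n) ψ| ≤ ε * Real.sqrt (∫ x, H1n ψ x)
  mass : ∃ c R0 : ℝ, 0 < c ∧ ∀ n, c ≤ ∫ x in Metric.ball (0 : Ed d) R0, u n x ^ 2

section E34
variable {d : ℕ} {A : Ed d → Fin d → Fin d → ℝ} {W : Ed d → ℝ} {μ M : ℝ} {u v a ψ : Ed d → ℝ}

lemma bilA_sum_right {ι : Type*} (s : Finset ι) (x ξ : Ed d) (f : ι → Ed d) :
    bilA A x ξ (∑ i ∈ s, f i) = ∑ i ∈ s, bilA A x ξ (f i) := by
  classical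
  induction s using Finset.induction_on with
  | empty => simp [bilA]
  | insert j s hj ih => rw [Finset.sum_insert hj, Finset.sum_insert hj, bilA_add_right, ih]

lemma quad_cs (h : Coef A W μ M) {ι : Type*} (s : Finset ι) (x : Ed d) (c : ι → ℝ) (f : ι → Ed d) :
    quadA A x (∑ i ∈ s, c i • f i) ≤ (∑ i ∈ s, c i ^ 2) * ∑ i ∈ s, quadA A x (f i) := by
  have h1 : quadA A x (∑ i ∈ s, c i • f i) = ∑ i ∈ s, ∑ j ∈ s, c i * c j * bilA A x (f i) (f j) := by
    rw [← bilA_self, bilA_sum_right]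
    simp_rw [bilA_comm h (∑ i ∈ s, c i • f i), bilA_sum_right]
    refine Finset.sum_congr rfl fun i _ => Finset.sum_congr rfl fun j _ => ?_
    rw [bilA_smul_left, bilA_smul_right]; ring
  have h2 : ∀ i j, c i * c j * bilA A x (f i) (f j) ≤ 2⁻¹ * (c i ^ 2 * quadA A x (f j)) + 2⁻¹ * (c j ^ 2 * quadA A x (f i)) := by
    intro i j
    have := quadA_nonneg (x := x) h (c i • f j + (-c j) • f i)
    rw [quadA_add h, quadA_smul, quadA_smul, bilA_smul_left, bilA_smul_right, bilA_comm h (f j)] at this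
    nlinarith
  rw [h1]
  refine (Finset.sum_le_sum fun i _ => Finset.sum_le_sum fun j _ => h2 i j).trans (le_of_eq ?_)
  simp_rw [Finset.sum_add_distrib, ← Finset.mul_sum]
  rw [Finset.sum_comm (f := fun i j => c j ^ 2 * quadA A x (f i))]
  simp_rw [← Finset.mul_sum, ← Finset.sum_mul]
  ring

set_option maxHeartbeats 1000000 in
lemma E3 (h : Coef A W μ M) (hA : IsPer A) (hW : IsPer W) (ha : IsTest a) {δ : ℝ} (hδ : 0 < δ) :
    ∃ u : Ed d → ℝ, ContDiff ℝ (⊤ : ℕ∞) u ∧ (∀ x, 0 < u x) ∧ IsPer u ∧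
      ∫ x in cell d, u x ^ 2 = (∫ x, a x ^ 2) + δ ^ 2 * volume.real (cell d) ∧
      ∫ x in cell d, den A W u u x ≤ QA A W a + δ ^ 2 * M * volume.real (cell d) := by
  set b : Ed d → ℝ := fun x => a x ^ 2 with hb
  have hbt : IsTest b := ⟨ha.1.pow 2, by
    refine HasCompactSupport.intro (K := tsupport a) ha.2 fun x hx => ?_
    simp [hb, image_eq_zero_of_notMem_tsupport hx]⟩
  have hPs := Per_smooth hbt
  have hP0 : ∀ x, 0 ≤ Per b x := fun x => tsum_nonneg fun g => sq_nonneg _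
  have hδ2 : 0 < δ ^ 2 := by positivity
  set u : Ed d → ℝ := fun x => Real.sqrt (Per b x + δ ^ 2) with hu
  have husq : ∀ x, u x ^ 2 = Per b x + δ ^ 2 := fun x => Real.sq_sqrt (by have := hP0 x; positivity)
  have hup : ∀ x, 0 < u x := fun x => Real.sqrt_pos.2 (by have := hP0 x; positivity)
  have hus : ContDiff ℝ (⊤ : ℕ∞) u := (hPs.add contDiff_const).sqrt fun x => by have := hP0 x; positivity
  have huper : IsPer u := fun g x => by simp only [hu, Per_per b g x]
  obtain ⟨R0, hR0, hcell⟩ := cell_rad (d := d)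
  obtain ⟨R1, hR1⟩ := ha.2.isCompact.isBounded.subset_ball (0 : Ed d)
  set R := max R0 R1
  have hcR : cell d ⊆ Metric.ball 0 R := hcell.trans (Metric.ball_subset_ball (le_max_left _ _))
  have hts : ∀ x, x ∉ Metric.ball (0 : Ed d) R → x ∉ tsupport a := fun x hx h' =>
    hx (Metric.ball_subset_ball (le_max_right _ _) (hR1 h'))
  have haz : ∀ x, x ∉ Metric.ball (0 : Ed d) R → a x = 0 := fun x hx => image_eq_zero_of_notMem_tsupport (hts x hx)
  have hbz : ∀ x, x ∉ Metric.ball (0 : Ed d) R → b x = 0 := fun x hx => by simp [hb, haz x hx]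
  have hgrad : ∀ x ∈ cell d, u x • gradient u x = ∑ g ∈ FS d R, a (x + g) • gradient a (x + g) := by
    intro x hx
    have hd2 : HasDerivAt (fun t : ℝ => t ^ 2) (2 * u x) (u x) := by simpa using hasDerivAt_pow 2 (u x)
    have e1 : gradient (fun y => u y ^ 2) x = (2 * u x) • gradient u x := grad_comp hd2 (c1_diff (sm_c1 hus))
    have e2 : gradient (fun y => u y ^ 2) x = gradient (Per b) x := by
      simp_rw [husq]; exact grad_add_const _
    rw [e2, Per_grad hbt hbz (hcR hx)] at e1
    have e3 : ∀ y, gradient b y = (2 * a y) • gradient a y := by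
      intro y
      have hd2 : HasDerivAt (fun t : ℝ => t ^ 2) (2 * a y) (a y) := by simpa using hasDerivAt_pow 2 (a y)
      exact grad_comp hd2 (c1_diff ha.c1)
    simp_rw [e3] at e1
    have e4 : u x • gradient u x = (2⁻¹ : ℝ) • ((2 * u x) • gradient u x) := by module
    rw [e4, ← e1, Finset.smul_sum]
    refine Finset.sum_congr rfl fun g _ => by module
  have hquad : ∀ x ∈ cell d, quadA A x (gradient u x) ≤ ∑ g ∈ FS d R, quadA A (x + g) (gradient a (x + g)) := by
    intro x hx
    have h1 := quad_cs h (FS d R) x (fun g => a (x + g)) (fun g => gradient a (x + g))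
    rw [← hgrad x hx, quadA_smul] at h1
    have h2 : ∑ g ∈ FS d R, a (x + g) ^ 2 ≤ u x ^ 2 := by
      rw [husq, Per_eq hbz (hcR hx)]; simp only [hb]; linarith
    have h3 : ∀ g ∈ FS d R, quadA A (x + g) (gradient a (x + g)) = quadA A x (gradient a (x + g)) := fun g _ => by
      simp only [quadA, hA g x]
    rw [Finset.sum_congr rfl h3]
    have h4 : 0 ≤ ∑ g ∈ FS d R, quadA A x (gradient a (x + g)) := Finset.sum_nonneg fun g _ => quadA_nonneg h _
    have h5 := h1.trans (mul_le_mul_of_nonneg_right h2 h4)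
    exact le_of_mul_le_mul_left h5 (by have := hup x; positivity)
  have hbi : Integrable b := hbt.integrable_cont hbt.cont fun x hx => image_eq_zero_of_notMem_tsupport hx
  refine ⟨u, hus, hup, huper, ?_, ?_⟩
  · rw [unfold_int hbi hcR hbz]
    have e : ∫ x in cell d, u x ^ 2 = ∫ x in cell d, ((∑ g ∈ FS d R, b (x + g)) + δ ^ 2) :=
      setIntegral_congr_fun cell_meas fun x hx => by simp only [husq, Per_eq hbz (hcR hx)]
    rw [e, integral_add _ (cont_intOn continuous_const cell_bdd), setIntegral_const, smul_eq_mul, mul_comm]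
    exact integrable_finsetSum _ fun g _ => (hbi.comp_add_right _).integrableOn
  · have hdi := den_integrable h ha.c1 ha.c1 ha.2
    rw [QA_eq, unfold_int hdi hcR]
    · have e : δ ^ 2 * M * volume.real (cell d) = ∫ x in cell d, δ ^ 2 * M := by simp [mul_comm]
      have hi1 : IntegrableOn (fun x => ∑ g ∈ FS d R, den A W a a (x + g)) (cell d) :=
        integrable_finsetSum _ fun g _ => (hdi.comp_add_right _).integrableOn
      rw [e, ← integral_add hi1 (cont_intOn continuous_const cell_bdd)]
      refine setIntegral_mono_on (den_intOn h (sm_c1 hus) (sm_c1 hus) cell_bdd) (I_add hi1 (cont_intOn continuous_const cell_bdd)) cell_meas fun x hx => ?_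
      simp only [den, bilA_self]
      have h1 := hquad x hx
      have h2 : W x * u x * u x = (∑ g ∈ FS d R, W (x + g) * a (x + g) * a (x + g)) + W x * δ ^ 2 := by
        rw [mul_assoc, ← sq, husq, Per_eq hbz (hcR hx), mul_add, Finset.mul_sum]
        congr 1
        refine Finset.sum_congr rfl fun g _ => ?_
        rw [hW g x]; simp only [hb]; ring
      rw [h2, Finset.sum_add_distrib]
      have h3 : W x ≤ M := (le_abs_self _).trans (h.bW x)
      nlinarith
    · intro x hx
      simp [den, haz x hx, grad_zero_off (hts x hx), bilA]

set_option maxHeartbeats 1000000 in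
lemma E4 (h : Coef A W μ M) (hpos : ∀ u, IsTest u → 0 ≤ QA A W u) (hA : IsPer A) (hW : IsPer W)
    (hu : ContDiff ℝ (⊤ : ℕ∞) u) (hup : IsPer u) {R : ℝ} (hcR : cell d ⊆ Metric.ball 0 R) (hψ : IsTest ψ)
    (hψz : ∀ x, x ∉ Metric.ball (0 : Ed d) R → ψ x = 0) (hψt : ∀ x, x ∉ Metric.ball (0 : Ed d) R → gradient ψ x = 0) :
    (BQ A W u ψ) ^ 2 ≤ (∫ x in cell d, den A W u u x) * ((μ + M) * ((FS d R).card * ∫ x, H1n ψ x)) := by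
  have hu1 := sm_c1 hu
  have hμ0 : 0 < μ := by linarith [h.hμ]
  have hM := Mnn h
  set Ψ := Per ψ with hΨ
  have hΨs : ContDiff ℝ (⊤ : ℕ∞) Ψ := Per_smooth hψ
  have hΨ1 := sm_c1 hΨs
  have hΨp : IsPer Ψ := Per_per ψ
  have hΨe : ∀ x ∈ cell d, Ψ x = ∑ g ∈ FS d R, ψ (x + g) := fun x hx => Per_eq hψz (hcR hx)
  have hΨg : ∀ x ∈ cell d, gradient Ψ x = ∑ g ∈ FS d R, gradient ψ (x + g) := fun x hx => Per_grad hψ hψz (hcR hx)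
  have hb : BQ A W u ψ = ∫ x in cell d, den A W u Ψ x := by
    unfold BQ
    rw [unfold_int (den_integrable h hu1 hψ.c1 hψ.2) hcR]
    · refine setIntegral_congr_fun cell_meas fun x hx => ?_
      simp only [den, hΨe x hx, hΨg x hx, bilA_sum_right, Finset.mul_sum, ← Finset.sum_add_distrib]
      refine Finset.sum_congr rfl fun g _ => ?_
      rw [hW g x, hup g x, grad_per hup g x]
      simp only [bilA, hA g x]
    · intro x hx
      simp [den, hψz x hx, hψt x hx, bilA]
  have hH : Integrable (H1n ψ) := hψ.integrable_cont (H1n_cont hψ.c1) fun x hx => by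
    simp [H1n, grad_zero_off hx, image_eq_zero_of_notMem_tsupport hx]
  have hp : ∫ x in cell d, den A W Ψ Ψ x ≤ (μ + M) * ((FS d R).card * ∫ x, H1n ψ x) := by
    rw [unfold_int hH hcR, ← integral_const_mul, ← integral_const_mul]
    · refine setIntegral_mono_on (den_intOn h hΨ1 hΨ1 cell_bdd) ?_ cell_meas fun x hx => ?_
      · exact ((integrable_finsetSum _ fun g _ => (hH.comp_add_right _).integrableOn).const_mul _).const_mul _
      · refine (le_abs_self _).trans ((den_self_le h x).trans ?_)
        gcongr
        unfold H1n
        rw [hΨe x hx, hΨg x hx, Finset.sum_add_distrib, mul_add]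
        gcongr
        · refine (pow_le_pow_left₀ (norm_nonneg _) (norm_sum_le _ _) 2).trans ?_
          exact sq_sum_le_card_mul_sum_sq
        · exact sq_sum_le_card_mul_sum_sq
    · intro x hx
      simp [H1n, hψz x hx, hψt x hx]
  set q := ∫ x in cell d, den A W u u x
  set p := ∫ x in cell d, den A W Ψ Ψ x
  have hq0 : 0 ≤ q := QT_nonneg h hpos hA hW hu hup
  have hquad : ∀ s : ℝ, 0 ≤ p * (s * s) + (2 * BQ A W u ψ) * s + q := by
    intro s
    have h1 := QT_nonneg (u := fun y => u y + s * Ψ y) h hpos hA hW (hu.add (contDiff_const.mul hΨs))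
      (fun g x => by simp only [hup g x, hΨp g x])
    simp_rw [den_add_smul h hu1 hΨ1] at h1
    rw [integral_add (I_add (den_intOn h hu1 hu1 cell_bdd) ((den_intOn h hu1 hΨ1 cell_bdd).const_mul _))
      ((den_intOn h hΨ1 hΨ1 cell_bdd).const_mul _), integral_add (den_intOn h hu1 hu1 cell_bdd) ((den_intOn h hu1 hΨ1 cell_bdd).const_mul _),
      integral_const_mul, integral_const_mul, ← hb] at h1
    simp only [q, p]
    linarith
  have hdis := discrim_le_zero hquad
  unfold discrim at hdis
  have : (BQ A W u ψ) ^ 2 ≤ q * p := by nlinarith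
  exact this.trans (mul_le_mul_of_nonneg_left hp hq0)

end E34

section appr
variable {d : ℕ} {A : Ed d → Fin d → Fin d → ℝ} {W : Ed d → ℝ} {μ M : ℝ}

lemma H1n_den (h : Coef A W μ M) (u : Ed d → ℝ) (x : Ed d) :
    H1n u x ≤ μ * (den A W u u x + M * u x ^ 2) + u x ^ 2 := by
  have h1 := (h.ell x (gradient u x)).1
  have hμ : 0 < μ := by linarith [h.hμ]
  have h2 : ‖gradient u x‖ ^ 2 ≤ μ * quadA A x (gradient u x) := by
    have := mul_le_mul_of_nonneg_left h1 hμ.le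
    rwa [mul_inv_cancel_left₀ hμ.ne'] at this
  have h3 := (abs_le.1 (h.bW x)).1
  unfold H1n den
  rw [bilA_self]
  have : -M * u x ^ 2 ≤ W x * u x ^ 2 := mul_le_mul_of_nonneg_right h3 (sq_nonneg _)
  have : μ * (-M * u x ^ 2) ≤ μ * (W x * u x ^ 2) := mul_le_mul_of_nonneg_left this hμ.le
  nlinarith

set_option maxHeartbeats 1000000 in
lemma appr (h : Coef A W μ M) (hpos : ∀ u, IsTest u → 0 ≤ QA A W u) (hA : IsPer A) (hW : IsPer W)
    (hinf : ∀ ε : ℝ, 0 < ε → ∃ a, IsTest a ∧ ∫ x, a x ^ 2 = 1 ∧ QA A W a < ε) : ∃ u, Appr A W u := by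
  have hμ : 0 < μ := by linarith [h.hμ]
  have hM := Mnn h
  set S := volume.real (cell d) with hS
  have hS0 : 0 < S := cell_vol_pos
  let e : ℕ → ℝ := fun n => 1 / ((n : ℝ) + 1)
  have he0 : ∀ n, 0 < e n := fun n => by positivity
  have he1 : ∀ n, e n ≤ 1 := fun n => by
    simp only [e]; rw [div_le_one (by positivity)]; linarith [(Nat.cast_nonneg n : (0:ℝ) ≤ n)]
  have het : Tendsto e atTop (𝓝 0) := tendsto_one_div_add_atTop_nhds_zero_nat
  have key : ∀ n, ∃ u : Ed d → ℝ, ContDiff ℝ (⊤ : ℕ∞) u ∧ (∀ x, 0 < u x) ∧ IsPer u ∧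
      1 ≤ ∫ x in cell d, u x ^ 2 ∧ ∫ x in cell d, u x ^ 2 ≤ 1 + S ∧
      ∫ x in cell d, den A W u u x ≤ e n * (1 + M * S) := by
    intro n
    obtain ⟨a, ha, ha1, ha2⟩ := hinf (e n) (he0 n)
    obtain ⟨u, h1, h2, h3, h4, h5⟩ := E3 h hA hW ha (he0 n)
    have e2 : e n ^ 2 ≤ e n := by nlinarith [he0 n, he1 n]
    refine ⟨u, h1, h2, h3, ?_, ?_, ?_⟩
    · rw [h4, ha1]; have := he0 n; nlinarith [mul_pos (pow_pos this 2) hS0]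
    · rw [h4, ha1]; have := he1 n; nlinarith
    · have : e n ^ 2 * (M * S) ≤ e n * (M * S) := mul_le_mul_of_nonneg_right e2 (by positivity)
      nlinarith
  choose u hus hup hper hu1 hu2 hu3 using key
  obtain ⟨R0, hR0, hcR⟩ := cell_rad (d := d)
  have hH : ∀ n, ∫ x in cell d, H1n (u n) x ≤ μ * ((1 + M * S) + M * (1 + S)) + (1 + S) := by
    intro n
    have c1 := sm_c1 (hus n)
    have i0 := cont_intOn (H1n_cont c1) (cell_bdd (d := d))
    have i1 := den_intOn h c1 c1 (cell_bdd (d := d))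
    have i2 : IntegrableOn (fun x => u n x ^ 2) (cell d) := cont_intOn (by have := c1.continuous; fun_prop) cell_bdd
    have i3 := I_add i1 (i2.const_mul M)
    calc _ ≤ ∫ x in cell d, (μ * (den A W (u n) (u n) x + M * u n x ^ 2) + u n x ^ 2) :=
          setIntegral_mono i0 (I_add (i3.const_mul μ) i2) fun x => H1n_den h _ x
      _ = μ * ((∫ x in cell d, den A W (u n) (u n) x) + M * ∫ x in cell d, u n x ^ 2) + ∫ x in cell d, u n x ^ 2 := by
          rw [integral_add (i3.const_mul μ) i2, integral_const_mul, integral_add i1 (i2.const_mul M), integral_const_mul]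
      _ ≤ _ := by
          have := hu2 n
          have := hu3 n
          have : e n * (1 + M * S) ≤ 1 * (1 + M * S) := mul_le_mul_of_nonneg_right (he1 n) (by positivity)
          gcongr
          linarith
  have hHper : ∀ n, IsPer (H1n (u n)) := fun n g x => by
    unfold H1n; rw [grad_per (hper n) g x, hper n g x]
  refine ⟨u, hus, hup, fun R => ?_, fun R ε hε => ?_, 1, R0, one_pos, fun n => ?_⟩
  · refine ⟨(FS d (max R R0)).card * (μ * ((1 + M * S) + M * (1 + S)) + (1 + S)), by positivity, fun n x0 => ?_⟩
    refine le_trans ?_ ((per_ball (hHper n) (fun x => H1n_nonneg x) (H1n_cont (sm_c1 (hus n))) (hcR.trans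
      (Metric.ball_subset_ball (le_max_right R R0))) x0).trans (mul_le_mul_of_nonneg_left (hH n) (Nat.cast_nonneg _)))
    exact setIntegral_mono_set (cont_intOn (H1n_cont (sm_c1 (hus n))) Metric.isBounded_ball)
      (ae_of_all _ fun x => H1n_nonneg x) (Metric.ball_subset_ball (le_max_left R R0)).eventuallyLE
  · set R1 := max (R + 1) R0
    set C := (1 + M * S) * ((μ + M) * ((FS d R1).card : ℝ)) with hC
    have hC0 : 0 ≤ C := by positivity
    have : Tendsto (fun n => e n * C) atTop (𝓝 0) := by simpa using het.mul_const C
    filter_upwards [this.eventually (gt_mem_nhds (pow_pos hε 2))] with n hn ψ hψ hψz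
    have hts : tsupport ψ ⊆ Metric.closedBall 0 R :=
      closure_minimal (fun x hx => by
        by_contra hc
        exact hx (hψz x fun hb => hc (Metric.ball_subset_closedBall hb))) Metric.isClosed_closedBall
    have hts' : ∀ x, x ∉ Metric.ball (0 : Ed d) R1 → x ∉ tsupport ψ := fun x hx hxt => hx (by
      have := hts hxt
      rw [mem_closedBall_zero_iff] at this
      rw [mem_ball_zero_iff]
      have := le_max_left (R + 1) R0
      simp only [R1]; linarith)
    have := E4 h hpos hA hW (hus n) (hper n) (hcR.trans (Metric.ball_subset_ball (le_max_right (R + 1) R0))) hψ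
      (fun x hx => image_eq_zero_of_notMem_tsupport (hts' x hx)) (fun x hx => grad_zero_off (hts' x hx))
    have hI : 0 ≤ ∫ x, H1n ψ x := integral_nonneg fun x => H1n_nonneg x
    apply abs_le_of_sq_le_sq _ (by positivity)
    rw [mul_pow, Real.sq_sqrt hI]
    refine this.trans ((mul_le_mul_of_nonneg_right (hu3 n) (by positivity)).trans ?_)
    calc _ = e n * C * ∫ x, H1n ψ x := by rw [hC]; ring
      _ ≤ _ := mul_le_mul_of_nonneg_right hn.le hI
  · refine (hu1 n).trans ?_
    exact setIntegral_mono_set (cont_intOn (by have := (hus n).continuous; fun_prop) Metric.isBounded_ball)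
      (ae_of_all _ fun x => sq_nonneg _) hcR.eventuallyLE

end appr

section holef
variable {d : ℕ}

lemma un_le {f : Ed d → ℝ} (hf : Continuous f) (h0 : ∀ x, 0 ≤ f x) {S T : Set (Ed d)} (hS : Bornology.IsBounded S)
    (hT : Bornology.IsBounded T) (hTm : MeasurableSet T) (hSm : MeasurableSet S) :
    ∫ x in S ∪ T, f x ≤ (∫ x in S, f x) + ∫ x in T, f x := by
  rw [← Set.union_sdiff_self, setIntegral_union Set.disjoint_sdiff_right (hTm.diff hSm) (cont_intOn hf hS)
    ((cont_intOn hf hT).mono_set Set.sdiff_subset)]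
  gcongr
  · exact ae_of_all _ h0
  · exact cont_intOn hf hT
  · exact Set.sdiff_subset

lemma mono_int {f : Ed d → ℝ} (hf : Continuous f) (h0 : ∀ x, 0 ≤ f x) {S T : Set (Ed d)} (hT : Bornology.IsBounded T)
    (hST : S ⊆ T) : ∫ x in S, f x ≤ ∫ x in T, f x :=
  setIntegral_mono_set (cont_intOn hf hT) (ae_of_all _ h0) hST.eventuallyLE

lemma bump (d : ℕ) : ∃ G : ℝ, 0 < G ∧ ∀ (x0 : Ed d) (R : ℝ), 0 < R → ∃ η : Ed d → ℝ, IsTest η ∧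
    (∀ x, 0 ≤ η x ∧ η x ≤ 1) ∧ (∀ x, dist x x0 ≤ 3 / 2 * R → η x = 1) ∧ (∀ x, 2 * R ≤ dist x x0 → η x = 0) ∧
    (∀ x, dist x x0 ≤ 3 / 2 * R → gradient η x = 0) ∧ (∀ x, 2 * R ≤ dist x x0 → gradient η x = 0) ∧
    ∀ x, ‖gradient η x‖ ≤ G / R := by
  let f : ContDiffBump (0 : Ed d) := ⟨3 / 2, 2, by norm_num, by norm_num⟩
  have hft : IsTest (f : Ed d → ℝ) := ⟨f.contDiff, f.hasCompactSupport⟩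
  obtain ⟨G, hG⟩ := (grad_cont hft.c1).bounded_above_of_compact_support (grad_compact hft.2)
  refine ⟨max G 1, by positivity, fun x0 R hR => ?_⟩
  set η : Ed d → ℝ := fun x => f (R⁻¹ • (x - x0)) with hη
  have hn : ∀ x, ‖R⁻¹ • (x - x0)‖ = R⁻¹ * dist x x0 := fun x => by
    rw [norm_smul, dist_eq_norm, Real.norm_of_nonneg (by positivity)]
  have hs : ContDiff ℝ (⊤ : ℕ∞) η := f.contDiff.comp (by fun_prop)
  have h1 : ∀ x, dist x x0 ≤ 3 / 2 * R → η x = 1 := fun x hx => f.one_of_mem_closedBall (by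
    rw [mem_closedBall_zero_iff, hn, inv_mul_le_iff₀ hR]; simpa [f, mul_comm] using hx)
  have h2 : ∀ x, 2 * R ≤ dist x x0 → η x = 0 := fun x hx => f.zero_of_le_dist (by
    rw [dist_zero_right, hn, le_inv_mul_iff₀ hR]; simpa [f, mul_comm] using hx)
  have hb : ∀ x, 0 ≤ η x ∧ η x ≤ 1 := fun x => ⟨f.nonneg, f.le_one⟩
  refine ⟨η, ⟨hs, HasCompactSupport.intro (isCompact_closedBall x0 (2 * R)) fun x hx => h2 x (by
    rw [Metric.mem_closedBall] at hx; linarith)⟩, hb, h1, h2, fun x hx => ?_, fun x hx => ?_, fun x => ?_⟩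
  · have : IsLocalMax η x := Eventually.of_forall fun y => by rw [h1 x hx]; exact (hb y).2
    simp [gradient, this.fderiv_eq_zero]
  · have : IsLocalMin η x := Eventually.of_forall fun y => by rw [h2 x hx]; exact (hb y).1
    simp [gradient, this.fderiv_eq_zero]
  · have e : gradient η x = R⁻¹ • gradient (f : Ed d → ℝ) (R⁻¹ • (x - x0)) := by
      have e1 : η = fun y => (fun z => f (R⁻¹ • z)) (y + -x0) := by ext y; simp [hη, sub_eq_add_neg]
      rw [e1, grad_translate (u := fun z => f (R⁻¹ • z)), grad_scale (u := (f : Ed d → ℝ)) _ (c1_diff hft.c1), sub_eq_add_neg]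
    rw [e, norm_smul, Real.norm_of_nonneg (by positivity), div_eq_inv_mul]
    exact mul_le_mul_of_nonneg_left ((hG _).trans (le_max_left _ _)) (by positivity)

/-- cap of a disc -/
def cap (x0 : Ed 2) (R : ℝ) (i : Fin 2) (s : ℝ) : Set (Ed 2) := {x | R < s * (x i - x0 i)} ∩ Metric.ball x0 (2 * R)

/-- corner disc -/
def cor (x0 : Ed 2) (R s t : ℝ) : Set (Ed 2) := Metric.ball (x0 + !₂[5 / 4 * R * s, 5 / 4 * R * t]) (R / 5)

lemma cap_conv (x0 : Ed 2) (R : ℝ) (i : Fin 2) (s : ℝ) : Convex ℝ (cap x0 R i s) := by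
  refine Convex.inter (fun x hx y hy a b ha hb hab => ?_) (convex_ball _ _)
  simp only [Set.mem_ofPred_eq, PiLp.add_apply, PiLp.smul_apply, smul_eq_mul] at *
  have : s * (a * x i + b * y i - x0 i) - R = a * (s * (x i - x0 i) - R) + b * (s * (y i - x0 i) - R) := by
    have : b = 1 - a := by linarith
    subst this; ring
  rcases ha.eq_or_lt with rfl | ha
  · have : b = 1 := by linarith
    subst this; simpa using hy
  · nlinarith [mul_pos ha (sub_pos.2 hx), mul_nonneg hb (sub_pos.2 hy).le]

lemma cap_open (x0 : Ed 2) (R : ℝ) (i : Fin 2) (s : ℝ) : IsOpen (cap x0 R i s) :=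
  (isOpen_lt (by fun_prop) (by fun_prop)).inter Metric.isOpen_ball

lemma cd_le (x y : Ed 2) (i : Fin 2) : |x i - y i| ≤ dist x y := by
  rw [dist_eq_norm]
  simpa using PiLp.norm_apply_le (x - y) i

lemma cor_sub (x0 : Ed 2) {R s t : ℝ} (hR : 0 < R) (hs : s = 1 ∨ s = -1) (ht : t = 1 ∨ t = -1) :
    cor x0 R s t ⊆ cap x0 R 0 s ∧ cor x0 R s t ⊆ cap x0 R 1 t := by
  have hb : cor x0 R s t ⊆ Metric.ball x0 (2 * R) := by
    refine Metric.ball_subset_ball' ?_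
    have : dist (x0 + !₂[5 / 4 * R * s, 5 / 4 * R * t]) x0 ≤ 9 / 5 * R := by
      rw [dist_eq_norm, add_sub_cancel_left, EuclideanSpace.norm_eq]
      apply Real.sqrt_le_iff.2 ⟨by positivity, ?_⟩
      simp only [Fin.sum_univ_two, Real.norm_eq_abs, sq_abs]
      have h1 : s ^ 2 = 1 := by rcases hs with rfl | rfl <;> norm_num
      have h2 : t ^ 2 = 1 := by rcases ht with rfl | rfl <;> norm_num
      simp
      simp only [mul_pow, h1, h2]
      nlinarith [sq_nonneg R]
    linarith
  refine ⟨fun x hx => ⟨?_, hb hx⟩, fun x hx => ⟨?_, hb hx⟩⟩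
  · have := (cd_le x _ 0).trans_lt hx
    simp at this
    simp only [Set.mem_ofPred_eq]
    have := abs_lt.1 this
    rcases hs with rfl | rfl <;> linarith
  · have := (cd_le x _ 1).trans_lt hx
    simp at this
    simp only [Set.mem_ofPred_eq]
    have := abs_lt.1 this
    rcases ht with rfl | rfl <;> linarith

set_option maxHeartbeats 1000000 in
lemma annP {u : Ed 2 → ℝ} (hu : ContDiff ℝ 1 u) (x0 : Ed 2) {R : ℝ} (hR : 0 < R) : ∃ c,
    ∫ x in Metric.ball x0 (2 * R) \ Metric.ball x0 (3 / 2 * R), (u x - c) ^ 2 ≤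
      (406 * 6400) * R ^ 2 * ∫ x in Metric.ball x0 (2 * R) \ Metric.ball x0 R, ‖gradient u x‖ ^ 2 ∧
    ∫ x in Metric.ball x0 (2 * R), (u x - c) ^ 2 ≤ 6400 * R ^ 2 * ∫ x in Metric.ball x0 (2 * R), ‖gradient u x‖ ^ 2 := by
  have hgc := grad_cont hu
  have huc := hu.continuous
  set ω := volume.real (Metric.ball (0 : Ed 2) 1)
  have hω : 0 < ω := om_pos
  have hv : ∀ s t, volume.real (cor x0 R s t) = (R / 5) ^ 2 * ω := fun s t => ball_vol _ (by positivity)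
  have hvp : ∀ s t, 0 < volume.real (cor x0 R s t) := fun s t => by rw [hv]; positivity
  have hP : ∀ s t, (volume.real (cor x0 R s t))⁻¹ * ((2 * (2 * R)) ^ 2 * volume.real (Metric.ball (0 : Ed 2) (2 * (2 * R)))) = 6400 * R ^ 2 := by
    intro s t
    rw [hv, ball_vol _ (by positivity)]
    field_simp
    ring
  set G := ∫ x in Metric.ball x0 (2 * R) \ Metric.ball x0 R, ‖gradient u x‖ ^ 2 with hG
  have hG0 : 0 ≤ G := integral_nonneg fun x => sq_nonneg _
  have hKG : ∀ i s, (s = 1 ∨ s = -1) → ∫ x in cap x0 R i s, ‖gradient u x‖ ^ 2 ≤ G := by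
    intro i s hs
    refine mono_int (by fun_prop) (fun x => sq_nonneg _) (Metric.isBounded_ball.subset Set.sdiff_subset) fun x hx => ⟨hx.2, fun hb => ?_⟩
    have h1 := (cd_le x x0 i).trans_lt hb
    have h2 : R < s * (x i - x0 i) := hx.1
    have := abs_lt.1 h1
    rcases hs with rfl | rfl <;> linarith
  have hKb : ∀ i s, Bornology.IsBounded (cap x0 R i s) := fun i s => Metric.isBounded_ball.subset Set.inter_subset_right
  have hKm : ∀ i s, MeasurableSet (cap x0 R i s) := fun i s => (cap_open x0 R i s).measurableSet
  have p1 : ∀ i s s' t', (s = 1 ∨ s = -1) → cor x0 R s' t' ⊆ cap x0 R i s →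
      ∫ x in cap x0 R i s, (u x - av u (cor x0 R s' t')) ^ 2 ≤ 6400 * R ^ 2 * G := by
    intro i s s' t' hs hsub
    have := poincG hu (cap_conv x0 R i s) (hKm i s) (by positivity) Set.inter_subset_right hsub (hvp _ _)
    rw [hP] at this
    exact this.trans (mul_le_mul_of_nonneg_left (hKG i s hs) (by positivity))
  have p2 : ∀ i s s' t' s2 t2, (s = 1 ∨ s = -1) → cor x0 R s' t' ⊆ cap x0 R i s → cor x0 R s2 t2 ⊆ cap x0 R i s →
      4 * R ^ 2 * ω * (av u (cor x0 R s2 t2) - av u (cor x0 R s' t')) ^ 2 ≤ 100 * (6400 * R ^ 2 * G) := by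
    intro i s s' t' s2 t2 hs hsub hsub2
    have := poincG2 hu (cap_conv x0 R i s) (hKm i s) (by positivity) Set.inter_subset_right hsub (hvp _ _) hsub2 (hvp _ _)
    rw [hP] at this
    have := this.trans (mul_le_mul_of_nonneg_left (mul_le_mul_of_nonneg_left (hKG i s hs) (by positivity)) (by have := hvp s2 t2; positivity))
    refine (mul_le_mul_of_nonneg_left this (by positivity)).trans (le_of_eq ?_)
    rw [hv]; field_simp; ring
  set c := av u (cor x0 R 1 1) with hc
  have o1 : (1:ℝ) = 1 ∨ (1:ℝ) = -1 := Or.inl rfl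
  have o2 : (-1:ℝ) = 1 ∨ (-1:ℝ) = -1 := Or.inr rfl
  have p3 : ∀ i s s' t', (s = 1 ∨ s = -1) → cor x0 R s' t' ⊆ cap x0 R i s →
      4 * R ^ 2 * ω * (av u (cor x0 R s' t') - c) ^ 2 ≤ 100 * (6400 * R ^ 2 * G) →
      ∫ x in cap x0 R i s, (u x - c) ^ 2 ≤ 202 * (6400 * R ^ 2 * G) := by
    intro i s s' t' hs hsub h2
    set b := av u (cor x0 R s' t')
    have i1 : IntegrableOn (fun x => (u x - b) ^ 2) (cap x0 R i s) := cont_intOn (by fun_prop) (hKb i s)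
    have i2 : IntegrableOn (fun _ => (b - c) ^ 2) (cap x0 R i s) := cont_intOn (by fun_prop) (hKb i s)
    have i3 : IntegrableOn (fun x => (u x - c) ^ 2) (cap x0 R i s) := cont_intOn (by fun_prop) (hKb i s)
    calc _ ≤ ∫ x in cap x0 R i s, (2 * (u x - b) ^ 2 + 2 * (b - c) ^ 2) :=
          setIntegral_mono i3 (I_add (i1.const_mul 2) (i2.const_mul 2)) fun x => by
            simp only []; nlinarith [sq_nonneg (u x - b - (b - c))]
      _ = 2 * (∫ x in cap x0 R i s, (u x - b) ^ 2) + 2 * (volume.real (cap x0 R i s) * (b - c) ^ 2) := by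
          rw [integral_add (i1.const_mul 2) (i2.const_mul 2), integral_const_mul, integral_const_mul, setIntegral_const, smul_eq_mul]
      _ ≤ 2 * (6400 * R ^ 2 * G) + 2 * (100 * (6400 * R ^ 2 * G)) := by
          have : volume.real (cap x0 R i s) ≤ 4 * R ^ 2 * ω := by
            refine (measureReal_mono Set.inter_subset_right measure_ball_lt_top.ne).trans (le_of_eq ?_)
            rw [ball_vol _ (by positivity)]; ring
          have h4 := (mul_le_mul_of_nonneg_right this (sq_nonneg (b - c))).trans h2
          have := p1 i s s' t' hs hsub
          linarith
      _ = _ := by ring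
  have k1 := p1 0 1 1 1 o1 (cor_sub x0 hR o1 o1).1
  have k2 := p1 1 1 1 1 o1 (cor_sub x0 hR o1 o1).2
  have k3 := p3 0 (-1) (-1) 1 o2 (cor_sub x0 hR o2 o1).1 (p2 1 1 1 1 (-1) 1 o1 (cor_sub x0 hR o1 o1).2 (cor_sub x0 hR o2 o1).2)
  have k4 := p3 1 (-1) 1 (-1) o2 (cor_sub x0 hR o1 o2).2 (p2 0 1 1 1 1 (-1) o1 (cor_sub x0 hR o1 o1).1 (cor_sub x0 hR o1 o2).1)
  refine ⟨c, ?_, ?_⟩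
  · have hcov : Metric.ball x0 (2 * R) \ Metric.ball x0 (3 / 2 * R) ⊆ (cap x0 R 0 1 ∪ cap x0 R 1 1) ∪ (cap x0 R 0 (-1) ∪ cap x0 R 1 (-1)) := by
      intro x hx
      by_contra hno
      simp only [Set.mem_union, cap, Set.mem_inter_iff, hx.1, and_true, Set.mem_ofPred_eq, not_or, not_lt] at hno
      obtain ⟨⟨a1, a2⟩, a3, a4⟩ := hno
      apply hx.2
      rw [Metric.mem_ball, EuclideanSpace.dist_eq, Real.sqrt_lt' (by positivity)]
      simp only [Fin.sum_univ_two, Real.dist_eq, sq_abs]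
      have : (x 0 - x0 0) ^ 2 ≤ R ^ 2 := sq_le_sq' (by linarith) (by linarith)
      have : (x 1 - x0 1) ^ 2 ≤ R ^ 2 := sq_le_sq' (by linarith) (by linarith)
      nlinarith [sq_pos_of_pos hR]
    have hf : Continuous fun x => (u x - c) ^ 2 := by fun_prop
    have hf0 : ∀ x, 0 ≤ (u x - c) ^ 2 := fun x => sq_nonneg _
    refine (mono_int hf hf0 (((hKb _ _).union (hKb _ _)).union ((hKb _ _).union (hKb _ _))) hcov).trans ?_
    have q0 := un_le hf hf0 ((hKb 0 1).union (hKb 1 1)) ((hKb 0 (-1)).union (hKb 1 (-1))) ((hKm _ _).union (hKm _ _)) ((hKm _ _).union (hKm _ _))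
    have q1 := un_le hf hf0 (hKb 0 1) (hKb 1 1) (hKm _ _) (hKm _ _)
    have q2 := un_le hf hf0 (hKb 0 (-1)) (hKb 1 (-1)) (hKm _ _) (hKm _ _)
    linarith
  · have := poincG hu (convex_ball x0 (2 * R)) measurableSet_ball (by positivity) subset_rfl
      ((cor_sub x0 hR o1 o1).1.trans Set.inter_subset_right) (hvp 1 1)
    rwa [hP] at this

end holef

section cacc
variable {d : ℕ} {A : Ed d → Fin d → Fin d → ℝ} {W : Ed d → ℝ} {μ M : ℝ}

lemma sqm_grad {η v : Ed d → ℝ} (hη : ContDiff ℝ 1 η) (hv : ContDiff ℝ 1 v) (x : Ed d) :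
    gradient (fun y => η y ^ 2 * v y) x = η x ^ 2 • gradient v x + (2 * η x * v x) • gradient η x := by
  rw [grad_mul (u := fun y => η y ^ 2) ((c1_diff hη).pow 2) (c1_diff hv)]
  have : gradient (fun y => η y ^ 2) x = (2 * η x) • gradient η x := by
    simp only [pow_two]
    rw [grad_mul (c1_diff hη) (c1_diff hη)]; module
  rw [this]; module

lemma cacc_pt (h : Coef A W μ M) {η u : Ed d → ℝ} (hη : ContDiff ℝ 1 η) (hu : ContDiff ℝ 1 u) (c : ℝ) {r : ℝ} (hr : 0 < r) (x : Ed d) :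
    (2 * μ)⁻¹ * (η x ^ 2 * ‖gradient u x‖ ^ 2) ≤ den A W u (fun y => η y ^ 2 * (u y - c)) x +
      (2 * μ ^ 3 * ((u x - c) ^ 2 * ‖gradient η x‖ ^ 2) + M * (η x ^ 2 * (r * u x ^ 2 + r⁻¹ * (u x - c) ^ 2))) := by
  have hμ : 0 < μ := by linarith [h.hμ]
  unfold den
  rw [sqm_grad hη (hu.sub contDiff_const), grad_sub_const, bilA_add_right, bilA_smul_right, bilA_smul_right, bilA_self]
  have h1 := (h.ell x (gradient u x)).1
  have h2 := abs_le.1 (bilA_abs_le (x := x) h (gradient u x) (gradient η x))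
  set g := ‖gradient u x‖
  set e := ‖gradient η x‖
  set w := u x - c
  have h3 : η x ^ 2 * (μ⁻¹ * g ^ 2) ≤ η x ^ 2 * quadA A x (gradient u x) := mul_le_mul_of_nonneg_left h1 (sq_nonneg _)
  have h4 : -(2 * |η x| * |w| * (μ * g * e)) ≤ 2 * η x * w * bilA A x (gradient u x) (gradient η x) := by
    refine (abs_le.1 (?_ : |2 * η x * w * bilA A x (gradient u x) (gradient η x)| ≤ _)).1
    rw [abs_mul, abs_mul, abs_mul, abs_two]
    exact mul_le_mul_of_nonneg_left (abs_le.2 h2) (by positivity)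
  have h5 : 2 * |η x| * |w| * (μ * g * e) ≤ (2 * μ)⁻¹ * (η x ^ 2 * g ^ 2) + 2 * μ ^ 3 * (w ^ 2 * e ^ 2) := by
    have := sq_nonneg (|η x| * g - 2 * μ ^ 2 * (|w| * e))
    have e1 : (|η x| * g - 2 * μ ^ 2 * (|w| * e)) ^ 2 = η x ^ 2 * g ^ 2 - 4 * μ ^ 2 * |η x| * g * |w| * e + 4 * μ ^ 4 * (w ^ 2 * e ^ 2) := by
      rw [← sq_abs (η x), ← sq_abs w]; ring
    rw [e1] at this
    have h6 := mul_le_mul_of_nonneg_left this (by positivity : 0 ≤ (2 * μ)⁻¹)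
    have e2 : (2 * μ)⁻¹ * (η x ^ 2 * g ^ 2 - 4 * μ ^ 2 * |η x| * g * |w| * e + 4 * μ ^ 4 * (w ^ 2 * e ^ 2)) =
      (2 * μ)⁻¹ * (η x ^ 2 * g ^ 2) - 2 * |η x| * |w| * (μ * g * e) + 2 * μ ^ 3 * (w ^ 2 * e ^ 2) := by field_simp; ring
    rw [e2] at h6; linarith
  have h7 : -(M * (η x ^ 2 * (r * u x ^ 2 + r⁻¹ * w ^ 2))) ≤ W x * u x * (η x ^ 2 * w) := by
    have k1 : |W x * u x * (η x ^ 2 * w)| ≤ M * (η x ^ 2 * (|u x| * |w|)) := by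
      rw [abs_mul, abs_mul, abs_mul, abs_of_nonneg (sq_nonneg (η x))]
      have := mul_le_mul_of_nonneg_right (h.bW x) (by positivity : 0 ≤ η x ^ 2 * (|u x| * |w|))
      linarith
    have k2 : |u x| * |w| ≤ r * u x ^ 2 + r⁻¹ * w ^ 2 := by
      have k3 := mul_nonneg (inv_nonneg.2 hr.le) (sq_nonneg (r * |u x| - |w|))
      have k4 : r⁻¹ * (r * |u x| - |w|) ^ 2 = r * u x ^ 2 - 2 * (|u x| * |w|) + r⁻¹ * w ^ 2 := by
        rw [← sq_abs (u x), ← sq_abs w]; field_simp; ring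
      have : 0 ≤ |u x| * |w| := by positivity
      linarith
    have k5 := mul_le_mul_of_nonneg_left (mul_le_mul_of_nonneg_left k2 (sq_nonneg (η x))) (Mnn h)
    linarith [(abs_le.1 (k1.trans k5)).1]
  have e3 : η x ^ 2 * (μ⁻¹ * g ^ 2) = (2 * μ)⁻¹ * (η x ^ 2 * g ^ 2) + (2 * μ)⁻¹ * (η x ^ 2 * g ^ 2) := by field_simp; ring
  linarith

lemma H1n_sqm {η v : Ed d → ℝ} (hη : ContDiff ℝ 1 η) (hv : ContDiff ℝ 1 v) {x : Ed d} (h0 : 0 ≤ η x) (h1 : η x ≤ 1) :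
    H1n (fun y => η y ^ 2 * v y) x ≤ 2 * ‖gradient v x‖ ^ 2 + 8 * (v x ^ 2 * ‖gradient η x‖ ^ 2) + v x ^ 2 := by
  unfold H1n
  rw [sqm_grad hη hv]
  have a1 : ‖η x ^ 2 • gradient v x + (2 * η x * v x) • gradient η x‖ ≤ ‖gradient v x‖ + 2 * |v x| * ‖gradient η x‖ := by
    refine (norm_add_le _ _).trans ?_
    rw [norm_smul, norm_smul, Real.norm_eq_abs, Real.norm_eq_abs, abs_mul, abs_mul, abs_two, abs_of_nonneg h0, abs_of_nonneg (sq_nonneg _)]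
    have : η x ^ 2 ≤ 1 := pow_le_one₀ h0 h1
    have b1 : η x ^ 2 * ‖gradient v x‖ ≤ 1 * ‖gradient v x‖ := mul_le_mul_of_nonneg_right this (norm_nonneg _)
    have b2 : η x * (2 * |v x| * ‖gradient η x‖) ≤ 1 * (2 * |v x| * ‖gradient η x‖) := mul_le_mul_of_nonneg_right h1 (by positivity)
    linarith
  have a2 := pow_le_pow_left₀ (norm_nonneg _) a1 2
  have a3 : (η x ^ 2 * v x) ^ 2 ≤ v x ^ 2 := by
    have : (η x ^ 2) ^ 2 ≤ 1 := pow_le_one₀ (sq_nonneg _) (pow_le_one₀ h0 h1)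
    nlinarith [mul_le_mul_of_nonneg_right this (sq_nonneg (v x))]
  have a4 : (‖gradient v x‖ + 2 * |v x| * ‖gradient η x‖) ^ 2 ≤ 2 * ‖gradient v x‖ ^ 2 + 8 * (v x ^ 2 * ‖gradient η x‖ ^ 2) := by
    rw [← sq_abs (v x)]
    nlinarith [sq_nonneg (‖gradient v x‖ - 2 * |v x| * ‖gradient η x‖)]
  linarith

end cacc

section hole
variable {A : Ed 2 → Fin 2 → Fin 2 → ℝ} {W : Ed 2 → ℝ} {μ M : ℝ} {u : ℕ → Ed 2 → ℝ}

set_option maxHeartbeats 2000000 in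
lemma hole (h : Coef A W μ M) (hu : Appr A W u) : ∃ C1 C2 : ℝ, 0 ≤ C1 ∧ 0 ≤ C2 ∧ ∀ (x0 : Ed 2) (R : ℝ), 0 < R → R ≤ 1 →
    ∀ᶠ n in atTop, ∫ x in Metric.ball x0 R, ‖gradient (u n) x‖ ^ 2 ≤
      C1 * ((∫ x in Metric.ball x0 (2 * R), ‖gradient (u n) x‖ ^ 2) - ∫ x in Metric.ball x0 R, ‖gradient (u n) x‖ ^ 2) + C2 * R := by
  have hμ : 0 < μ := by linarith [h.hμ]
  have hM := Mnn h
  obtain ⟨G, hG, hbump⟩ := bump 2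
  obtain ⟨Cb, hCb, hbd⟩ := hu.bd 2
  refine ⟨2 * μ * (2 * μ ^ 3 * (G ^ 2 * (406 * 6400))), 2 * μ * (1 + M * (6401 * Cb)), by positivity, by positivity, fun x0 R hR hR1 => ?_⟩
  obtain ⟨η, hη, hη01, hη1, hη0, hg1, hg0, hgG⟩ := hbump x0 R hR
  set Cψ := 2 * Cb + (8 * (G / R) ^ 2 + 1) * (6400 * R ^ 2 * Cb) with hCψ
  have hCψ0 : 0 ≤ Cψ := by positivity
  filter_upwards [hu.eq (‖x0‖ + 2 * R) (R / (Real.sqrt Cψ + 1)) (by positivity)] with n hn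
  have c1 := sm_c1 (hu.sm n)
  have huc := c1.continuous
  have hgc := grad_cont c1
  have hηc := hη.cont
  have hηg := grad_cont hη.c1
  obtain ⟨c, hc1, hc2⟩ := annP c1 x0 hR
  set B := Metric.ball x0 (2 * R) with hB
  have hBb : Bornology.IsBounded B := Metric.isBounded_ball
  set D2 := ∫ x in B, ‖gradient (u n) x‖ ^ 2 with hD2
  set D1 := ∫ x in Metric.ball x0 R, ‖gradient (u n) x‖ ^ 2 with hD1
  have hBs : Metric.ball x0 R ⊆ B := Metric.ball_subset_ball (by linarith)
  have iD : IntegrableOn (fun x => ‖gradient (u n) x‖ ^ 2) B := cont_intOn (by fun_prop) hBb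
  have hdiff : ∫ x in B \ Metric.ball x0 R, ‖gradient (u n) x‖ ^ 2 = D2 - D1 :=
    setIntegral_sdiff measurableSet_ball iD hBs
  rw [hdiff] at hc1
  have hH : ∫ x in B, H1n (u n) x ≤ Cb := (mono_int (H1n_cont c1) (fun x => H1n_nonneg x) Metric.isBounded_ball
    (Metric.ball_subset_ball (by linarith))).trans (hbd n x0)
  have hD2b : D2 ≤ Cb := (setIntegral_mono iD (cont_intOn (H1n_cont c1) hBb) fun x => by
    unfold H1n; simp only []; nlinarith [sq_nonneg (u n x)]).trans hH
  have hU : ∫ x in B, u n x ^ 2 ≤ Cb := (setIntegral_mono (cont_intOn (by fun_prop) hBb) (cont_intOn (H1n_cont c1) hBb) fun x => by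
    unfold H1n; simp only []; nlinarith [sq_nonneg ‖gradient (u n) x‖]).trans hH
  have hc3 : ∫ x in B, (u n x - c) ^ 2 ≤ 6400 * R ^ 2 * Cb := hc2.trans (mul_le_mul_of_nonneg_left hD2b (by positivity))
  set v : Ed 2 → ℝ := fun x => u n x - c with hv
  have hvs : ContDiff ℝ (⊤ : ℕ∞) v := (hu.sm n).sub contDiff_const
  have hvc : Continuous v := hvs.continuous
  set ψ : Ed 2 → ℝ := fun y => η y ^ 2 * v y with hψ
  have hψt : IsTest ψ := ⟨(hη.1.pow 2).mul hvs, HasCompactSupport.intro (K := tsupport η) hη.2 fun x hx => by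
    simp [hψ, image_eq_zero_of_notMem_tsupport hx]⟩
  have hoff : ∀ x, x ∉ B → η x = 0 := fun x hx => hη0 x (not_lt.1 hx)
  have hψg : ∀ x, x ∉ B → ψ x = 0 ∧ gradient ψ x = 0 := fun x hx => by
    refine ⟨by simp [hψ, hoff x hx], ?_⟩
    rw [hψ, sqm_grad hη.c1 (sm_c1 hvs), hoff x hx]; simp
  have iv : IntegrableOn (fun x => v x ^ 2) B := cont_intOn (by fun_prop) hBb
  have iu : IntegrableOn (fun x => u n x ^ 2) B := cont_intOn (by fun_prop) hBb
  have ive : IntegrableOn (fun x => v x ^ 2 * ‖gradient η x‖ ^ 2) B := cont_intOn (by fun_prop) hBb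
  have hHψ : ∫ x, H1n ψ x ≤ Cψ := by
    rw [← setIntegral_eq_integral_of_forall_compl_eq_zero (s := B) fun x hx => by
      unfold H1n; rw [(hψg x hx).1, (hψg x hx).2]; simp]
    calc _ ≤ ∫ x in B, (2 * ‖gradient (u n) x‖ ^ 2 + (8 * (G / R) ^ 2 + 1) * v x ^ 2) := by
          refine setIntegral_mono (cont_intOn (H1n_cont hψt.c1) hBb) (I_add (iD.const_mul 2) (iv.const_mul _)) fun x => ?_
          refine (H1n_sqm hη.c1 (sm_c1 hvs) (hη01 x).1 (hη01 x).2).trans ?_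
          have : gradient v x = gradient (u n) x := grad_sub_const c
          rw [this]
          have := mul_le_mul_of_nonneg_left (pow_le_pow_left₀ (norm_nonneg _) (hgG x) 2) (sq_nonneg (v x))
          linarith
      _ = 2 * D2 + (8 * (G / R) ^ 2 + 1) * ∫ x in B, v x ^ 2 := by
          rw [integral_add (iD.const_mul 2) (iv.const_mul _), integral_const_mul, integral_const_mul]
      _ ≤ _ := by
          have := mul_le_mul_of_nonneg_left hc3 (by positivity : 0 ≤ 8 * (G / R) ^ 2 + 1)
          linarith
  have hBQ : BQ A W (u n) ψ ≤ R := by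
    refine (le_abs_self _).trans ((hn ψ hψt fun x hx => (hψg x fun hb => hx ?_).1).trans ?_)
    · rw [mem_ball_zero_iff]
      have : dist x x0 < 2 * R := hb
      have h2 := norm_sub_norm_le x x0
      rw [dist_eq_norm] at this; linarith
    · calc _ ≤ R / (Real.sqrt Cψ + 1) * Real.sqrt Cψ := mul_le_mul_of_nonneg_left (Real.sqrt_le_sqrt hHψ) (by positivity)
        _ ≤ R := by
          rw [div_mul_eq_mul_div, div_le_iff₀ (by positivity)]
          nlinarith [Real.sqrt_nonneg Cψ]
  have hBQ' : ∫ x in B, den A W (u n) ψ x = BQ A W (u n) ψ :=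
    setIntegral_eq_integral_of_forall_compl_eq_zero fun x hx => by
      unfold den; rw [(hψg x hx).1, (hψg x hx).2]; simp [bilA]
  have t2 : ∫ x in B, v x ^ 2 * ‖gradient η x‖ ^ 2 ≤ G ^ 2 * (406 * 6400) * (D2 - D1) := by
    have hann : Bornology.IsBounded (B \ Metric.ball x0 (3 / 2 * R)) := hBb.subset Set.sdiff_subset
    rw [setIntegral_eq_of_subset_of_forall_sdiff_eq_zero (s := B \ Metric.ball x0 (3 / 2 * R)) (t := B) measurableSet_ball Set.sdiff_subset
      (fun x hx => by
        have : dist x x0 < 3 / 2 * R := by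
          by_contra hno
          exact hx.2 ⟨hx.1, hno⟩
        rw [hg1 x this.le]; simp)]
    calc _ ≤ ∫ x in B \ Metric.ball x0 (3 / 2 * R), (G / R) ^ 2 * v x ^ 2 :=
          setIntegral_mono (cont_intOn (by fun_prop) hann) (cont_intOn (by fun_prop) hann) fun x => by
            have := mul_le_mul_of_nonneg_left (pow_le_pow_left₀ (norm_nonneg _) (hgG x) 2) (sq_nonneg (v x))
            simp only []; linarith
      _ ≤ (G / R) ^ 2 * ((406 * 6400) * R ^ 2 * (D2 - D1)) := by
          rw [integral_const_mul]; exact mul_le_mul_of_nonneg_left hc1 (by positivity)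
      _ = _ := by field_simp
  have ie : IntegrableOn (fun x => η x ^ 2 * (R * u n x ^ 2 + R⁻¹ * v x ^ 2)) B := cont_intOn (by fun_prop) hBb
  have t3 : ∫ x in B, η x ^ 2 * (R * u n x ^ 2 + R⁻¹ * v x ^ 2) ≤ 6401 * Cb * R := by
    calc _ ≤ ∫ x in B, (R * u n x ^ 2 + R⁻¹ * v x ^ 2) := by
          refine setIntegral_mono ie (I_add (iu.const_mul _) (iv.const_mul _)) fun x => ?_
          exact mul_le_of_le_one_left (by positivity) (pow_le_one₀ (hη01 x).1 (hη01 x).2)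
      _ = R * (∫ x in B, u n x ^ 2) + R⁻¹ * ∫ x in B, v x ^ 2 := by
          rw [integral_add (iu.const_mul _) (iv.const_mul _), integral_const_mul, integral_const_mul]
      _ ≤ R * Cb + R⁻¹ * (6400 * R ^ 2 * Cb) := by gcongr
      _ = _ := by field_simp; ring
  have t1 : D1 ≤ ∫ x in B, η x ^ 2 * ‖gradient (u n) x‖ ^ 2 := by
    refine le_trans (le_of_eq ?_) (mono_int (by fun_prop) (fun x => by positivity) hBb hBs)
    refine setIntegral_congr_fun measurableSet_ball fun x hx => ?_
    have : dist x x0 < R := hx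
    simp only [hη1 x (by linarith), one_pow, one_mul]
  have id := den_intOn h c1 hψt.c1 hBb
  have main := setIntegral_mono (cont_intOn (by fun_prop) hBb) (I_add id (I_add (ive.const_mul (2 * μ ^ 3)) (ie.const_mul M)))
    fun x => cacc_pt h hη.c1 c1 c hR x
  rw [integral_const_mul, integral_add id (I_add (ive.const_mul (2 * μ ^ 3)) (ie.const_mul M)),
    integral_add (ive.const_mul (2 * μ ^ 3)) (ie.const_mul M), integral_const_mul, integral_const_mul, hBQ'] at main
  have f1 := mul_le_mul_of_nonneg_left t1 (by positivity : 0 ≤ (2 * μ)⁻¹)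
  have f2 := mul_le_mul_of_nonneg_left t2 (by positivity : 0 ≤ 2 * μ ^ 3)
  have f3 := mul_le_mul_of_nonneg_left t3 hM
  have f4 : (2 * μ)⁻¹ * D1 ≤ R + (2 * μ ^ 3 * (G ^ 2 * (406 * 6400) * (D2 - D1)) + M * (6401 * Cb * R)) := by linarith
  have f5 := mul_le_mul_of_nonneg_left f4 (by positivity : 0 ≤ 2 * μ)
  rw [mul_inv_cancel_left₀ (by positivity)] at f5
  linarith

end hole

section decay
variable {d : ℕ} {A : Ed d → Fin d → Fin d → ℝ} {W : Ed d → ℝ} {μ M : ℝ} {u : ℕ → Ed d → ℝ}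

lemma grad_le_H1 {v : Ed d → ℝ} (hv : ContDiff ℝ 1 v) {S : Set (Ed d)} (hS : Bornology.IsBounded S) :
    ∫ x in S, ‖gradient v x‖ ^ 2 ≤ ∫ x in S, H1n v x :=
  setIntegral_mono (cont_intOn (by have := grad_cont hv; fun_prop) hS) (cont_intOn (H1n_cont hv) hS) fun x => by
    unfold H1n; simp only []; nlinarith [sq_nonneg (v x)]

lemma sq_le_H1 {v : Ed d → ℝ} (hv : ContDiff ℝ 1 v) {S : Set (Ed d)} (hS : Bornology.IsBounded S) :
    ∫ x in S, v x ^ 2 ≤ ∫ x in S, H1n v x :=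
  setIntegral_mono (cont_intOn (by have := hv.continuous; fun_prop) hS) (cont_intOn (H1n_cont hv) hS) fun x => by
    unfold H1n; simp only []; nlinarith [sq_nonneg ‖gradient v x‖]

lemma decay (hd : 0 < d) (hd2 : d ≤ 2) (h : Coef A W μ M) (hu : Appr A W u) : ∃ C0 σ : ℝ, 0 ≤ C0 ∧ 0 < σ ∧ σ < 1 ∧
    ∀ (x0 : Ed d) (k : ℕ), ∀ᶠ n in atTop, ((1 / 2 : ℝ) ^ k) ^ 2 * ∫ x in Metric.ball x0 ((1 / 2 : ℝ) ^ k), ‖gradient (u n) x‖ ^ 2 ≤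
      C0 * (σ ^ k) ^ 2 * ((1 / 2 : ℝ) ^ k) ^ d := by
  obtain ⟨Cb, hCb, hbd⟩ := hu.bd 1
  have hD : ∀ n x0 (k : ℕ), ∫ x in Metric.ball x0 ((1 / 2 : ℝ) ^ k), ‖gradient (u n) x‖ ^ 2 ≤ Cb := fun n x0 k =>
    (mono_int (by have := grad_cont (sm_c1 (hu.sm n)); fun_prop) (fun x => by positivity) Metric.isBounded_ball
      (Metric.ball_subset_ball (pow_le_one₀ (by norm_num) (by norm_num)))).trans
    ((grad_le_H1 (sm_c1 (hu.sm n)) Metric.isBounded_ball).trans (hbd n x0))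
  obtain rfl | rfl : d = 1 ∨ d = 2 := by omega
  · refine ⟨Cb, Real.sqrt (1 / 2), hCb, by positivity, by rw [Real.sqrt_lt' one_pos]; norm_num, fun x0 k => Eventually.of_forall fun n => ?_⟩
    have e1 : (Real.sqrt (1 / 2) ^ k) ^ 2 = (1 / 2) ^ k := by
      rw [← pow_mul, mul_comm k 2, pow_mul, Real.sq_sqrt (by norm_num)]
    rw [e1, pow_one]
    have := mul_le_mul_of_nonneg_left (hD n x0 k) (by positivity : 0 ≤ ((1 / 2 : ℝ) ^ k) ^ 2)
    linarith
  · obtain ⟨C1, C2, hC1, hC2, H⟩ := hole h hu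
    set θ := C1 / (1 + C1) with hθ
    have hθ0 : 0 ≤ θ := by positivity
    have hθ1 : θ < 1 := by rw [hθ, div_lt_one (by positivity)]; linarith
    set τ := (1 + max θ (1 / 2)) / 2 with hτ
    have hm : max θ (1 / 2) < 1 := max_lt hθ1 (by norm_num)
    have hτ1 : τ < 1 := by rw [hτ]; linarith
    have hτθ : θ < τ := by rw [hτ]; linarith [le_max_left θ (1 / 2)]
    have hτ2 : 1 / 2 ≤ τ := by rw [hτ]; linarith [le_max_right θ (1 / 2)]
    set C0 := Cb + C2 / (τ - θ) with hC0
    have hC00 : 0 ≤ C0 := by have : 0 < τ - θ := by linarith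
                             positivity
    have hC0' : C2 ≤ C0 * (τ - θ) := by
      rw [hC0, add_mul, div_mul_cancel₀ _ (by linarith)]
      nlinarith
    have key : ∀ (x0 : Ed 2) (k : ℕ), ∀ᶠ n in atTop, ∫ x in Metric.ball x0 ((1 / 2 : ℝ) ^ k), ‖gradient (u n) x‖ ^ 2 ≤ C0 * τ ^ k := by
      intro x0 k
      induction k with
      | zero =>
        refine Eventually.of_forall fun n => (hD n x0 0).trans ?_
        have : 0 ≤ C2 / (τ - θ) := div_nonneg hC2 (by linarith)
        simp [hC0, this]
      | succ k ih =>
        filter_upwards [ih, H x0 ((1 / 2 : ℝ) ^ (k + 1)) (by positivity) (pow_le_one₀ (by norm_num) (by norm_num))] with n h1 h2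
        have e : 2 * (1 / 2 : ℝ) ^ (k + 1) = (1 / 2) ^ k := by rw [pow_succ]; ring
        rw [e] at h2
        set D2 := ∫ x in Metric.ball x0 ((1 / 2 : ℝ) ^ k), ‖gradient (u n) x‖ ^ 2
        set D1 := ∫ x in Metric.ball x0 ((1 / 2 : ℝ) ^ (k + 1)), ‖gradient (u n) x‖ ^ 2
        have h3 : D1 ≤ θ * D2 + C2 * (1 / 2) ^ (k + 1) := by
          have p1 : 0 < 1 + C1 := by linarith
          have : (1 + C1) * D1 ≤ (1 + C1) * (θ * D2 + C2 * (1 / 2) ^ (k + 1)) := by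
            have e2 : (1 + C1) * (θ * D2 + C2 * (1 / 2) ^ (k + 1)) = C1 * D2 + (1 + C1) * (C2 * (1 / 2) ^ (k + 1)) := by
              rw [hθ]; field_simp
            rw [e2]
            have : 0 ≤ C1 * (C2 * (1 / 2 : ℝ) ^ (k + 1)) := by positivity
            linarith
          exact le_of_mul_le_mul_left this p1
        have h4 : (1 / 2 : ℝ) ^ (k + 1) ≤ τ ^ k := by
          refine le_trans ?_ (pow_le_pow_left₀ (by norm_num) hτ2 k)
          rw [pow_succ]; have : (0:ℝ) < (1 / 2) ^ k := by positivity
          linarith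
        have h5 : θ * D2 ≤ θ * (C0 * τ ^ k) := mul_le_mul_of_nonneg_left h1 hθ0
        have h6 : C2 * (1 / 2) ^ (k + 1) ≤ C0 * (τ - θ) * τ ^ k := (mul_le_mul_of_nonneg_left h4 hC2).trans
          (mul_le_mul_of_nonneg_right hC0' (by positivity))
        calc D1 ≤ θ * (C0 * τ ^ k) + C0 * (τ - θ) * τ ^ k := by linarith
          _ = _ := by ring
    refine ⟨C0, Real.sqrt τ, hC00, Real.sqrt_pos.2 (by linarith), by rw [Real.sqrt_lt' one_pos]; linarith, fun x0 k => ?_⟩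
    filter_upwards [key x0 k] with n hn
    rw [← pow_mul (Real.sqrt τ), mul_comm k 2, pow_mul (Real.sqrt τ), Real.sq_sqrt (by linarith), mul_comm]
    exact mul_le_mul_of_nonneg_right hn (by positivity)

end decay

/-- ultrafilter used to extract limits -/
def uf : Filter ℕ := (hyperfilter ℕ : Filter ℕ)

instance uf_ne : uf.NeBot := inferInstanceAs (NeBot ((hyperfilter ℕ : Ultrafilter ℕ) : Filter ℕ))

lemma uf_le : uf ≤ atTop := Nat.hyperfilter_le_atTop

lemma ulim {f : ℕ → ℝ} {C : ℝ} (hf : ∀ n, |f n| ≤ C) : ∃ l, Tendsto f uf (𝓝 l) := by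
  obtain ⟨l, -, hl⟩ := (isCompact_Icc (a := -C) (b := C)).ultrafilter_le_nhds ((hyperfilter ℕ).map f)
    (by
      rw [le_principal_iff]
      exact Filter.mem_map.2 (Filter.univ_mem' fun n => abs_le.1 (hf n)))
  exact ⟨l, hl⟩

section lim
variable {d : ℕ} {A : Ed d → Fin d → Fin d → ℝ} {W : Ed d → ℝ} {μ M : ℝ} {u : ℕ → Ed d → ℝ}

lemma av_bd (hu : Appr A W u) {r : ℝ} (hr : 0 < r) : ∃ C, 0 ≤ C ∧ ∀ n (x : Ed d), |av (u n) (Metric.ball x r)| ≤ C := by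
  obtain ⟨Cb, hCb, hbd⟩ := hu.bd r
  refine ⟨Real.sqrt ((r ^ d * volume.real (Metric.ball (0 : Ed d) 1))⁻¹ * Cb), by positivity, fun n x => Real.abs_le_sqrt ?_⟩
  have hv := ball_vol_pos x hr
  refine (av_sq_le hv Metric.isBounded_ball (hu.sm n).continuous).trans ?_
  rw [ball_vol x hr] at hv ⊢
  exact mul_le_mul_of_nonneg_left ((sq_le_H1 (sm_c1 (hu.sm n)) Metric.isBounded_ball).trans (hbd n x)) (by positivity)

/-- comparison of averages on nested balls -/
lemma av_nest {v : Ed d → ℝ} (hv : ContDiff ℝ 1 v) {x y : Ed d} {r : ℝ} (hr : 0 < r)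
    (hsub : Metric.ball y (r / 2) ⊆ Metric.ball x r) {E : ℝ} (hE : r ^ 2 * ∫ x in Metric.ball x r, ‖gradient v x‖ ^ 2 ≤ E * r ^ d) :
    (av v (Metric.ball y (r / 2)) - av v (Metric.ball x r)) ^ 2 ≤ 4 ^ (d + 1) / volume.real (Metric.ball (0 : Ed d) 1) * E := by
  have := poincG2 hv (convex_ball x r) measurableSet_ball hr.le subset_rfl subset_rfl (ball_vol_pos x hr) hsub (ball_vol_pos y (half_pos hr))
  refine this.trans ?_
  rw [ball_vol _ (half_pos hr), ball_vol _ hr, ball_vol _ (by positivity : 0 < 2 * r)]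
  set ω := volume.real (Metric.ball (0 : Ed d) 1)
  have hω : 0 < ω := om_pos
  set D := ∫ x in Metric.ball x r, ‖gradient v x‖ ^ 2
  calc _ = 4 ^ (d + 1) / ω * ((r ^ 2 * D) / r ^ d) := by
        have e4 : (4:ℝ) ^ (d + 1) = 2 ^ d * 2 ^ d * 4 := by rw [pow_succ, ← mul_pow]; norm_num
        rw [div_pow, mul_pow 2 r d, e4]; field_simp; ring
    _ ≤ _ := by
        refine mul_le_mul_of_nonneg_left ?_ (by positivity)
        rwa [div_le_iff₀ (by positivity)]

lemma Jp_int {v : Ed d → ℝ} (hv : Continuous v) {K : Set (Ed d)} (hK : Bornology.IsBounded K) (r : ℝ) :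
    IntegrableOn (fun x => ∫ y in K ∩ Metric.ball x r, |v x - v y| ^ 2) K := by
  have hc : Continuous fun p : Ed d × Ed d => |v p.1 - v p.2| ^ 2 := by fun_prop
  have h1 : Integrable (fun p : Ed d × Ed d => |v p.1 - v p.2| ^ 2) ((volume.restrict K).prod (volume.restrict K)) := by
    rw [Measure.prod_restrict]
    exact (hc.continuousOn.integrableOn_compact (hK.prod hK).isCompact_closure).mono_set subset_closure
  have hS : MeasurableSet {p : Ed d × Ed d | p.2 ∈ Metric.ball p.1 r} := by
    simp only [Metric.mem_ball]
    exact (isOpen_lt (by fun_prop) (by fun_prop)).measurableSet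
  have h2 := (h1.indicator hS).integral_prod_left
  refine h2.congr (ae_of_all _ fun x => ?_)
  simp only []
  rw [Set.inter_comm, ← Measure.restrict_restrict measurableSet_ball, ← integral_indicator measurableSet_ball]
  rfl

lemma Jp_pt {v : Ed d → ℝ} (hv : Continuous v) {K b : Set (Ed d)} (hK : Bornology.IsBounded K) {x : Ed d} {r : ℝ} (hb : b ⊆ K ∩ Metric.ball x r)
    (hb0 : 0 < volume.real b) : (v x - av v b) ^ 2 ≤ (volume.real b)⁻¹ * ∫ y in K ∩ Metric.ball x r, |v x - v y| ^ 2 := by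
  have hbb : Bornology.IsBounded b := hK.subset (hb.trans Set.inter_subset_left)
  have e : v x - av v b = av (fun y => v x - v y) b := by
    rw [av_sub hbb continuous_const hv, av_const hb0]
  rw [e]
  refine (av_sq_le hb0 hbb (by fun_prop)).trans (mul_le_mul_of_nonneg_left ?_ (by positivity))
  simp only [sq_abs]
  exact mono_int (by fun_prop) (fun y => sq_nonneg _) (hK.subset Set.inter_subset_left) hb

set_option maxHeartbeats 1000000 in
lemma limphi (hd : 0 < d) (hd2 : d ≤ 2) (h : Coef A W μ M) (hu : Appr A W u) : ∃ (φ : Ed d → ℝ) (C σ : ℝ), Continuous φ ∧ (∀ x, 0 ≤ φ x) ∧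
    0 < C ∧ 0 < σ ∧ σ < 1 ∧ (∀ x (k : ℕ), ∀ᶠ n in uf, |av (u n) (Metric.ball x ((1 / 2 : ℝ) ^ k)) - φ x| ≤ C * σ ^ k) ∧
    ∀ N : ℝ, Tendsto (fun n => ∫ x in Metric.ball (0 : Ed d) N, (u n x - φ x) ^ 2) uf (𝓝 0) := by
  obtain ⟨C0, σ, hC0, hσ0, hσ1, hdec⟩ := decay hd hd2 h hu
  set ω := volume.real (Metric.ball (0 : Ed d) 1)
  have hω : 0 < ω := om_pos
  set C1 := Real.sqrt (4 ^ (d + 1) / ω * C0) with hC1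
  have hC10 : 0 ≤ C1 := Real.sqrt_nonneg _
  have hr : ∀ k : ℕ, (0:ℝ) < (1 / 2) ^ k := fun k => by positivity
  have hrs : ∀ k : ℕ, (1 / 2 : ℝ) ^ (k + 1) = (1 / 2) ^ k / 2 := fun k => by rw [pow_succ]; ring
  have hav : ∀ x y (k : ℕ), Metric.ball y ((1 / 2 : ℝ) ^ (k + 1)) ⊆ Metric.ball x ((1 / 2 : ℝ) ^ k) →
      ∀ᶠ n in uf, |av (u n) (Metric.ball y ((1 / 2 : ℝ) ^ (k + 1))) - av (u n) (Metric.ball x ((1 / 2 : ℝ) ^ k))| ≤ C1 * σ ^ k := by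
    intro x y k hsub
    filter_upwards [uf_le (hdec x k)] with n hn
    apply abs_le_of_sq_le_sq _ (by positivity)
    rw [hrs] at hsub ⊢
    refine (av_nest (sm_c1 (hu.sm n)) (hr k) hsub hn).trans (le_of_eq ?_)
    rw [mul_pow, hC1, Real.sq_sqrt (by positivity)]; ring
  have hlim : ∀ (k : ℕ) (x : Ed d), ∃ l, Tendsto (fun n => av (u n) (Metric.ball x ((1 / 2 : ℝ) ^ k))) uf (𝓝 l) := fun k x => by
    obtain ⟨C, -, hC⟩ := av_bd hu (hr k)
    exact ulim fun n => hC n x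
  choose m hm using hlim
  have hmm : ∀ x y (k : ℕ), Metric.ball y ((1 / 2 : ℝ) ^ (k + 1)) ⊆ Metric.ball x ((1 / 2 : ℝ) ^ k) → |m (k + 1) y - m k x| ≤ C1 * σ ^ k :=
    fun x y k hsub => le_of_tendsto ((hm (k + 1) y).sub (hm k x)).abs (hav x y k hsub)
  have hgeo : ∀ x (k : ℕ), dist (m k x) (m (k + 1) x) ≤ C1 * σ ^ k := fun x k => by
    rw [dist_comm, Real.dist_eq]
    exact hmm x x k (Metric.ball_subset_ball (by rw [hrs]; linarith [hr k]))
  choose φ hφ using fun x => cauchySeq_tendsto_of_complete (cauchySeq_of_le_geometric σ C1 hσ1 (hgeo x))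
  set C2 := C1 / (1 - σ) with hC2
  have hC20 : 0 ≤ C2 := div_nonneg hC10 (by linarith)
  have hmφ : ∀ x (k : ℕ), |m k x - φ x| ≤ C2 * σ ^ k := fun x k => by
    have := dist_le_of_le_geometric_of_tendsto σ C1 hσ1 (hgeo x) (hφ x) k
    rw [Real.dist_eq] at this
    refine this.trans (le_of_eq ?_)
    rw [hC2]; ring
  set C := 2 * C2 + C1 + 1 with hC
  have hCpos : 0 < C := by positivity
  have hσk : ∀ k : ℕ, 0 < σ ^ k := fun k => by positivity
  have hφφ : ∀ x y (k : ℕ), dist x y ≤ (1 / 2) ^ (k + 1) → |φ y - φ x| ≤ C * σ ^ k := by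
    intro x y k hxy
    have h1 := abs_le.1 (hmm x y k (Metric.ball_subset_ball' (by rw [dist_comm]; rw [hrs] at *; linarith)))
    have h2 := abs_le.1 (hmφ x k)
    have h3 := abs_le.1 (hmφ y (k + 1))
    have h4 : C2 * σ ^ (k + 1) ≤ C2 * σ ^ k := mul_le_mul_of_nonneg_left (pow_le_pow_of_le_one hσ0.le hσ1.le (by omega)) hC20
    have := hσk k
    rw [abs_le, hC]
    constructor <;> nlinarith
  have ha : ∀ x (k : ℕ), ∀ᶠ n in uf, |av (u n) (Metric.ball x ((1 / 2 : ℝ) ^ k)) - φ x| ≤ C * σ ^ k := by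
    intro x k
    filter_upwards [(hm k x).eventually (Metric.ball_mem_nhds _ (hσk k))] with n hn
    rw [Real.dist_eq] at hn
    have h1 := abs_lt.1 hn
    have h2 := abs_le.1 (hmφ x k)
    have := hσk k
    rw [abs_le, hC]
    constructor <;> nlinarith
  have hφc : Continuous φ := by
    rw [Metric.continuous_iff]
    intro x ε hε
    obtain ⟨k, hk⟩ := exists_pow_lt_of_lt_one (div_pos hε hCpos) hσ1
    refine ⟨(1 / 2) ^ (k + 1), hr _, fun y hy => ?_⟩
    rw [Real.dist_eq]
    rw [lt_div_iff₀ hCpos, mul_comm] at hk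
    exact (hφφ x y k (by rw [dist_comm]; exact hy.le)).trans_lt hk
  have hφ0 : ∀ x, 0 ≤ φ x := fun x => ge_of_tendsto' (hφ x) fun k => ge_of_tendsto' (hm k x) fun n => by
    have := setIntegral_nonneg (μ := volume) (measurableSet_ball (x := x) (ε := (1 / 2 : ℝ) ^ k)) fun y _ => (hu.pos n y).le
    unfold av; positivity
  refine ⟨φ, C, σ, hφc, hφ0, hCpos, hσ0, hσ1, ha, fun N => ?_⟩
  obtain ⟨Cg, hCg, hbd⟩ := hu.bd (N + 2)
  set Vn := volume.real (Metric.ball (0 : Ed d) N)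
  have key : ∀ k : ℕ, ∀ᶠ n in uf, ∫ x in Metric.ball (0 : Ed d) N, (u n x - φ x) ^ 2 ≤
      8 * 2 ^ d * Cg * ((1 / 2) ^ k) ^ 2 + 8 * C ^ 2 * Vn * (σ ^ k) ^ 2 := by
    intro k
    obtain ⟨t, -, htf, hcov⟩ := (isCompact_closedBall (0 : Ed d) N).finite_cover_balls (hr (k + 1))
    filter_upwards [(eventually_all_finite htf).2 fun i _ => ha i k] with n hn
    have huc := (hu.sm n).continuous
    set r := (1 / 2 : ℝ) ^ k with hrk
    have hr0 : 0 < r := hr k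
    have hr1 : r ≤ 1 := pow_le_one₀ (by norm_num) (by norm_num)
    set K := Metric.ball (0 : Ed d) (N + 2) with hK
    have hKb : Bornology.IsBounded K := Metric.isBounded_ball
    set J : Ed d → ℝ := fun x => ∫ y in K ∩ Metric.ball x (2 * r), |u n x - u n y| ^ 2 with hJ
    have hJ0 : ∀ x, 0 ≤ J x := fun x => integral_nonneg fun y => by positivity
    have hJi : IntegrableOn J K := Jp_int huc hKb _
    have hsub : Metric.ball (0 : Ed d) N ⊆ K := Metric.ball_subset_ball (by linarith)
    set v := (r ^ d * ω)⁻¹ with hv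
    have hv0 : 0 < v := by positivity
    have pt : ∀ x ∈ Metric.ball (0 : Ed d) N, (u n x - φ x) ^ 2 ≤ 2 * v * J x + 8 * C ^ 2 * (σ ^ k) ^ 2 := by
      intro x hx
      obtain ⟨i, hit, hxi⟩ := Set.mem_iUnion₂.1 (hcov (Metric.ball_subset_closedBall hx))
      have h1 := hn i hit
      have hxi' : dist i x ≤ (1 / 2) ^ (k + 1) := by rw [dist_comm]; exact (Metric.mem_ball.1 hxi).le
      have h2 := hφφ i x k hxi'
      rw [hrs] at hxi'
      have h3 := Jp_pt huc hKb (x := x) (r := 2 * r) (b := Metric.ball i r) (fun y hy => by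
        have : dist y x < 2 * r := by
          have := dist_triangle y i x
          have h5 : dist y i < r := hy
          linarith
        refine ⟨?_, this⟩
        rw [Metric.mem_ball] at hx ⊢
        have := dist_triangle y x 0
        linarith) (ball_vol_pos i hr0)
      rw [ball_vol i hr0] at h3
      set a := av (u n) (Metric.ball i r)
      have h4 : (a - φ x) ^ 2 ≤ (2 * C * σ ^ k) ^ 2 := by
        have := abs_le.1 h1
        have := abs_le.1 h2
        apply sq_le_sq' <;> linarith
      calc (u n x - φ x) ^ 2 ≤ 2 * (u n x - a) ^ 2 + 2 * (a - φ x) ^ 2 := by nlinarith [sq_nonneg (u n x - a - (a - φ x))]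
        _ ≤ 2 * (v * J x) + 2 * (2 * C * σ ^ k) ^ 2 := by linarith
        _ = _ := by ring
    have iJ := hJi.mono_set hsub
    have iC : IntegrableOn (fun _ : Ed d => 8 * C ^ 2 * (σ ^ k) ^ 2) (Metric.ball (0 : Ed d) N) := cont_intOn (by fun_prop) Metric.isBounded_ball
    have h1 := setIntegral_mono_on (cont_intOn (by fun_prop) Metric.isBounded_ball) (I_add (iJ.const_mul (2 * v)) iC) measurableSet_ball pt
    rw [integral_add (iJ.const_mul (2 * v)) iC, integral_const_mul, setIntegral_const, smul_eq_mul] at h1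
    have h2 : ∫ x in Metric.ball (0 : Ed d) N, J x ≤ ∫ x in K, J x := setIntegral_mono_set hJi (ae_of_all _ hJ0) hsub.eventuallyLE
    have h3 := poinc (sm_c1 (hu.sm n)) (convex_ball (0 : Ed d) (N + 2)) measurableSet_ball Metric.isBounded_ball (by positivity : 0 ≤ 2 * r) 2 (Or.inr rfl)
    have h4 := (grad_le_H1 (sm_c1 (hu.sm n)) (Metric.isBounded_ball (x := (0 : Ed d)) (r := N + 2))).trans (hbd n 0)
    rw [ball_vol 0 (by positivity : 0 < 2 * r)] at h3
    have h5 := h2.trans (h3.trans (mul_le_mul_of_nonneg_left h4 (by positivity)))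
    have h6 := mul_le_mul_of_nonneg_left h5 (by positivity : 0 ≤ 2 * v)
    have e : 2 * v * ((2 * r) ^ 2 * ((2 * r) ^ d * ω) * Cg) = 8 * 2 ^ d * Cg * r ^ 2 := by
      rw [hv, mul_pow 2 r d]; field_simp; ring
    rw [e] at h6
    linarith
  have hb : Tendsto (fun k : ℕ => 8 * 2 ^ d * Cg * ((1 / 2 : ℝ) ^ k) ^ 2 + 8 * C ^ 2 * Vn * (σ ^ k) ^ 2) atTop (𝓝 0) := by
    have t1 := ((tendsto_pow_atTop_nhds_zero_of_lt_one (by norm_num : (0:ℝ) ≤ 1 / 2) (by norm_num)).pow 2).const_mul (8 * 2 ^ d * Cg)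
    have t2 := ((tendsto_pow_atTop_nhds_zero_of_lt_one hσ0.le hσ1).pow 2).const_mul (8 * C ^ 2 * Vn)
    simpa using t1.add t2
  rw [Metric.tendsto_nhds]
  intro ε hε
  obtain ⟨k, hk⟩ := (hb.eventually (gt_mem_nhds hε)).exists
  filter_upwards [key k] with n hn
  rw [Real.dist_eq, sub_zero, abs_of_nonneg (integral_nonneg fun x => sq_nonneg _)]
  exact hn.trans_lt hk

end lim

section capa
variable {d : ℕ}

lemma cap0 (hd : 0 < d) (hd2 : d ≤ 2) : ∃ K : ℝ, 0 < K ∧ ∀ (x0 : Ed d) (c : ℝ), 0 < c → (d = 2 ∨ 1 ≤ c) → ∀ N : ℕ,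
    ∃ F : Ed d → ℝ, IsTest F ∧ (∀ x, 0 ≤ F x ∧ F x ≤ N) ∧ (∀ x, dist x x0 ≤ c → F x = N) ∧
      (∀ x, 2 ^ N * c ≤ dist x x0 → F x = 0) ∧ (∀ x, 2 ^ N * c ≤ dist x x0 → gradient F x = 0) ∧
      ∫ x, ‖gradient F x‖ ^ 2 ≤ N * K := by
  obtain ⟨G, hG, hb⟩ := bump d
  have hω : 0 < volume.real (Metric.ball (0 : Ed d) 1) := om_pos
  refine ⟨G ^ 2 * (4 * volume.real (Metric.ball (0 : Ed d) 1)), by positivity, fun x0 c hc hdc N => ?_⟩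
  induction N with
  | zero =>
    refine ⟨fun _ => 0, ⟨contDiff_const, HasCompactSupport.zero⟩, by simp, by simp, by simp, fun x _ => grad_const _, ?_⟩
    simp [grad_const]
  | succ N ih =>
    obtain ⟨F, hF, hF0, hF1, hFz, hFg, hFe⟩ := ih
    have hp : (1:ℝ) ≤ 2 ^ N := one_le_pow₀ (by norm_num)
    have hR : 0 < 2 ^ N * c := by positivity
    have hcR : c ≤ 2 ^ N * c := le_mul_of_one_le_left hc.le hp
    obtain ⟨β, hβ, hβ0, hβ1, hβz, hβg, hβg2, hβG⟩ := hb x0 (2 ^ N * c) hR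
    have e2 : (2:ℝ) ^ (N + 1) * c = 2 * (2 ^ N * c) := by ring
    have hg : ∀ x, gradient (fun y => F y + β y) x = gradient F x + gradient β x := fun x => grad_add (c1_diff hF.c1) (c1_diff hβ.c1)
    refine ⟨fun x => F x + β x, ⟨hF.1.add hβ.1, hF.2.add hβ.2⟩, fun x => ⟨add_nonneg (hF0 x).1 (hβ0 x).1, ?_⟩, fun x hx => ?_,
      fun x hx => ?_, fun x hx => ?_, ?_⟩
    · push_cast; exact add_le_add (hF0 x).2 (hβ0 x).2
    · simp only []
      rw [hF1 x hx, hβ1 x (by linarith)]; push_cast; rfl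
    · rw [e2] at hx; simp only []
      rw [hFz x (by linarith), hβz x hx, add_zero]
    · rw [e2] at hx
      rw [hg, hFg x (by linarith), hβg2 x hx, add_zero]
    · have h1 : ∀ x, ‖gradient (fun y => F y + β y) x‖ ^ 2 = ‖gradient F x‖ ^ 2 + ‖gradient β x‖ ^ 2 := fun x => by
        rw [hg]
        rcases le_total (2 ^ N * c) (dist x x0) with h | h
        · rw [hFg x h]; simp
        · rw [hβg x (by linarith)]; simp
      simp only [h1]
      have cF := grad_cont hF.c1
      have cβ := grad_cont hβ.c1
      rw [integral_add (hF.integrable_cont (by fun_prop) fun x hx => by rw [grad_zero_off hx]; simp)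
        (hβ.integrable_cont (by fun_prop) fun x hx => by rw [grad_zero_off hx]; simp)]
      have h2 : ∫ x, ‖gradient β x‖ ^ 2 ≤ G ^ 2 * (4 * volume.real (Metric.ball (0 : Ed d) 1)) := by
        rw [← setIntegral_eq_integral_of_forall_compl_eq_zero (s := Metric.ball x0 (2 * (2 ^ N * c))) fun x hx => by
          rw [hβg2 x (not_lt.1 hx)]; simp]
        calc _ ≤ ∫ x in Metric.ball x0 (2 * (2 ^ N * c)), (G / (2 ^ N * c)) ^ 2 :=
              setIntegral_mono (cont_intOn (by fun_prop) Metric.isBounded_ball) (cont_intOn (by fun_prop) Metric.isBounded_ball) fun x =>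
                pow_le_pow_left₀ (norm_nonneg _) (hβG x) 2
          _ = G ^ 2 * ((2 * (2 ^ N * c)) ^ d / (2 ^ N * c) ^ 2 * volume.real (Metric.ball (0 : Ed d) 1)) := by
              rw [setIntegral_const, smul_eq_mul, ball_vol _ (by positivity)]; ring
          _ ≤ _ := by
              gcongr
              rw [div_le_iff₀ (by positivity)]
              rcases hdc with h | h
              · subst h; nlinarith
              · have hr1 : 1 ≤ 2 ^ N * c := h.trans hcR
                have := pow_le_pow_right₀ (by linarith : 1 ≤ 2 * (2 ^ N * c)) hd2
                nlinarith
      push_cast; linarith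

lemma capc (hd : 0 < d) (hd2 : d ≤ 2) {ε : ℝ} (hε : 0 < ε) : ∃ N : ℕ, ∀ (x0 : Ed d) (c : ℝ), 0 < c → (d = 2 ∨ 1 ≤ c) →
    ∃ F : Ed d → ℝ, IsTest F ∧ (∀ x, 0 ≤ F x ∧ F x ≤ 1) ∧ (∀ x, dist x x0 ≤ c → F x = 1) ∧
      (∀ x, 2 ^ N * c ≤ dist x x0 → F x = 0) ∧ ∫ x, ‖gradient F x‖ ^ 2 ≤ ε := by
  obtain ⟨K, hK, hF⟩ := cap0 hd hd2
  obtain ⟨N, hN⟩ := exists_nat_gt (K / ε)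
  have hN0 : (0:ℝ) < N := lt_trans (by positivity) hN
  rw [div_lt_iff₀ hε] at hN
  refine ⟨N, fun x0 c hc hdc => ?_⟩
  obtain ⟨F, h1, h2, h3, h4, -, h6⟩ := hF x0 c hc hdc N
  refine ⟨fun x => (N:ℝ)⁻¹ * F x, h1.cmul _, fun x => ⟨mul_nonneg (by positivity) (h2 x).1, ?_⟩, fun x hx => ?_, fun x hx => ?_, ?_⟩
  · rw [inv_mul_le_iff₀ hN0, mul_one]; exact (h2 x).2
  · simp only []; rw [h3 x hx, inv_mul_cancel₀ hN0.ne']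
  · simp only []; rw [h4 x hx, mul_zero]
  · have : ∀ x, ‖gradient (fun y => (N:ℝ)⁻¹ * F y) x‖ ^ 2 = ((N:ℝ)⁻¹) ^ 2 * ‖gradient F x‖ ^ 2 := fun x => by
      rw [grad_const_mul _ (c1_diff h1.c1), norm_smul, mul_pow, Real.norm_eq_abs, sq_abs]
    simp only [this]
    rw [integral_const_mul]
    calc _ ≤ ((N:ℝ)⁻¹) ^ 2 * (N * (N * ε)) := by
          refine mul_le_mul_of_nonneg_left (h6.trans ?_) (by positivity)
          exact mul_le_mul_of_nonneg_left hN.le hN0.le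
      _ = ε := by field_simp
end capa

section logc
variable {d : ℕ} {A : Ed d → Fin d → Fin d → ℝ} {W : Ed d → ℝ} {μ M : ℝ} {u : ℕ → Ed d → ℝ}

lemma inv_sm {v : Ed d → ℝ} (hv : ContDiff ℝ (⊤ : ℕ∞) v) (hv0 : ∀ x, 0 < v x) {s : ℝ} (hs : 0 < s) :
    ContDiff ℝ (⊤ : ℕ∞) fun y => (v y + s)⁻¹ :=
  (hv.add contDiff_const).inv fun x => by have := hv0 x; positivity

lemma log_sm {v : Ed d → ℝ} (hv : ContDiff ℝ (⊤ : ℕ∞) v) (hv0 : ∀ x, 0 < v x) {s : ℝ} (hs : 0 < s) :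
    ContDiff ℝ (⊤ : ℕ∞) fun y => Real.log (v y + s) :=
  (hv.add contDiff_const).log fun x => by have := hv0 x; positivity

lemma inv_grad {v : Ed d → ℝ} (hv : ContDiff ℝ (⊤ : ℕ∞) v) (hv0 : ∀ x, 0 < v x) {s : ℝ} (hs : 0 < s) (x : Ed d) :
    gradient (fun y => (v y + s)⁻¹) x = (-((v x + s)⁻¹) ^ 2) • gradient v x := by
  have h0 : v x + s ≠ 0 := by have := hv0 x; positivity
  refine (grad_comp (f := fun t => (t + s)⁻¹) (((hasDerivAt_id (v x)).add_const s).inv h0) (c1_diff (sm_c1 hv))).trans ?_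
  congr 1; simp [div_eq_mul_inv]

lemma log_grad {v : Ed d → ℝ} (hv : ContDiff ℝ (⊤ : ℕ∞) v) (hv0 : ∀ x, 0 < v x) {s : ℝ} (hs : 0 < s) (x : Ed d) :
    gradient (fun y => Real.log (v y + s)) x = ((v x + s)⁻¹) • gradient v x := by
  have h0 : v x + s ≠ 0 := by have := hv0 x; positivity
  refine (grad_comp (f := fun t => Real.log (t + s)) (((hasDerivAt_id (v x)).add_const s).log h0) (c1_diff (sm_c1 hv))).trans ?_
  congr 1; simp [div_eq_mul_inv]

lemma log_pt (h : Coef A W μ M) {η v : Ed d → ℝ} (hη : ContDiff ℝ 1 η) (hv : ContDiff ℝ (⊤ : ℕ∞) v) (hv0 : ∀ x, 0 < v x)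
    {s : ℝ} (hs : 0 < s) (x : Ed d) :
    (2 * μ)⁻¹ * (η x ^ 2 * ‖gradient (fun y => Real.log (v y + s)) x‖ ^ 2) ≤
      -den A W v (fun y => η y ^ 2 * (v y + s)⁻¹) x + (2 * μ ^ 3 * ‖gradient η x‖ ^ 2 + M * η x ^ 2) := by
  have hμ : 0 < μ := by linarith [h.hμ]
  have hp := hv0 x
  unfold den
  rw [sqm_grad hη (sm_c1 (inv_sm hv hv0 hs)), log_grad hv hv0 hs, inv_grad hv hv0 hs, bilA_add_right, bilA_smul_right, bilA_smul_right,
    bilA_smul_right, bilA_self, norm_smul, mul_pow, Real.norm_eq_abs, sq_abs]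
  have h1 := (h.ell x (gradient v x)).1
  have h2 := bilA_abs_le (x := x) h (gradient v x) (gradient η x)
  set t := (v x + s)⁻¹ with ht
  have ht0 : 0 < t := by positivity
  set g := ‖gradient v x‖
  set e := ‖gradient η x‖
  have h3 : (η x * t) ^ 2 * (μ⁻¹ * g ^ 2) ≤ (η x * t) ^ 2 * quadA A x (gradient v x) := mul_le_mul_of_nonneg_left h1 (sq_nonneg _)
  have h4 : 2 * η x * t * bilA A x (gradient v x) (gradient η x) ≤ 2 * |η x| * t * (μ * g * e) := by
    refine (le_abs_self _).trans ?_
    rw [abs_mul, abs_mul, abs_mul, abs_two, abs_of_pos ht0]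
    exact mul_le_mul_of_nonneg_left h2 (by positivity)
  have h5 : 2 * |η x| * t * (μ * g * e) ≤ (2 * μ)⁻¹ * ((η x * t) ^ 2 * g ^ 2) + 2 * μ ^ 3 * e ^ 2 := by
    have h6 := mul_nonneg (by positivity : 0 ≤ (2 * μ)⁻¹) (sq_nonneg (|η x| * t * g - 2 * μ ^ 2 * e))
    have e2 : (2 * μ)⁻¹ * (|η x| * t * g - 2 * μ ^ 2 * e) ^ 2 =
      (2 * μ)⁻¹ * (|η x| ^ 2 * t ^ 2 * g ^ 2) - 2 * |η x| * t * (μ * g * e) + 2 * μ ^ 3 * e ^ 2 := by field_simp; ring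
    rw [e2, sq_abs] at h6; rw [mul_pow]; linarith
  have h7 : W x * v x * (η x ^ 2 * t) ≤ M * η x ^ 2 := by
    have k1 : v x * t ≤ 1 := by rw [ht, ← div_eq_mul_inv, div_le_one (by positivity)]; linarith
    have k2 : |W x| * (v x * t) ≤ M * 1 := mul_le_mul (h.bW x) k1 (by positivity) (Mnn h)
    have k3 : W x * (v x * t) ≤ M := by
      have := mul_le_mul_of_nonneg_right (le_abs_self (W x)) (by positivity : 0 ≤ v x * t); linarith
    have := mul_le_mul_of_nonneg_right k3 (sq_nonneg (η x)); linarith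
  have e3 : (η x * t) ^ 2 * (μ⁻¹ * g ^ 2) = (2 * μ)⁻¹ * ((η x * t) ^ 2 * g ^ 2) + (2 * μ)⁻¹ * ((η x * t) ^ 2 * g ^ 2) := by field_simp; ring
  have e4 : (η x * t) ^ 2 = η x ^ 2 * t ^ 2 := by ring
  rw [e4] at *
  linarith

set_option maxHeartbeats 1000000 in
lemma logcacc (h : Coef A W μ M) (hu : Appr A W u) {η : Ed d → ℝ} (hη : IsTest η) (h01 : ∀ x, 0 ≤ η x ∧ η x ≤ 1) {s τ : ℝ} (hs : 0 < s)
    (hτ : 0 < τ) : ∀ᶠ n in atTop, ∫ x, η x ^ 2 * ‖gradient (fun y => Real.log (u n y + s)) x‖ ^ 2 ≤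
      2 * μ * (τ + (2 * μ ^ 3 * ∫ x, ‖gradient η x‖ ^ 2) + M * ∫ x, η x ^ 2) := by
  have hμ : 0 < μ := by linarith [h.hμ]
  obtain ⟨R, hR⟩ := (Metric.isBounded_iff_subset_ball (0 : Ed d)).1 hη.2.isBounded
  obtain ⟨Cb, hCb, hbd⟩ := hu.bd R
  have cg := grad_cont hη.c1
  have ce := hη.cont
  set E := ∫ x in Metric.ball (0 : Ed d) R, (8 * ((s⁻¹) ^ 2 * ‖gradient η x‖ ^ 2) + (s⁻¹) ^ 2) with hE
  have hE0 : 0 ≤ E := integral_nonneg fun x => by positivity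
  set C := 2 * ((s⁻¹) ^ 2) ^ 2 * Cb + E with hC
  have hC0 : 0 ≤ C := by positivity
  filter_upwards [hu.eq R (τ / (1 + Real.sqrt C)) (by positivity)] with n hn
  have hsm := hu.sm n
  have hp := hu.pos n
  have hvs := inv_sm hsm hp hs
  have cgu := grad_cont (sm_c1 hsm)
  set ψ := fun y => η y ^ 2 * (u n y + s)⁻¹ with hψd
  have hψ : IsTest ψ := ⟨(hη.1.pow 2).mul hvs, by
    have : HasCompactSupport fun y => η y * (η y * (u n y + s)⁻¹) := hη.2.mul_right
    have e : ψ = fun y => η y * (η y * (u n y + s)⁻¹) := by ext y; simp only [hψd]; ring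
    rw [e]; exact this⟩
  have hoff : ∀ x, x ∉ Metric.ball (0 : Ed d) R → η x = 0 := fun x hx => image_eq_zero_of_notMem_tsupport fun hx' => hx (hR hx')
  have hoffg : ∀ x, x ∉ Metric.ball (0 : Ed d) R → gradient η x = 0 := fun x hx => grad_zero_off fun hx' => hx (hR hx')
  have h1 := hn ψ hψ fun x hx => by simp [hψd, hoff x hx]
  have h2 : ∫ x, H1n ψ x ≤ C := by
    rw [← setIntegral_eq_integral_of_forall_compl_eq_zero (s := Metric.ball 0 R) fun x hx => by
      unfold H1n
      rw [sqm_grad hη.c1 (sm_c1 hvs), hψd]; simp [hoff x hx]]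
    calc _ ≤ ∫ x in Metric.ball (0 : Ed d) R, (2 * ((s⁻¹) ^ 2) ^ 2 * ‖gradient (u n) x‖ ^ 2 + (8 * ((s⁻¹) ^ 2 * ‖gradient η x‖ ^ 2) + (s⁻¹) ^ 2)) := by
          refine setIntegral_mono (cont_intOn (H1n_cont hψ.c1) Metric.isBounded_ball) (cont_intOn (by fun_prop) Metric.isBounded_ball) fun x => ?_
          refine (H1n_sqm hη.c1 (sm_c1 hvs) (h01 x).1 (h01 x).2).trans ?_
          rw [inv_grad hsm hp hs, norm_smul, mul_pow, Real.norm_eq_abs, sq_abs, neg_sq]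
          have hpx := hp x
          have k1 : (u n x + s)⁻¹ ≤ s⁻¹ := inv_anti₀ hs (by linarith)
          have k2 : ((u n x + s)⁻¹) ^ 2 ≤ (s⁻¹) ^ 2 := pow_le_pow_left₀ (by positivity) k1 2
          have k3 : (((u n x + s)⁻¹) ^ 2) ^ 2 ≤ ((s⁻¹) ^ 2) ^ 2 := pow_le_pow_left₀ (by positivity) k2 2
          have k4 := mul_le_mul_of_nonneg_right k2 (sq_nonneg ‖gradient η x‖)
          have k5 := mul_le_mul_of_nonneg_right k3 (sq_nonneg ‖gradient (u n) x‖)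
          linarith
      _ = 2 * ((s⁻¹) ^ 2) ^ 2 * (∫ x in Metric.ball (0 : Ed d) R, ‖gradient (u n) x‖ ^ 2) + E := by
          rw [integral_add (cont_intOn (by fun_prop) Metric.isBounded_ball) (cont_intOn (by fun_prop) Metric.isBounded_ball), integral_const_mul]
      _ ≤ C := by
          have := (grad_le_H1 (sm_c1 hsm) Metric.isBounded_ball).trans (hbd n 0)
          rw [hC]; gcongr
  have h3 : |BQ A W (u n) ψ| ≤ τ := h1.trans (by
    rw [div_mul_eq_mul_div, div_le_iff₀ (by positivity)]
    have := Real.sqrt_le_sqrt h2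
    nlinarith [Real.sqrt_nonneg C])
  have cl := grad_cont (sm_c1 (log_sm hsm hp hs))
  have i1 : Integrable fun x => 2 * μ ^ 3 * ‖gradient η x‖ ^ 2 :=
    hη.integrable_cont (by fun_prop) fun x hx => by rw [grad_zero_off hx]; simp
  have i2 : Integrable fun x => M * η x ^ 2 :=
    hη.integrable_cont (by fun_prop) fun x hx => by rw [image_eq_zero_of_notMem_tsupport hx]; simp
  have i3 : Integrable fun x => (2 * μ)⁻¹ * (η x ^ 2 * ‖gradient (fun y => Real.log (u n y + s)) x‖ ^ 2) :=
    hη.integrable_cont (by fun_prop) fun x hx => by rw [image_eq_zero_of_notMem_tsupport hx]; simp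
  have i4 : Integrable fun x => -den A W (u n) ψ x := (den_integrable h (sm_c1 hsm) hψ.c1 hψ.2).neg
  have main := integral_mono i3 (I_add i4 (I_add i1 i2)) fun x => log_pt h hη.c1 hsm hp hs x
  rw [integral_const_mul, integral_add i4 (I_add i1 i2), integral_add i1 i2, integral_const_mul, integral_const_mul, integral_neg] at main
  have h4 := (abs_le.1 h3).1
  unfold BQ at h4
  have := mul_le_mul_of_nonneg_left main (by positivity : 0 ≤ 2 * μ)
  rw [mul_inv_cancel_left₀ (by positivity)] at this
  refine this.trans (mul_le_mul_of_nonneg_left ?_ (by positivity))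
  linarith

/-- local energy of the logarithm from a cutoff -/
lemma log_loc (h : Coef A W μ M) (hu : Appr A W u) {η : Ed d → ℝ} (hη : IsTest η) (h01 : ∀ x, 0 ≤ η x ∧ η x ≤ 1) {s τ : ℝ} (hs : 0 < s)
    (hτ : 0 < τ) {x0 : Ed d} {R : ℝ} (h1 : ∀ x, dist x x0 ≤ R → η x = 1) :
    ∀ᶠ n in atTop, ∫ x in Metric.ball x0 R, ‖gradient (fun y => Real.log (u n y + s)) x‖ ^ 2 ≤
      2 * μ * (τ + (2 * μ ^ 3 * ∫ x, ‖gradient η x‖ ^ 2) + M * ∫ x, η x ^ 2) := by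
  filter_upwards [logcacc h hu hη h01 hs hτ] with n hn
  refine le_trans ?_ hn
  have cl := grad_cont (sm_c1 (log_sm (hu.sm n) (hu.pos n) hs))
  have ce := hη.cont
  calc _ = ∫ x in Metric.ball x0 R, η x ^ 2 * ‖gradient (fun y => Real.log (u n y + s)) x‖ ^ 2 :=
        setIntegral_congr_fun measurableSet_ball fun x hx => by
          have : dist x x0 < R := hx
          rw [h1 x this.le]; simp
    _ ≤ _ := setIntegral_le_integral (hη.integrable_cont (by fun_prop) fun x hx => by
        rw [image_eq_zero_of_notMem_tsupport hx]; simp) (ae_of_all _ fun x => by simp only [Pi.zero_apply]; positivity)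

lemma log_big (h : Coef A W μ M) (hu : Appr A W u) (x0 : Ed d) {R : ℝ} (hR : 0 < R) : ∃ C, 0 ≤ C ∧ ∀ s, 0 < s →
    ∀ᶠ n in atTop, ∫ x in Metric.ball x0 R, ‖gradient (fun y => Real.log (u n y + s)) x‖ ^ 2 ≤ C := by
  obtain ⟨G, hG, hb⟩ := bump d
  obtain ⟨η, hη, h01, h1, -⟩ := hb x0 R hR
  have hμ : 0 < μ := by linarith [h.hμ]
  have hM := Mnn h
  have e1 : 0 ≤ ∫ x, ‖gradient η x‖ ^ 2 := integral_nonneg fun x => by positivity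
  have e2 : 0 ≤ ∫ x, η x ^ 2 := integral_nonneg fun x => by positivity
  exact ⟨_, by positivity, fun s hs => log_loc h hu hη h01 hs one_pos fun x hx => h1 x (by linarith)⟩

lemma log_small (hd : 0 < d) (hd2 : d ≤ 2) (h : Coef A W μ M) (hu : Appr A W u) (x0 : Ed d) {δ : ℝ} (hδ : 0 < δ) :
    ∃ k0 : ℕ, ∀ k, k0 ≤ k → ∀ s, 0 < s → ∀ᶠ n in atTop,
      ((1 / 2 : ℝ) ^ k) ^ 2 * (∫ x in Metric.ball x0 ((1 / 2 : ℝ) ^ k), ‖gradient (fun y => Real.log (u n y + s)) x‖ ^ 2) ≤ δ * ((1 / 2 : ℝ) ^ k) ^ d := by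
  have hμ : 0 < μ := by linarith [h.hμ]
  have hM := Mnn h
  rcases (by omega : d = 1 ∨ d = 2) with h1 | h2
  · obtain ⟨C, hC, hb⟩ := log_big h hu x0 one_pos
    obtain ⟨k0, hk0⟩ := exists_pow_lt_of_lt_one (by positivity : 0 < δ / (C + 1)) (by norm_num : (1 / 2 : ℝ) < 1)
    refine ⟨k0, fun k hk s hs => ?_⟩
    filter_upwards [hb s hs] with n hn
    have cl := grad_cont (sm_c1 (log_sm (hu.sm n) (hu.pos n) hs))
    have hr : (0:ℝ) < (1 / 2) ^ k := by positivity
    have hr1 : (1 / 2 : ℝ) ^ k ≤ 1 := pow_le_one₀ (by norm_num) (by norm_num)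
    have hrk : (1 / 2 : ℝ) ^ k ≤ δ / (C + 1) := (pow_le_pow_of_le_one (by norm_num) (by norm_num) hk).trans hk0.le
    rw [le_div_iff₀ (by positivity)] at hrk
    have := (mono_int (by fun_prop) (fun x => by positivity) Metric.isBounded_ball (Metric.ball_subset_ball hr1)).trans hn
    calc _ ≤ ((1 / 2 : ℝ) ^ k) ^ 2 * C := by gcongr
      _ ≤ δ * (1 / 2 : ℝ) ^ k := by nlinarith
      _ = _ := by rw [h1, pow_one]
  · set ω := volume.real (Metric.ball (0 : Ed d) 1)
    have hω : 0 < ω := om_pos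
    set κ := δ / (2 * μ * (1 + 2 * μ ^ 3 + M * ω)) with hκ
    have hκ0 : 0 < κ := by positivity
    obtain ⟨N, hN⟩ := capc hd hd2 hκ0
    obtain ⟨p, hp⟩ := exists_pow_lt_of_lt_one hκ0 (by norm_num : (1 / 2 : ℝ) < 1)
    obtain ⟨η, hη, h01, h1, hz, he⟩ := hN x0 ((1 / 2) ^ (N + p)) (by positivity) (Or.inl h2)
    refine ⟨N + p, fun k hk s hs => ?_⟩
    have hrk : (1 / 2 : ℝ) ^ k ≤ (1 / 2) ^ (N + p) := pow_le_pow_of_le_one (by norm_num) (by norm_num) hk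
    filter_upwards [log_loc h hu hη h01 hs hκ0 (fun x hx => h1 x (le_trans hx hrk))] with n hn
    have e0 : (2:ℝ) ^ N * (1 / 2) ^ (N + p) = (1 / 2) ^ p := by rw [pow_add, ← mul_assoc, ← mul_pow]; norm_num
    rw [e0] at hz
    have ce := hη.cont
    have e2 : ∫ x, η x ^ 2 ≤ κ * ω := by
      rw [← setIntegral_eq_integral_of_forall_compl_eq_zero (s := Metric.ball x0 ((1 / 2) ^ p)) fun x hx => by
        rw [hz x (not_lt.1 hx)]; simp]
      calc _ ≤ ∫ x in Metric.ball x0 ((1 / 2) ^ p), (1:ℝ) :=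
            setIntegral_mono (cont_intOn (ce.pow 2) Metric.isBounded_ball) (cont_intOn continuous_const Metric.isBounded_ball) fun x =>
              pow_le_one₀ (h01 x).1 (h01 x).2
        _ = ((1 / 2) ^ p) ^ d * ω := by rw [setIntegral_const, smul_eq_mul, ball_vol _ (by positivity), mul_one]
        _ ≤ _ := by
            have : (1 / 2 : ℝ) ^ p ≤ 1 := pow_le_one₀ (by norm_num) (by norm_num)
            gcongr
            exact (pow_le_of_le_one (by positivity) this hd.ne').trans hp.le
    have e5 : ((1 / 2 : ℝ) ^ k) ^ d = ((1 / 2) ^ k) ^ 2 := by rw [h2]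
    rw [e5, mul_comm]
    refine mul_le_mul_of_nonneg_right (hn.trans ?_) (by positivity)
    calc _ ≤ 2 * μ * (κ + 2 * μ ^ 3 * κ + M * (κ * ω)) := by gcongr
      _ = δ := by rw [hκ]; field_simp

end logc

section posi
variable {d : ℕ} {A : Ed d → Fin d → Fin d → ℝ} {W : Ed d → ℝ} {μ M : ℝ} {u : ℕ → Ed d → ℝ}

lemma log_low {v : Ed d → ℝ} (hv : ContDiff ℝ (⊤ : ℕ∞) v) (hv0 : ∀ x, 0 < v x) {s : ℝ} (hs : 0 < s) (hs1 : s ≤ 1) {x0 : Ed d} {R L P Cb c1 : ℝ}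
    (hP : ∫ x in Metric.ball x0 R, (Real.log (v x + s) - L) ^ 2 ≤ P) (hCb : ∫ x in Metric.ball x0 R, v x ^ 2 ≤ Cb)
    (hc0 : 0 < c1) (hc : c1 ≤ ∫ x in Metric.ball x0 R, v x) :
    -((4 * volume.real (Metric.ball x0 R) + 2 * Cb + P) / c1) ≤ L := by
  have cw := (log_sm hv hv0 hs).continuous
  have cv := hv.continuous
  have hBb : Bornology.IsBounded (Metric.ball x0 R) := Metric.isBounded_ball
  have hP0 : 0 ≤ P := le_trans (integral_nonneg fun x => sq_nonneg _) hP
  have hC0 : 0 ≤ Cb := le_trans (integral_nonneg fun x => sq_nonneg _) hCb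
  have hV : 0 ≤ volume.real (Metric.ball x0 R) := measureReal_nonneg
  by_contra hcon
  push Not at hcon
  have hX : 0 ≤ (4 * volume.real (Metric.ball x0 R) + 2 * Cb + P) / c1 := by positivity
  set K := -L with hK
  have hK0 : 0 < K := by linarith
  have hKX : (4 * volume.real (Metric.ball x0 R) + 2 * Cb + P) / c1 < K := by linarith
  rw [div_lt_iff₀ hc0] at hKX
  have pt : ∀ x, v x ≤ K⁻¹ * (4 + 2 * v x ^ 2 + (Real.log (v x + s) - L) ^ 2) := fun x => by
    have hp := hv0 x
    have ht : 0 < v x + s := by linarith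
    rw [← div_eq_inv_mul, le_div_iff₀ hK0]
    rcases le_total (Real.log (v x + s)) (-(K / 2)) with h1 | h1
    · have h2 : v x + s ≤ Real.exp (-(K / 2)) := by rwa [Real.log_le_iff_le_exp ht] at h1
      have h3 : Real.exp (-(K / 2)) * (K / 2) ≤ 1 := by
        rw [Real.exp_neg, inv_mul_le_iff₀ (Real.exp_pos _)]
        linarith [Real.add_one_le_exp (K / 2)]
      have h4 : v x * (K / 2) ≤ Real.exp (-(K / 2)) * (K / 2) := mul_le_mul_of_nonneg_right (by linarith) (by linarith)
      nlinarith [sq_nonneg (v x), sq_nonneg (Real.log (v x + s) - L)]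
    · have h2 : K / 2 ≤ Real.log (v x + s) - L := by linarith
      have h3 : v x * (K / 2) ≤ v x * (Real.log (v x + s) - L) := mul_le_mul_of_nonneg_left h2 hp.le
      nlinarith [sq_nonneg (v x - (Real.log (v x + s) - L)), sq_nonneg (v x)]
  have i1 : IntegrableOn (fun x => 4 + 2 * v x ^ 2) (Metric.ball x0 R) := cont_intOn (by fun_prop) hBb
  have i2 : IntegrableOn (fun x => (Real.log (v x + s) - L) ^ 2) (Metric.ball x0 R) := cont_intOn (by fun_prop) hBb
  have i3 : IntegrableOn (fun x => 2 * v x ^ 2) (Metric.ball x0 R) := cont_intOn (by fun_prop) hBb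
  have i4 : IntegrableOn (fun _ => (4:ℝ)) (Metric.ball x0 R) := cont_intOn (by fun_prop) hBb
  have := setIntegral_mono (cont_intOn cv hBb) ((I_add i1 i2).const_mul K⁻¹) pt
  rw [integral_const_mul, integral_add i1 i2, integral_add i4 i3, setIntegral_const, smul_eq_mul, integral_const_mul, ← div_eq_inv_mul,
    le_div_iff₀ hK0] at this
  nlinarith

set_option maxHeartbeats 1000000 in
lemma posit (hd : 0 < d) (hd2 : d ≤ 2) (h : Coef A W μ M) (hu : Appr A W u) {φ : Ed d → ℝ} {C σ : ℝ} (hφ : Continuous φ)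
    (hφ0 : ∀ x, 0 ≤ φ x) (hC : 0 < C) (hσ : 0 < σ) (hσ1 : σ < 1)
    (hav : ∀ x (k : ℕ), ∀ᶠ n in uf, |av (u n) (Metric.ball x ((1 / 2 : ℝ) ^ k)) - φ x| ≤ C * σ ^ k)
    (hL2 : ∀ N : ℝ, Tendsto (fun n => ∫ x in Metric.ball (0 : Ed d) N, (u n x - φ x) ^ 2) uf (𝓝 0)) (x0 : Ed d) : 0 < φ x0 := by
  rcases (hφ0 x0).lt_or_eq with h0 | h0
  · exact h0
  exfalso
  have hω : 0 < volume.real (Metric.ball (0 : Ed d) 1) := om_pos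
  set q := -Real.log σ / 2 with hq
  have hq0 : 0 < q := by have := Real.log_neg hσ hσ1; linarith
  set δ := q ^ 2 * (volume.real (Metric.ball (0 : Ed d) 1) / 4 ^ (d + 1)) with hδ
  obtain ⟨k0, hk0⟩ := log_small hd hd2 h hu x0 (δ := δ) (by positivity)
  obtain ⟨c, R0, hc, hmass⟩ := hu.mass
  set R := |R0| + dist x0 0 + 1 with hR
  have hR1 : 1 ≤ R := by have := abs_nonneg R0; have := dist_nonneg (x := x0) (y := 0); linarith
  have hR0 : 0 < R := by linarith
  have hsubR : Metric.ball (0 : Ed d) R0 ⊆ Metric.ball x0 R := Metric.ball_subset_ball' (by rw [dist_comm]; linarith [le_abs_self R0])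
  have hBN : Metric.ball x0 R ⊆ Metric.ball (0 : Ed d) (R + dist x0 0) := Metric.ball_subset_ball' le_rfl
  obtain ⟨CB, hCB, hbig⟩ := log_big h hu x0 hR0
  obtain ⟨Cb, hCb, hbd⟩ := hu.bd R
  obtain ⟨Φ, hΦ⟩ := (isCompact_closedBall x0 R).exists_bound_of_continuousOn hφ.continuousOn
  set Φ' := |Φ| + 1 with hΦ'
  have hΦ0 : 0 < Φ' := by positivity
  have hBb : Bornology.IsBounded (Metric.ball x0 R) := Metric.isBounded_ball
  -- mass in L1
  have hL1 : ∀ᶠ n in uf, c / (4 * Φ') ≤ ∫ x in Metric.ball x0 R, u n x := by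
    filter_upwards [(hL2 (R + dist x0 0)).eventually (gt_mem_nhds (by positivity : 0 < c / 2))] with n hn
    have cu := (hu.sm n).continuous
    have h1 : c ≤ ∫ x in Metric.ball x0 R, u n x ^ 2 := (hmass n).trans (mono_int (by fun_prop) (fun x => by positivity) hBb hsubR)
    have h2 : ∫ x in Metric.ball x0 R, (u n x - φ x) ^ 2 ≤ c / 2 :=
      (mono_int (by fun_prop) (fun x => by positivity) Metric.isBounded_ball hBN).trans hn.le
    have i1 : IntegrableOn (fun x => (u n x - φ x) ^ 2) (Metric.ball x0 R) := cont_intOn (by fun_prop) hBb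
    have i2 : IntegrableOn (fun x => 2 * Φ' * u n x) (Metric.ball x0 R) := cont_intOn (by fun_prop) hBb
    have h3 := setIntegral_mono_on (cont_intOn (f := fun x => u n x ^ 2) (by fun_prop) hBb) (I_add i1 i2) measurableSet_ball fun x hx => by
      have k1 := hΦ x (Metric.ball_subset_closedBall hx)
      have k2 : φ x ≤ Φ' := by rw [Real.norm_eq_abs] at k1; linarith [le_abs_self (φ x), le_abs_self Φ]
      have k3 := mul_le_mul_of_nonneg_right k2 (hu.pos n x).le
      nlinarith [sq_nonneg (φ x)]
    rw [integral_add i1 i2, integral_const_mul] at h3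
    rw [div_le_iff₀ (by positivity)]
    linarith
  have hr : ∀ k : ℕ, (0:ℝ) < (1 / 2) ^ k := fun k => by positivity
  have hr1 : ∀ k : ℕ, (1 / 2 : ℝ) ^ k ≤ 1 := fun k => pow_le_one₀ (by norm_num) (by norm_num)
  have hrs : ∀ k : ℕ, (1 / 2 : ℝ) ^ (k + 1) = (1 / 2) ^ k / 2 := fun k => by rw [pow_succ]; ring
  have hbK : Metric.ball x0 ((1 / 2 : ℝ) ^ k0) ⊆ Metric.ball x0 R := Metric.ball_subset_ball ((hr1 k0).trans hR1)
  set P := (volume.real (Metric.ball x0 ((1 / 2 : ℝ) ^ k0)))⁻¹ * ((2 * R) ^ 2 * volume.real (Metric.ball (0 : Ed d) (2 * R))) * CB with hP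
  set C4 := (4 * volume.real (Metric.ball x0 R) + 2 * Cb + P) / (c / (4 * Φ')) with hC4
  have hstart : ∀ s, 0 < s → s ≤ 1 → ∀ᶠ n in uf, -C4 ≤ av (fun y => Real.log (u n y + s)) (Metric.ball x0 ((1 / 2 : ℝ) ^ k0)) := by
    intro s hs hs1
    filter_upwards [hL1, uf_le (hbig s hs)] with n h1 h2
    refine log_low (hu.sm n) (hu.pos n) hs hs1 ?_ ((sq_le_H1 (sm_c1 (hu.sm n)) hBb).trans (hbd n x0)) (by positivity) h1
    refine (poincG (sm_c1 (log_sm (hu.sm n) (hu.pos n) hs)) (convex_ball x0 R) measurableSet_ball hR0.le subset_rfl hbK (ball_vol_pos x0 (hr k0))).trans ?_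
    rw [hP]; gcongr
  have hchain : ∀ s, 0 < s → s ≤ 1 → ∀ j : ℕ, ∀ᶠ n in uf,
      -C4 - j * q ≤ av (fun y => Real.log (u n y + s)) (Metric.ball x0 ((1 / 2 : ℝ) ^ (k0 + j))) := by
    intro s hs hs1 j
    induction j with
    | zero => simpa using hstart s hs hs1
    | succ j ih =>
      filter_upwards [ih, uf_le (hk0 (k0 + j) (by omega) s hs)] with n h1 h2
      have h3 := av_nest (sm_c1 (log_sm (hu.sm n) (hu.pos n) hs)) (hr (k0 + j)) (Metric.ball_subset_ball (x := x0) (by linarith [hr (k0 + j)])) h2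
      have h4 : 4 ^ (d + 1) / volume.real (Metric.ball (0 : Ed d) 1) * δ = q ^ 2 := by rw [hδ]; field_simp
      rw [h4, ← hrs] at h3
      have h5 := (abs_le.1 (abs_le_of_sq_le_sq h3 hq0.le)).1
      rw [← add_assoc]
      push_cast
      linarith
  have hupper : ∀ k : ℕ, ∀ᶠ n in uf,
      av (fun y => Real.log (u n y + σ ^ k)) (Metric.ball x0 ((1 / 2 : ℝ) ^ k)) ≤ Real.log (C + 1) - 2 * q * k := by
    intro k
    filter_upwards [hav x0 k] with n hn
    have hs : 0 < σ ^ k := by positivity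
    rw [← h0, sub_zero] at hn
    have hn' := (abs_le.1 hn).2
    have cw := (log_sm (hu.sm n) (hu.pos n) hs).continuous
    have cu := (hu.sm n).continuous
    have hv := ball_vol_pos x0 (hr k)
    set a := (C + 1) * σ ^ k with ha
    have ha0 : 0 < a := by positivity
    have hla : Real.log a = Real.log (C + 1) - 2 * q * k := by
      rw [ha, Real.log_mul (by positivity) hs.ne', Real.log_pow, hq]; ring
    have h1 := av_mono (b := Metric.ball x0 ((1 / 2 : ℝ) ^ k)) Metric.isBounded_ball measurableSet_ball cw
      (g := fun y => (-(a⁻¹)) * (-(u n y)) - (1 - Real.log a - a⁻¹ * σ ^ k)) (by fun_prop) fun x hx => by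
        have hp : 0 < u n x + σ ^ k := by have := hu.pos n x; positivity
        have k1 := Real.log_le_sub_one_of_pos (div_pos hp ha0)
        rw [Real.log_div hp.ne' ha0.ne', div_eq_inv_mul] at k1
        linarith
    rw [av_sub Metric.isBounded_ball (by fun_prop) continuous_const, av_const hv] at h1
    have h2 : av (fun y => (-(a⁻¹)) * (-(u n y))) (Metric.ball x0 ((1 / 2 : ℝ) ^ k)) = a⁻¹ * av (u n) (Metric.ball x0 ((1 / 2 : ℝ) ^ k)) := by
      unfold av; simp only [neg_mul_neg]; rw [integral_const_mul]; ring
    rw [h2] at h1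
    have h3 : a⁻¹ * (av (u n) (Metric.ball x0 ((1 / 2 : ℝ) ^ k)) + σ ^ k) ≤ 1 := by
      rw [inv_mul_le_iff₀ ha0, ha]; linarith
    rw [← hla]; linarith
  obtain ⟨j, hj⟩ := exists_nat_gt ((C4 + Real.log (C + 1)) / q)
  rw [div_lt_iff₀ hq0] at hj
  obtain ⟨n, h1, h2⟩ := ((hchain (σ ^ (k0 + j)) (by positivity) (pow_le_one₀ hσ.le hσ1.le) j).and (hupper (k0 + j))).exists
  have : (0:ℝ) ≤ 2 * q * k0 := by positivity
  push_cast at h2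
  linarith

end posi

section nul
variable {d : ℕ} {A : Ed d → Fin d → Fin d → ℝ} {W : Ed d → ℝ} {μ M : ℝ} {u : ℕ → Ed d → ℝ}

lemma prodQ (h : Coef A W μ M) {χ v : Ed d → ℝ} (hχ : IsTest χ) (hv : ContDiff ℝ (⊤ : ℕ∞) v) :
    QA A W (fun y => v y * χ y) ≤ (∫ x, μ * (v x ^ 2 * ‖gradient χ x‖ ^ 2)) + BQ A W v (fun y => χ y ^ 2 * v y) := by
  have cv := hv.continuous
  have cg := grad_cont hχ.c1
  have hp : HasCompactSupport fun y => v y * χ y := hχ.2.mul_left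
  have hp2 : HasCompactSupport fun y => χ y ^ 2 * v y := by
    have : HasCompactSupport fun y => χ y * (χ y * v y) := hχ.2.mul_right
    simpa only [pow_two, mul_assoc] using this
  have c1 : ContDiff ℝ 1 fun y => v y * χ y := (sm_c1 hv).mul hχ.c1
  have c2 : ContDiff ℝ 1 fun y => χ y ^ 2 * v y := (hχ.c1.pow 2).mul (sm_c1 hv)
  have i1 : Integrable fun x => μ * (v x ^ 2 * ‖gradient χ x‖ ^ 2) :=
    hχ.integrable_cont (by fun_prop) fun x hx => by rw [grad_zero_off hx]; simp
  have i2 := den_integrable h (sm_c1 hv) c2 hp2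
  rw [QA_eq, BQ, ← integral_add i1 i2]
  refine integral_mono (den_integrable h c1 c1 hp) (I_add i1 i2) fun x => ?_
  have k := mul_le_mul_of_nonneg_left (h.ell x (gradient χ x)).2 (sq_nonneg (v x))
  simp only [den]
  rw [sqm_grad hχ.c1 (sm_c1 hv), grad_mul (c1_diff (sm_c1 hv)) (c1_diff hχ.c1), bilA_self, quadA_add h, quadA_smul, quadA_smul, bilA_smul_left,
    bilA_smul_right, bilA_add_right, bilA_smul_right, bilA_smul_right, bilA_self, bilA_comm h (gradient χ x)]
  linarith

set_option maxHeartbeats 1000000 in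
lemma nulstep (hd : 0 < d) (hd2 : d ≤ 2) (h : Coef A W μ M) (hu : Appr A W u) {φ : Ed d → ℝ} {Φ : ℝ} (hφ : Continuous φ)
    (hΦ : ∀ x, |φ x| ≤ Φ)
    (hL2 : ∀ N : ℝ, Tendsto (fun n => ∫ x in Metric.ball (0 : Ed d) N, (u n x - φ x) ^ 2) uf (𝓝 0)) {ε R : ℝ} (hε : 0 < ε) (hR : 1 ≤ R) :
    ∃ v, IsTest v ∧ (∀ x, 0 ≤ v x) ∧ (∀ x ∈ Metric.ball (0 : Ed d) R, 0 < v x) ∧ QA A W v ≤ ε ∧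
      ∫ x in Metric.ball (0 : Ed d) R, (v x - φ x) ^ 2 ≤ ε := by
  have hμ : 0 < μ := by linarith [h.hμ]
  set κ := ε / (2 * μ * (2 + 2 * Φ ^ 2)) with hκ
  have hκ0 : 0 < κ := by positivity
  obtain ⟨N, hN⟩ := capc hd hd2 hκ0
  obtain ⟨χ, hχ, h01, h1, hz, he⟩ := hN 0 R (by linarith) (Or.inr hR)
  set B := Metric.ball (0 : Ed d) (2 ^ N * R) with hB
  have hBb : Bornology.IsBounded B := Metric.isBounded_ball
  have cg := grad_cont hχ.c1
  have cχ := hχ.cont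
  obtain ⟨S, hS⟩ := (grad_compact hχ.2).exists_bound_of_continuous cg
  have hS0 : 0 ≤ S := (norm_nonneg _).trans (hS 0)
  have hS2 : ∀ x, ‖gradient χ x‖ ^ 2 ≤ S ^ 2 := fun x => pow_le_pow_left₀ (norm_nonneg _) (hS x) 2
  have hzg : ∀ x, x ∉ Metric.ball (0 : Ed d) (2 ^ N * R + 1) → χ x = 0 ∧ gradient χ x = 0 := fun x hx => by
    have hx' : 2 ^ N * R + 1 ≤ dist x 0 := not_lt.1 hx
    have : x ∉ tsupport χ := by
      intro hxt
      have hsub : tsupport χ ⊆ Metric.closedBall 0 (2 ^ N * R) := by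
        refine closure_minimal (fun y hy => ?_) Metric.isClosed_closedBall
        by_contra hy'
        exact hy (hz y (not_le.1 hy').le)
      have : dist x 0 ≤ 2 ^ N * R := hsub hxt
      linarith
    exact ⟨image_eq_zero_of_notMem_tsupport this, grad_zero_off this⟩
  set B' := Metric.ball (0 : Ed d) (2 ^ N * R + 1) with hB'
  have hBb' : Bornology.IsBounded B' := Metric.isBounded_ball
  obtain ⟨Cb, hCb, hbd⟩ := hu.bd (2 ^ N * R + 1)
  set D := (3 + 8 * S ^ 2) * Cb with hD
  have hD0 : 0 ≤ D := by positivity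
  obtain ⟨n, ⟨hn1, hn2⟩, hn3⟩ := ((((hu.eq (2 ^ N * R + 1) (ε / 2 / (1 + Real.sqrt D)) (by positivity)).filter_mono uf_le).and
    ((hL2 (2 ^ N * R + 1)).eventually (gt_mem_nhds (by positivity : 0 < κ / (1 + S ^ 2))))).and
    ((hL2 R).eventually (gt_mem_nhds hε))).exists
  have hsm := hu.sm n
  have cu := hsm.continuous
  have cgu := grad_cont (sm_c1 hsm)
  refine ⟨fun y => u n y * χ y, ⟨hsm.mul hχ.1, hχ.2.mul_left⟩, fun x => mul_nonneg (hu.pos n x).le (h01 x).1, fun x hx => ?_, ?_, ?_⟩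
  · have : dist x 0 < R := hx
    simp only []; rw [h1 x this.le, mul_one]; exact hu.pos n x
  · refine (prodQ h hχ hsm).trans ?_
    have hψ : IsTest fun y => χ y ^ 2 * u n y := ⟨(hχ.1.pow 2).mul hsm, by
      have : HasCompactSupport fun y => χ y * (χ y * u n y) := hχ.2.mul_right
      simpa only [pow_two, mul_assoc] using this⟩
    have b1 := hn1 _ hψ fun x hx => by simp [(hzg x hx).1]
    have b2 : ∫ x, H1n (fun y => χ y ^ 2 * u n y) x ≤ D := by
      rw [← setIntegral_eq_integral_of_forall_compl_eq_zero (s := B') fun x hx => by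
        unfold H1n
        rw [sqm_grad hχ.c1 (sm_c1 hsm)]; simp [(hzg x hx).1]]
      calc _ ≤ ∫ x in B', (3 + 8 * S ^ 2) * H1n (u n) x := by
            refine setIntegral_mono (cont_intOn (H1n_cont hψ.c1) hBb') ((cont_intOn (H1n_cont (sm_c1 hsm)) hBb').const_mul _) fun x => ?_
            refine (H1n_sqm hχ.c1 (sm_c1 hsm) (h01 x).1 (h01 x).2).trans ?_
            have k := mul_le_mul_of_nonneg_left (hS2 x) (sq_nonneg (u n x))
            have k2 : 0 ≤ S ^ 2 * ‖gradient (u n) x‖ ^ 2 := by positivity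
            unfold H1n
            nlinarith [sq_nonneg (u n x), sq_nonneg ‖gradient (u n) x‖]
        _ ≤ D := by rw [integral_const_mul]; exact mul_le_mul_of_nonneg_left (hbd n 0) (by positivity)
    have b3 : BQ A W (u n) (fun y => χ y ^ 2 * u n y) ≤ ε / 2 := (le_abs_self _).trans (b1.trans (by
      rw [div_mul_eq_mul_div, div_le_iff₀ (by positivity)]
      have := Real.sqrt_le_sqrt b2
      nlinarith [Real.sqrt_nonneg D]))
    have b4 : ∫ x, μ * (u n x ^ 2 * ‖gradient χ x‖ ^ 2) ≤ ε / 2 := by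
      rw [integral_const_mul]
      rw [← setIntegral_eq_integral_of_forall_compl_eq_zero (s := B') fun x hx => by rw [(hzg x hx).2]; simp]
      have i1 : IntegrableOn (fun x => 2 * S ^ 2 * (u n x - φ x) ^ 2) B' := cont_intOn (by fun_prop) hBb'
      have i2 : IntegrableOn (fun x => 2 * Φ ^ 2 * ‖gradient χ x‖ ^ 2) B' := cont_intOn (by fun_prop) hBb'
      have b5 : ∫ x in B', u n x ^ 2 * ‖gradient χ x‖ ^ 2 ≤ ∫ x in B', (2 * S ^ 2 * (u n x - φ x) ^ 2 + 2 * Φ ^ 2 * ‖gradient χ x‖ ^ 2) := by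
        refine setIntegral_mono (cont_intOn (by fun_prop) hBb') (I_add i1 i2) fun x => ?_
        have k1 := mul_le_mul_of_nonneg_left (hS2 x) (sq_nonneg (u n x - φ x))
        have k2 : φ x ^ 2 ≤ Φ ^ 2 := sq_le_sq' (by linarith [(abs_le.1 (hΦ x)).1]) (abs_le.1 (hΦ x)).2
        have k3 := mul_le_mul_of_nonneg_right k2 (sq_nonneg ‖gradient χ x‖)
        have k4 : u n x ^ 2 ≤ 2 * (u n x - φ x) ^ 2 + 2 * φ x ^ 2 := by nlinarith [sq_nonneg (u n x - 2 * φ x)]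
        have k5 := mul_le_mul_of_nonneg_right k4 (sq_nonneg ‖gradient χ x‖)
        simp only []; linarith
      rw [integral_add i1 i2, integral_const_mul, integral_const_mul] at b5
      rw [setIntegral_eq_integral_of_forall_compl_eq_zero (f := fun x => ‖gradient χ x‖ ^ 2) fun x hx => by rw [(hzg x hx).2]; simp] at b5
      have b6 : 2 * S ^ 2 * (∫ x in B', (u n x - φ x) ^ 2) ≤ 2 * κ := by
        rw [lt_div_iff₀ (by positivity)] at hn2
        have : 0 ≤ ∫ x in B', (u n x - φ x) ^ 2 := integral_nonneg fun x => sq_nonneg _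
        linarith
      have b7 := mul_le_mul_of_nonneg_left he (by positivity : 0 ≤ 2 * Φ ^ 2)
      calc _ ≤ μ * (2 * κ + 2 * Φ ^ 2 * κ) := mul_le_mul_of_nonneg_left (by linarith) hμ.le
        _ = ε / 2 := by rw [hκ]; field_simp
    linarith
  · refine le_trans (le_of_eq ?_) hn3.le
    refine setIntegral_congr_fun measurableSet_ball fun x hx => ?_
    have : dist x 0 < R := hx
    simp only []; rw [h1 x this.le, mul_one]

lemma L2_sq_tend {v : ℕ → Ed d → ℝ} {φ : Ed d → ℝ} {S : Set (Ed d)} {Φ : ℝ} (hv : ∀ n, Continuous (v n)) (hφ : Continuous φ)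
    (hΦ : ∀ x, |φ x| ≤ Φ) (hS : Bornology.IsBounded S) (hL : Tendsto (fun n => ∫ x in S, (v n x - φ x) ^ 2) atTop (𝓝 0)) :
    Tendsto (fun n => ∫ x in S, v n x ^ 2) atTop (𝓝 (∫ x in S, φ x ^ 2)) := by
  rw [tendsto_iff_dist_tendsto_zero]
  have h2 : Tendsto (fun n => (∫ x in S, (v n x - φ x) ^ 2) + 2 * Φ * ∫ x in S, |v n x - φ x|) atTop (𝓝 0) := by
    simpa using hL.add ((L1_tend hv hφ hS hL).const_mul (2 * Φ))
  refine squeeze_zero (fun n => dist_nonneg) (fun n => ?_) h2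
  have := hv n
  have i1 : IntegrableOn (fun x => (v n x - φ x) ^ 2) S := cont_intOn (by fun_prop) hS
  have i2 : IntegrableOn (fun x => 2 * Φ * |v n x - φ x|) S := cont_intOn (by fun_prop) hS
  rw [Real.dist_eq, ← integral_sub (cont_intOn (by fun_prop) hS) (cont_intOn (by fun_prop) hS), ← integral_const_mul, ← integral_add i1 i2]
  refine (abs_integral_le_integral_abs).trans (setIntegral_mono (cont_intOn (by fun_prop) hS) (I_add i1 i2) fun x => ?_)
  have e : v n x ^ 2 - φ x ^ 2 = (v n x - φ x) ^ 2 + 2 * φ x * (v n x - φ x) := by ring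
  simp only []
  rw [e]
  refine (abs_add_le _ _).trans ?_
  rw [abs_of_nonneg (sq_nonneg (v n x - φ x)), abs_mul, abs_mul, abs_two]
  have := mul_le_mul_of_nonneg_right (hΦ x) (abs_nonneg (v n x - φ x))
  linarith

lemma sq_pos_int {f : Ed d → ℝ} (hf : Continuous f) (h0 : ∀ x ∈ Metric.ball (0 : Ed d) 1, 0 < f x) :
    0 < ∫ x in Metric.ball (0 : Ed d) 1, f x ^ 2 := by
  rw [setIntegral_pos_iff_support_of_nonneg_ae (ae_of_all _ fun x => sq_nonneg _) (cont_intOn (by fun_prop) Metric.isBounded_ball)]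
  have : Function.support (fun x => f x ^ 2) ∩ Metric.ball (0 : Ed d) 1 = Metric.ball (0 : Ed d) 1 :=
    Set.inter_eq_right.2 fun x hx => (pow_pos (h0 x hx) 2).ne'
  rw [this]
  exact Metric.measure_ball_pos _ _ one_pos

set_option maxHeartbeats 1000000 in
lemma crit (hd : 0 < d) (hd2 : d ≤ 2) (h : Coef A W μ M) (hpos : ∀ u, IsTest u → 0 ≤ QA A W u) (hu : Appr A W u) : CriticalA A W := by
  refine ⟨hpos, ?_⟩
  obtain ⟨φ, C, σ, hφ, hφ0, hC, hσ, hσ1, hav, hL2⟩ := limphi hd hd2 h hu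
  have hφp := posit hd hd2 h hu hφ hφ0 hC hσ hσ1 hav hL2
  obtain ⟨C1, -, hC1⟩ := av_bd hu one_pos
  set Φ := C1 + C
  have hΦ : ∀ x, |φ x| ≤ Φ := fun x => by
    obtain ⟨n, hn⟩ := (hav x 0).exists
    rw [pow_zero, pow_zero, mul_one] at hn
    rw [abs_of_nonneg (hφ0 x)]
    linarith [(abs_le.1 hn).1, (abs_le.1 (hC1 n x)).2]
  choose v hv hv0 hvp hvQ hvL using fun j : ℕ => nulstep hd hd2 h hu hφ hΦ hL2 (ε := 1 / ((j:ℝ) + 1)) (R := (j:ℝ) + 1) (by positivity) (by linarith [j.cast_nonneg (α := ℝ)])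
  have cv : ∀ j, Continuous (v j) := fun j => (hv j).cont
  have hlim := tendsto_one_div_add_atTop_nhds_zero_nat (𝕜 := ℝ)
  have hL : ∀ S : Set (Ed d), Bornology.IsBounded S → Tendsto (fun n => ∫ x in S, (v n x - φ x) ^ 2) atTop (𝓝 0) := fun S hS => by
    obtain ⟨r, hr⟩ := (Metric.isBounded_iff_subset_ball (0 : Ed d)).1 hS
    obtain ⟨n0, hn0⟩ := exists_nat_gt r
    refine squeeze_zero' (Eventually.of_forall fun n => integral_nonneg fun x => sq_nonneg _) ?_ hlim
    filter_upwards [eventually_ge_atTop n0] with n hn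
    have : (n0:ℝ) ≤ n := by exact_mod_cast hn
    have := cv n
    exact (mono_int (by fun_prop) (fun x => sq_nonneg _) Metric.isBounded_ball (hr.trans (Metric.ball_subset_ball (by linarith)))).trans (hvL n)
  set B := Metric.ball (0 : Ed d) 1 with hB
  set c := ∫ x in B, φ x ^ 2 with hc
  have hc0 : 0 < c := sq_pos_int hφ fun x _ => hφp x
  have hcj : ∀ j, 0 < ∫ x in B, v j x ^ 2 := fun j => sq_pos_int (cv j) fun x hx =>
    hvp j x (Metric.ball_subset_ball (by linarith [j.cast_nonneg (α := ℝ)]) hx)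
  have hct : Tendsto (fun j => ∫ x in B, v j x ^ 2) atTop (𝓝 c) := L2_sq_tend cv hφ hΦ Metric.isBounded_ball (hL _ Metric.isBounded_ball)
  set t := fun j => (Real.sqrt (∫ x in B, v j x ^ 2))⁻¹ with ht
  set T := (Real.sqrt c)⁻¹ with hT
  have htT : Tendsto t atTop (𝓝 T) := hct.sqrt.inv₀ (Real.sqrt_pos.2 hc0).ne'
  have hT0 : 0 < T := by positivity
  have ht0 : ∀ j, 0 < t j := fun j => inv_pos.2 (Real.sqrt_pos.2 (hcj j))
  have hQ0 : Tendsto (fun j => QA A W (v j)) atTop (𝓝 0) := squeeze_zero (fun j => hpos _ (hv j)) hvQ hlim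
  refine ⟨fun x => T * φ x, by fun_prop, fun x => mul_pos hT0 (hφp x), fun j x => t j * v j x,
    ⟨fun j => (hv j).cmul _, fun j x => mul_nonneg (ht0 j).le (hv0 j x), ⟨B, Metric.isOpen_ball, Metric.isBounded_ball, fun j => ?_⟩, ?_⟩, fun K hK => ?_⟩
  · simp only [mul_pow]
    rw [integral_const_mul, ht]
    simp only []
    rw [inv_pow, Real.sq_sqrt (hcj j).le, inv_mul_cancel₀ (hcj j).ne']
  · simp only [QA_cmul (hv _)]
    simpa using (htT.pow 2).mul hQ0
  · have e : Tendsto (fun j => 2 * t j ^ 2 * (∫ x in K, (v j x - φ x) ^ 2) + 2 * (t j - T) ^ 2 * ∫ x in K, φ x ^ 2) atTop (𝓝 0) := by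
      have h1 := ((htT.pow 2).const_mul 2).mul (hL K hK.isBounded)
      have h2 := (((htT.sub_const T).pow 2).const_mul 2).mul_const (∫ x in K, φ x ^ 2)
      simpa using h1.add h2
    refine squeeze_zero (fun n => integral_nonneg fun x => sq_nonneg _) (fun j => ?_) e
    have := cv j
    have hKb := hK.isBounded
    have i1 : IntegrableOn (fun x => 2 * t j ^ 2 * (v j x - φ x) ^ 2) K := cont_intOn (by fun_prop) hKb
    have i2 : IntegrableOn (fun x => 2 * (t j - T) ^ 2 * φ x ^ 2) K := cont_intOn (by fun_prop) hKb
    rw [← integral_const_mul, ← integral_const_mul, ← integral_add i1 i2]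
    refine setIntegral_mono (cont_intOn (by fun_prop) hKb) (I_add i1 i2) fun x => ?_
    simp only []
    nlinarith [sq_nonneg (t j * (v j x - φ x) - (t j - T) * φ x)]

end nul

section fin
variable {d : ℕ} {A : Ed d → Fin d → Fin d → ℝ} {W : Ed d → ℝ} {μ M : ℝ}

lemma QA_sub (h : Coef A W μ M) {u : Ed d → ℝ} (hu : IsTest u) (l : ℝ) :
    QA A (fun x => W x - l) u = QA A W u - l * ∫ x, u x ^ 2 := by
  have cu := hu.cont
  have i2 : Integrable fun x => l * u x ^ 2 :=
    hu.integrable_cont (by fun_prop) fun x hx => by rw [image_eq_zero_of_notMem_tsupport hx]; simp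
  rw [QA_eq, QA_eq, ← integral_const_mul, ← integral_sub (den_integrable h hu.c1 hu.c1 hu.2) i2]
  congr 1; ext x; unfold den; ring

lemma QA_low (h : Coef A W μ M) {u : Ed d → ℝ} (hu : IsTest u) : -M * ∫ x, u x ^ 2 ≤ QA A W u := by
  have cu := hu.cont
  have i2 : Integrable fun x => -M * u x ^ 2 :=
    hu.integrable_cont (by fun_prop) fun x hx => by rw [image_eq_zero_of_notMem_tsupport hx]; simp
  rw [QA_eq, ← integral_const_mul]
  refine integral_mono i2 (den_integrable h hu.c1 hu.c1 hu.2) fun x => ?_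
  unfold den
  rw [bilA_self]
  have h1 := quadA_nonneg (x := x) h (gradient u x)
  have h2 := mul_le_mul_of_nonneg_right (abs_le.1 (h.bW x)).1 (sq_nonneg (u x))
  simp only []; linarith

end fin

/-- Corollary 11.5: for a ℤ^d-periodic uniformly elliptic divergence-form operator
`P = -∇·(A∇) + V` on ℝ^d with generalized principal eigenvalue `λ₀`, the shifted
functional `Q(u) = ∫ (⟨A∇u, ∇u⟩ + (V - λ₀)u²)` is critical iff `d ≤ 2`. -/
theorem stmt9 (d : ℕ) (hd : 0 < d) (A : Ed d → Fin d → Fin d → ℝ) (V : Ed d → ℝ)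
    (hAm : Measurable A) (hVm : Measurable V)
    (hAsym : ∀ x i j, A x i j = A x j i)
    (hAper : ∀ (x : Ed d) (i : Fin d), A (x + EuclideanSpace.single i 1) = A x)
    (hVper : ∀ (x : Ed d) (i : Fin d), V (x + EuclideanSpace.single i 1) = V x)
    (μ : ℝ) (hμ : 1 < μ)
    (hell : ∀ (x : Ed d) (ξ : Ed d),
      μ⁻¹ * ‖ξ‖ ^ 2 ≤ quadA A x ξ ∧ quadA A x ξ ≤ μ * ‖ξ‖ ^ 2)
    (hVbdd : ∃ M : ℝ, ∀ᵐ x ∂(volume : Measure (Ed d)), |V x| ≤ M)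
    (lam0 : ℝ)
    (hlam0 : lam0 = sSup {l : ℝ | ∀ u, IsTest u → l * ∫ x, u x ^ 2 ≤ QA A V u}) :
    CriticalA A (fun x => V x - lam0) ↔ d ≤ 2 := by
  obtain ⟨M, hM⟩ := hVbdd
  set m := |M| with hm
  have hm0 : 0 ≤ m := abs_nonneg M
  set V' : Ed d → ℝ := fun x => max (-m) (min m (V x)) with hV'
  have hVV : ∀ᵐ x ∂(volume : Measure (Ed d)), V x = V' x := by
    filter_upwards [hM] with x hx
    have h1 := abs_le.1 (hx.trans (le_abs_self M))
    rw [hV']; simp only []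
    rw [min_eq_right h1.2, max_eq_right h1.1]
  have hC' : Coef A V' μ m := ⟨hAm, measurable_const.max (measurable_const.min hVm), hAsym, hell, hμ, fun x =>
    abs_le.2 ⟨le_max_left _ _, max_le (by linarith) (min_le_left _ _)⟩⟩
  set W : Ed d → ℝ := fun x => V' x - lam0 with hW
  have hC : Coef A W μ (m + |lam0|) := ⟨hAm, hC'.mW.sub_const _, hAsym, hell, hμ, fun x =>
    (abs_sub _ _).trans (by linarith [hC'.bW x])⟩
  have hQV : QA A V = QA A V' := by
    ext u; refine integral_congr_ae ?_
    filter_upwards [hVV] with x hx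
    rw [hx]
  have hQW : QA A (fun x => V x - lam0) = QA A W := by
    ext u; refine integral_congr_ae ?_
    filter_upwards [hVV] with x hx
    simp only [hW]; rw [hx]
  have hcr : CriticalA A (fun x => V x - lam0) ↔ CriticalA A W := by
    unfold CriticalA GroundStateA NullSeqA; rw [hQW]
  rw [hcr]
  rw [hQV] at hlam0
  set S := {l : ℝ | ∀ u, IsTest u → l * ∫ x, u x ^ 2 ≤ QA A V' u} with hS
  have hSne : S.Nonempty := ⟨-m, fun u hu => QA_low hC' hu⟩
  obtain ⟨χ, hχ, -, hχ1, -⟩ := exists_cut (d := d) 1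
  have hSb : BddAbove S := by
    have h1 : 0 < ∫ x, χ x ^ 2 := by
      have cχ := hχ.cont
      have := sq_pos_int hχ.cont fun x hx => by rw [hχ1 x hx]; exact one_pos
      exact this.trans_le (setIntegral_le_integral (hχ.integrable_cont (by fun_prop) fun x hx => by
        rw [image_eq_zero_of_notMem_tsupport hx]; simp) (ae_of_all _ fun x => sq_nonneg _))
    exact ⟨QA A V' χ / ∫ x, χ x ^ 2, fun l hl => (le_div_iff₀ h1).2 (hl χ hχ)⟩
  have hmem : lam0 ∈ S := fun u hu => by
    have h0 : 0 ≤ ∫ x, u x ^ 2 := integral_nonneg fun x => sq_nonneg _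
    rcases h0.lt_or_eq with h1 | h1
    · rw [← le_div_iff₀ h1, hlam0]
      exact csSup_le hSne fun l hl => (le_div_iff₀ h1).2 (hl u hu)
    · have := QA_low hC' hu
      rw [← h1] at this ⊢; linarith
  have hpos : ∀ u, IsTest u → 0 ≤ QA A W u := fun u hu => by
    rw [hW, QA_sub hC' hu]; linarith [hmem u hu]
  have hWper : ∀ (x : Ed d) (i : Fin d), W (x + EuclideanSpace.single i 1) = W x := fun x i => by
    simp only [hW, hV', hVper]
  constructor
  · rintro ⟨-, φ, hφ⟩
    by_contra hcon
    exact noncrit (by omega) hC hAper hWper hpos hφ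
  · intro hd2
    obtain ⟨u, hu⟩ := appr hC hpos (per_of hAper) (per_of hWper) (fun ε hε => by
      have hn : lam0 + ε ∉ S := fun hc => by
        have := le_csSup hSb hc
        rw [← hlam0] at this; linarith
      simp only [hS, Set.mem_ofPred_eq, not_forall, not_le] at hn
      obtain ⟨a, ha, hlt⟩ := hn
      have h0 : 0 ≤ ∫ x, a x ^ 2 := integral_nonneg fun x => sq_nonneg _
      have hlow := hmem a ha
      have h1 : 0 < ∫ x, a x ^ 2 := by
        rcases h0.lt_or_eq with h1 | h1
        · exact h1
        · rw [← h1] at hlt hlow; linarith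
      have e : ((Real.sqrt (∫ x, a x ^ 2))⁻¹) ^ 2 = (∫ x, a x ^ 2)⁻¹ := by rw [inv_pow, Real.sq_sqrt h0]
      refine ⟨fun x => (Real.sqrt (∫ x, a x ^ 2))⁻¹ * a x, ha.cmul _, ?_, ?_⟩
      · simp only [mul_pow]
        rw [integral_const_mul, e, inv_mul_cancel₀ h1.ne']
      · rw [QA_cmul ha, e, inv_mul_lt_iff₀ h1, hW, QA_sub hC' ha]
        linarith)
    exact crit hd hd2 hC hpos hu
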